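/- There are no minimal pairs in the K-degrees of computably enumerable sets: for any two computably enumerable sets A and D, neither of which is K-trivial, there exists a computably enumerable set B which is not K-trivial and satisfies B ≤_K A and B ≤_K D. -/

import Mathlib

open Part Filter

open scoped Classical

namespace KPaper

/-- Binary strings. -/
abbrev Str := List Bool

/-! ### Oracle (Turing) reducibility -/

/-- The functions `ℕ →. ℕ` that are partial recursive relative to an oracle `O : ℕ →. ℕ`.
This mirrors Mathlib's `Nat.Partrec`, with an extra base case for the oracle. -/
inductive RecursiveIn (O : ℕ →. ℕ) : (ℕ →. ℕ) → Prop
  | oracle : RecursiveIn O O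
  | zero : RecursiveIn O (pure 0)
  | succ : RecursiveIn O ↑Nat.succ
  | left : RecursiveIn O ↑fun n : ℕ => n.unpair.1
  | right : RecursiveIn O ↑fun n : ℕ => n.unpair.2
  | pair {f g} : RecursiveIn O f → RecursiveIn O g →
      RecursiveIn O fun n => Nat.pair <$> f n <*> g n
  | comp {f g} : RecursiveIn O f → RecursiveIn O g → RecursiveIn O fun n => g n >>= f
  | prec {f g} : RecursiveIn O f → RecursiveIn O g → RecursiveIn O (Nat.unpaired fun a n =>
      n.rec (f a) fun y IH => do let i ← IH; g (Nat.pair a (Nat.pair y i)))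
  | rfind {f} : RecursiveIn O f →
      RecursiveIn O fun a => Nat.rfind fun n => (fun m => m = 0) <$> f (Nat.pair a n)

/-- The characteristic (partial) function of a set of naturals, used as a Turing oracle. -/
noncomputable def chi (A : Set ℕ) : ℕ →. ℕ := fun n => Part.some (if n ∈ A then 1 else 0)

/-- The characteristic function of an infinite binary sequence, used as a Turing oracle. -/
def chiSeq (X : ℕ → Bool) : ℕ →. ℕ := fun n => Part.some (cond (X n) 1 0)

/-- `A` is Turing reducible to `B`. -/
noncomputable def TuringLeSet (A B : Set ℕ) : Prop := RecursiveIn (chi B) (chi A)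

/-- `A` is Turing equivalent to `B`. -/
noncomputable def TuringEquivSet (A B : Set ℕ) : Prop := TuringLeSet A B ∧ TuringLeSet B A

/-- Turing equivalence between a set and an infinite binary sequence. -/
noncomputable def TuringEquivSetSeq (A : Set ℕ) (X : ℕ → Bool) : Prop :=
  RecursiveIn (chiSeq X) (chi A) ∧ RecursiveIn (chi A) (chiSeq X)

/-- The halting problem `∅'`. -/
def haltingSet : Set ℕ := {n | ((Denumerable.ofNat Nat.Partrec.Code n).eval n).Dom}

/-- A set of naturals is computably enumerable iff it is the domain of a
partial computable function. -/
def CESet (A : Set ℕ) : Prop := ∃ f : ℕ →. ℕ, Nat.Partrec f ∧ ∀ n, n ∈ A ↔ (f n).Dom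

/-! ### Machines and Kolmogorov complexity -/

/-- A (plain) machine is a partial computable map from binary strings to binary strings. -/
def PlainMachine (M : Str →. Str) : Prop := Partrec M

/-- A prefix-free machine: a partial computable map on binary strings whose
domain is an antichain under the prefix relation. -/
def PFMachine (M : Str →. Str) : Prop :=
  Partrec M ∧ ∀ ρ₁ ρ₂ : Str, (M ρ₁).Dom → (M ρ₂).Dom → ρ₁ <+: ρ₂ → ρ₁ = ρ₂

/-- The Kolmogorov complexity of a string `σ` with respect to a machine `M`:
the least length of an `M`-description of `σ` (`⊤` if there is none). -/
noncomputable def KC (M : Str →. Str) (σ : Str) : ℕ∞ :=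
  ⨅ ρ : {ρ : Str // σ ∈ M ρ}, ((ρ : Str).length : ℕ∞)

/-- An optimal prefix-free machine: a prefix-free machine whose associated complexity
is minimal, up to an additive constant, among all prefix-free machines. -/
def OptimalPF (U : Str →. Str) : Prop :=
  PFMachine U ∧ ∀ M : Str →. Str, PFMachine M → ∃ c : ℕ, ∀ σ : Str, KC U σ ≤ KC M σ + c

/-- An optimal plain machine. -/
def OptimalPlain (V : Str →. Str) : Prop :=
  PlainMachine V ∧ ∀ M : Str →. Str, PlainMachine M → ∃ c : ℕ, ∀ σ : Str, KC V σ ≤ KC M σ + c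

/-! ### Initial segments -/

/-- The first `n` bits of the characteristic sequence of a set of naturals. -/
noncomputable def restrSet (A : Set ℕ) (n : ℕ) : Str :=
  (List.range n).map fun i => decide (i ∈ A)

/-- The first `n` bits of an infinite binary sequence. -/
def restrSeq (X : ℕ → Bool) (n : ℕ) : Str := (List.range n).map X

/-- The string `0^n`; `K(n)` is identified with `K(0^n)`. -/
def zeroStr (n : ℕ) : Str := List.replicate n false

/-! ### `≤_K`, `<_K`, `K`-triviality (and the `≤_C` analogues) -/

def KLeSet (U : Str →. Str) (A B : Set ℕ) : Prop :=
  ∃ c : ℕ, ∀ n, KC U (restrSet A n) ≤ KC U (restrSet B n) + c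

def KLtSet (U : Str →. Str) (A B : Set ℕ) : Prop := KLeSet U A B ∧ ¬ KLeSet U B A

def KTrivialSet (U : Str →. Str) (A : Set ℕ) : Prop :=
  ∃ c : ℕ, ∀ n, KC U (restrSet A n) ≤ KC U (zeroStr n) + c

def KLeSeq (U : Str →. Str) (X Y : ℕ → Bool) : Prop :=
  ∃ c : ℕ, ∀ n, KC U (restrSeq X n) ≤ KC U (restrSeq Y n) + c

def KLtSeq (U : Str →. Str) (X Y : ℕ → Bool) : Prop := KLeSeq U X Y ∧ ¬ KLeSeq U Y X

def KTrivialSeq (U : Str →. Str) (X : ℕ → Bool) : Prop :=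
  ∃ c : ℕ, ∀ n, KC U (restrSeq X n) ≤ KC U (zeroStr n) + c

/-! ### Computably enumerable reals -/

/-- The real number in `[0,1]` whose binary expansion is the sequence `X`. -/
noncomputable def realOfSeq (X : ℕ → Bool) : ℝ := ∑' i : ℕ, cond (X i) ((2 : ℝ) ^ (i + 1))⁻¹ 0

/-- `X` (identified with the real it is the binary expansion of) is a computably
enumerable real: it is the limit of a nondecreasing computable sequence of
(dyadic) rationals. -/
def CEReal (X : ℕ → Bool) : Prop :=
  ∃ f : ℕ → ℤ, Computable f ∧
    (∀ s, (f s : ℝ) / 2 ^ s ≤ (f (s + 1) : ℝ) / 2 ^ (s + 1)) ∧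
    Tendsto (fun s => (f s : ℝ) / 2 ^ s) atTop (nhds (realOfSeq X))

/-- The characteristic sequence of a set of naturals. -/
noncomputable def seqOfSet (A : Set ℕ) : ℕ → Bool := fun i => decide (i ∈ A)

/-! ### Solovay reducibility -/

/-- Solovay reducibility on c.e. reals: `X ≤_S Y` iff there are nondecreasing computable
rational approximations to `X` and `Y` and a constant `c` such that at each stage the
distance to `X` is bounded by `c` times the distance to `Y`. -/
def SolovayLe (X Y : ℕ → Bool) : Prop :=
  ∃ (c : ℕ) (f g : ℕ → ℤ), Computable f ∧ Computable g ∧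
    (∀ s, (f s : ℝ) / 2 ^ s ≤ (f (s + 1) : ℝ) / 2 ^ (s + 1)) ∧
    (∀ s, (g s : ℝ) / 2 ^ s ≤ (g (s + 1) : ℝ) / 2 ^ (s + 1)) ∧
    Tendsto (fun s => (f s : ℝ) / 2 ^ s) atTop (nhds (realOfSeq X)) ∧
    Tendsto (fun s => (g s : ℝ) / 2 ^ s) atTop (nhds (realOfSeq Y)) ∧
    ∀ s, realOfSeq X - (f s : ℝ) / 2 ^ s ≤ (c : ℝ) * (realOfSeq Y - (g s : ℝ) / 2 ^ s)


/-! ### A small `fun_prop` toolkit for primitive recursive functions -/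
section
variable {α β γ σ : Type*} [Primcodable α] [Primcodable β] [Primcodable γ] [Primcodable σ]

attribute [fun_prop] Primrec

@[fun_prop] theorem pr_id : Primrec (fun a : α => a) := Primrec.id

@[fun_prop] theorem pr_const (c : β) : Primrec (fun _ : α => c) := Primrec.const c

@[fun_prop] theorem pr_comp {f : β → γ} {g : α → β} (hf : Primrec f) (hg : Primrec g) :
    Primrec (fun a => f (g a)) := hf.comp hg

@[fun_prop] theorem pr_pair {f : α → β} {g : α → γ} (hf : Primrec f) (hg : Primrec g) :
    Primrec (fun a => (f a, g a)) := hf.pair hg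

@[fun_prop] theorem pr_fst {f : α → β × γ} (hf : Primrec f) : Primrec (fun a => (f a).1) :=
  Primrec.fst.comp hf

@[fun_prop] theorem pr_snd {f : α → β × γ} (hf : Primrec f) : Primrec (fun a => (f a).2) :=
  Primrec.snd.comp hf

@[fun_prop] theorem pr_unpair {f : α → ℕ} (hf : Primrec f) : Primrec (fun a => (f a).unpair) :=
  Primrec.unpair.comp hf

@[fun_prop] theorem pr_some {f : α → β} (hf : Primrec f) : Primrec (fun a => Option.some (f a)) :=
  Primrec.option_some.comp hf

@[fun_prop] theorem pr_isSome {f : α → Option β} (hf : Primrec f) :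
    Primrec (fun a => (f a).isSome) :=
  Primrec.option_isSome.comp hf

@[fun_prop] theorem pr_add {f g : α → ℕ} (hf : Primrec f) (hg : Primrec g) :
    Primrec (fun a => f a + g a) := Primrec.nat_add.comp hf hg

@[fun_prop] theorem pr_mul {f g : α → ℕ} (hf : Primrec f) (hg : Primrec g) :
    Primrec (fun a => f a * g a) := Primrec.nat_mul.comp hf hg

@[fun_prop] theorem pr_succ {f : α → ℕ} (hf : Primrec f) :
    Primrec (fun a => (f a).succ) := Primrec.succ.comp hf

@[fun_prop] theorem pr_sub {f g : α → ℕ} (hf : Primrec f) (hg : Primrec g) :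
    Primrec (fun a => f a - g a) := Primrec.nat_sub.comp hf hg

@[fun_prop] theorem pr_pow {f g : α → ℕ} (hf : Primrec f) (hg : Primrec g) :
    Primrec (fun a => f a ^ g a) := (Primrec₂.unpaired'.1 Nat.Primrec.pow).comp hf hg

@[fun_prop] theorem pr_ble {f g : α → ℕ} (hf : Primrec f) (hg : Primrec g) :
    Primrec (fun a => decide (f a ≤ g a)) := Primrec.nat_le.decide.comp hf hg

@[fun_prop] theorem pr_blt {f g : α → ℕ} (hf : Primrec f) (hg : Primrec g) :
    Primrec (fun a => decide (f a < g a)) := Primrec.nat_lt.decide.comp hf hg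

@[fun_prop] theorem pr_beq [DecidableEq β] {f g : α → β} (hf : Primrec f) (hg : Primrec g) :
    Primrec (fun a => decide (f a = g a)) := Primrec.eq.decide.comp hf hg

@[fun_prop] theorem pr_not {f : α → Bool} (hf : Primrec f) : Primrec (fun a => !(f a)) :=
  Primrec.not.comp hf

@[fun_prop] theorem pr_and {f g : α → Bool} (hf : Primrec f) (hg : Primrec g) :
    Primrec (fun a => f a && g a) := Primrec.and.comp hf hg

@[fun_prop] theorem pr_or {f g : α → Bool} (hf : Primrec f) (hg : Primrec g) :
    Primrec (fun a => f a || g a) := Primrec.or.comp hf hg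

@[fun_prop] theorem pr_cond {c : α → Bool} {f g : α → σ} (hc : Primrec c) (hf : Primrec f)
    (hg : Primrec g) : Primrec (fun a => cond (c a) (f a) (g a)) := Primrec.cond hc hf hg

@[fun_prop] theorem pr_rec {c : α → ℕ} {f : α → σ} {g : α → ℕ → σ → σ} (hc : Primrec c)
    (hf : Primrec f) (hg : Primrec fun p : α × ℕ × σ => g p.1 p.2.1 p.2.2) :
    Primrec (fun a => Nat.rec (motive := fun _ => σ) (f a) (g a) (c a)) :=
  Primrec.nat_rec' (h := fun a p => g a p.1 p.2) hc hf hg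

@[fun_prop] theorem pr_elim {o : α → Option β} {f : α → σ} {g : α → β → σ} (ho : Primrec o)
    (hf : Primrec f) (hg : Primrec fun p : α × β => g p.1 p.2) :
    Primrec (fun a => (o a).elim (f a) (g a)) :=
  (Primrec.option_casesOn ho hf hg).of_eq fun a => by cases o a <;> rfl

@[fun_prop] theorem pr_map {f : α → List β} {g : α → β → σ} (hf : Primrec f)
    (hg : Primrec fun p : α × β => g p.1 p.2) : Primrec (fun a => (f a).map (g a)) :=
  Primrec.list_map hf hg

@[fun_prop] theorem pr_flatMap {f : α → List β} {g : α → β → List σ} (hf : Primrec f)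
    (hg : Primrec fun p : α × β => g p.1 p.2) : Primrec (fun a => (f a).flatMap (g a)) :=
  Primrec.list_flatMap hf hg

@[fun_prop] theorem pr_cons {f : α → β} {g : α → List β} (hf : Primrec f) (hg : Primrec g) :
    Primrec (fun a => f a :: g a) := Primrec.list_cons.comp hf hg

@[fun_prop] theorem pr_append {f : α → List β} {g : α → List β} (hf : Primrec f)
    (hg : Primrec g) : Primrec (fun a => f a ++ g a) := Primrec.list_append.comp hf hg

@[fun_prop] theorem pr_length {f : α → List β} (hf : Primrec f) :
    Primrec (fun a => (f a).length) := Primrec.list_length.comp hf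

@[fun_prop] theorem pr_range {f : α → ℕ} (hf : Primrec f) :
    Primrec (fun a => List.range (f a)) := Primrec.list_range.comp hf

@[fun_prop] theorem pr_foldl {f : α → List β} {g : α → σ} {h : α → σ → β → σ}
    (hf : Primrec f) (hg : Primrec g) (hh : Primrec fun p : α × σ × β => h p.1 p.2.1 p.2.2) :
    Primrec (fun a => (f a).foldl (h a) (g a)) :=
  Primrec.list_foldl (h := fun a p => h a p.1 p.2) hf hg hh

theorem filter_eq_flatMap (l : List β) (p : β → Bool) :
    l.filter p = l.flatMap (fun b => cond (p b) [b] []) := by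
  induction l with
  | nil => rfl
  | cons b l ih => cases h : p b <;> simp [List.filter_cons, h, ih]

@[fun_prop] theorem pr_filter {f : α → List β} {g : α → β → Bool} (hf : Primrec f)
    (hg : Primrec fun p : α × β => g p.1 p.2) : Primrec (fun a => (f a).filter (g a)) := by
  simp only [filter_eq_flatMap]
  fun_prop

theorem sum_eq_foldl (l : List ℕ) : l.sum = l.foldl (fun x y => x + y) 0 := by
  rw [List.sum_eq_foldl]

@[fun_prop] theorem pr_sum {f : α → List ℕ} (hf : Primrec f) :
    Primrec (fun a => (f a).sum) := by
  simp only [sum_eq_foldl]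
  fun_prop

theorem all_eq_foldl (l : List β) (p : β → Bool) (b : Bool) :
    (b && l.all p) = l.foldl (fun x y => x && p y) b := by
  induction l generalizing b with
  | nil => simp
  | cons a l ih => simp [← ih, Bool.and_assoc]

@[fun_prop] theorem pr_all {f : α → List β} {g : α → β → Bool} (hf : Primrec f)
    (hg : Primrec fun p : α × β => g p.1 p.2) : Primrec (fun a => (f a).all (g a)) := by
  have : (fun a => (f a).all (g a)) = fun a => (f a).foldl (fun x y => x && g a y) true := by
    funext a; rw [← all_eq_foldl]; simp
  rw [this]
  fun_prop

@[fun_prop] theorem pr_any {f : α → List β} {g : α → β → Bool} (hf : Primrec f)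
    (hg : Primrec fun p : α × β => g p.1 p.2) : Primrec (fun a => (f a).any (g a)) := by
  have : (fun a => (f a).any (g a)) = fun a => !((f a).all (fun x => !(g a x))) := by
    funext a; simp [List.not_all_eq_any_not]
  rw [this]
  fun_prop

@[fun_prop] theorem pr_dcond {c : α → Bool} (hc : Primrec c) :
    Primrec (fun a => decide (c a = true)) := by
  simpa using hc

end

/-! ### The Kraft-Chaitin theorem -/

/-- the binary value of a string -/
def bval (l : Str) : ℕ := l.foldl (fun x b => 2 * x + cond b 1 0) 0

@[fun_prop] theorem pr_bval {α} [Primcodable α] {f : α → Str} (hf : Primrec f) :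
    Primrec (fun a => bval (f a)) := by
  unfold bval; fun_prop

theorem bval_append_aux (l : Str) (a : ℕ) :
    l.foldl (fun x b => 2 * x + cond b 1 0) a = a * 2 ^ l.length + bval l := by
  induction l generalizing a with
  | nil => simp [bval]
  | cons b l ih =>
    simp only [List.foldl_cons, List.length_cons, bval]
    rw [ih, ih (2 * 0 + _)]; ring

theorem bval_append (l m : Str) : bval (l ++ m) = bval l * 2 ^ m.length + bval m := by
  conv_lhs => unfold bval
  rw [List.foldl_append, bval_append_aux]; rfl

theorem bval_lt (l : Str) : bval l < 2 ^ l.length := by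
  induction l using List.reverseRecOn with
  | nil => simp [bval]
  | append_singleton l b ih =>
    rw [bval_append]
    have h1 : bval [true] = 1 := rfl
    have h2 : bval [false] = 0 := rfl
    cases b <;> simp [h1, h2, pow_succ] <;> omega

theorem exists_bval (n a : ℕ) (h : a < 2 ^ n) : ∃ l : Str, l.length = n ∧ bval l = a := by
  induction n generalizing a with
  | zero => exact ⟨[], rfl, by simp at h; simp [bval, h]⟩
  | succ n ih =>
    obtain ⟨l, h1, h2⟩ := ih (a / 2) (by rw [pow_succ] at h; omega)
    refine ⟨l ++ [decide (a % 2 = 1)], by simp [h1], ?_⟩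
    rw [bval_append, h2]
    by_cases hh : a % 2 = 1 <;> simp [bval, hh] <;> omega

/-- the weight of a request -/
noncomputable def rwt (R : ℕ → Option (ℕ × Str)) (i : ℕ) : ℝ :=
  (R i).elim 0 fun p => (1 / 2 : ℝ) ^ p.1

theorem rwt_nonneg (R : ℕ → Option (ℕ × Str)) (i : ℕ) : 0 ≤ rwt R i := by
  unfold rwt; cases R i <;> simp

/-- numerator and exponent of the sum of the first requests -/
def kcs (R : ℕ → Option (ℕ × Str)) (i : ℕ) : ℕ × ℕ :=
  Nat.rec (motive := fun _ => ℕ × ℕ) (0, 0)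
    (fun i y => (R i).elim y (fun p => (y.1 * 2 ^ p.1 + 2 ^ y.2, y.2 + p.1))) i

theorem kcs_spec (R : ℕ → Option (ℕ × Str)) (i : ℕ) :
    ((kcs R i).1 : ℝ) = (∑ j ∈ Finset.range i, rwt R j) * 2 ^ (kcs R i).2 := by
  induction i with
  | zero => simp [kcs]
  | succ i ih =>
    rw [Finset.sum_range_succ]
    have : kcs R (i+1) = (R i).elim (kcs R i)
      (fun p => ((kcs R i).1 * 2 ^ p.1 + 2 ^ (kcs R i).2, (kcs R i).2 + p.1)) := rfl
    rw [this]
    have hr : rwt R i = (R i).elim 0 fun p => (1 / 2 : ℝ) ^ p.1 := rfl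
    rw [hr]
    cases h : R i with
    | none => simpa using ih
    | some p =>
      simp only [Option.elim]
      push_cast
      rw [ih, pow_add, add_mul]
      have : (1/2:ℝ)^p.1 * 2^p.1 = 1 := by rw [← mul_pow]; norm_num
      linear_combination (-2^(kcs R i).2 : ℝ) * this

/-- `ρ` is the code of request `i` -/
def kctest (R : ℕ → Option (ℕ × Str)) (ρ : Str) (i : ℕ) : Option Str :=
  (R i).elim none fun p =>
    cond (decide (ρ.length = p.1 + 1) &&
      decide ((kcs R i).1 * 2 ^ ρ.length ≤ bval ρ * 2 ^ (kcs R i).2) &&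
      decide (bval ρ * 2 ^ (kcs R i).2 < (kcs R i).1 * 2 ^ ρ.length + 2 ^ (kcs R i).2))
    (Option.some p.2) Option.none

theorem kctest_prim (R : ℕ → Option (ℕ × Str)) (hR : Primrec R) :
    Primrec (fun p : Str × ℕ => kctest R p.1 p.2) := by
  have : Primrec (kcs R) := by unfold kcs; fun_prop
  unfold kctest
  fun_prop

theorem kctest_spec (R : ℕ → Option (ℕ × Str)) (ρ τ : Str) (i : ℕ)
    (h : kctest R ρ i = Option.some τ) : ∃ r, R i = Option.some (r, τ) ∧ ρ.length = r + 1 ∧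
      (∑ j ∈ Finset.range i, rwt R j) ≤ bval ρ * (1/2:ℝ) ^ ρ.length ∧
      (bval ρ + 1) * (1/2:ℝ) ^ ρ.length ≤ ∑ j ∈ Finset.range (i+1), rwt R j := by
  unfold kctest at h
  cases hi : R i with
  | none => simp [hi] at h
  | some p =>
    simp only [hi, Option.elim] at h
    cases hc : (decide (ρ.length = p.1 + 1) &&
      decide ((kcs R i).1 * 2 ^ ρ.length ≤ bval ρ * 2 ^ (kcs R i).2) &&
      decide (bval ρ * 2 ^ (kcs R i).2 < (kcs R i).1 * 2 ^ ρ.length + 2 ^ (kcs R i).2)) with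
    | false => rw [hc] at h; simp at h
    | true =>
      rw [hc] at h
      simp only [cond_true, Option.some.injEq] at h
      simp only [Bool.and_eq_true, decide_eq_true_eq] at hc
      obtain ⟨⟨h1, h2⟩, h3⟩ := hc
      have h2' : ((kcs R i).1 : ℝ) * 2 ^ ρ.length ≤ bval ρ * 2 ^ (kcs R i).2 := by
        exact_mod_cast h2
      have h3' : (bval ρ : ℝ) * 2 ^ (kcs R i).2 < (kcs R i).1 * 2 ^ ρ.length + 2 ^ (kcs R i).2 := by
        exact_mod_cast h3
      rw [kcs_spec] at h2' h3'
      have hpos : (0:ℝ) < 2 ^ (kcs R i).2 := by positivity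
      have hpos2 : (0:ℝ) < 2 ^ ρ.length := by positivity
      have e : (1/2:ℝ)^ρ.length * 2^ρ.length = 1 := by rw [← mul_pow]; norm_num
      have h4 : (∑ j ∈ Finset.range i, rwt R j) * 2 ^ ρ.length ≤ bval ρ := by
        nlinarith
      have h5 : (bval ρ : ℝ) < (∑ j ∈ Finset.range i, rwt R j) * 2 ^ ρ.length + 1 := by
        nlinarith
      refine ⟨p.1, by rw [← h], h1, ?_, ?_⟩
      · rw [← mul_le_mul_iff_left₀ hpos2]; rw [mul_assoc, e]; linarith
      · rw [← mul_le_mul_iff_left₀ hpos2]; rw [mul_assoc, e, Finset.sum_range_succ]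
        have : rwt R i * 2^ρ.length = 2 := by
          simp only [rwt, hi, Option.elim, h1, pow_succ]
          rw [← mul_assoc, ← mul_pow]; norm_num
        linarith

theorem pfx_interval {ρ₁ ρ₂ : Str} (h : ρ₁ <+: ρ₂) :
    bval ρ₁ * (1/2:ℝ) ^ ρ₁.length ≤ bval ρ₂ * (1/2:ℝ) ^ ρ₂.length ∧
    (bval ρ₂ + 1) * (1/2:ℝ) ^ ρ₂.length ≤ (bval ρ₁ + 1) * (1/2:ℝ) ^ ρ₁.length := by
  obtain ⟨m, rfl⟩ := h
  rw [bval_append, List.length_append, pow_add]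
  push_cast
  have e : (1/2:ℝ)^m.length * 2^m.length = 1 := by rw [← mul_pow]; norm_num
  have h1 := bval_lt m
  have h2 : (bval m : ℝ) + 1 ≤ 2 ^ m.length := by exact_mod_cast h1
  have h3 : (0:ℝ) ≤ bval m := by positivity
  set x : ℝ := (1/2:ℝ)^ρ₁.length
  set y : ℝ := (1/2:ℝ)^m.length
  have hx : 0 ≤ x := by positivity
  have hy : 0 ≤ y := by positivity
  constructor
  · have : ((bval ρ₁:ℝ) * 2^m.length + bval m) * (x * y) = bval ρ₁ * x + bval m * (x * y) := by
      linear_combination (bval ρ₁ * x : ℝ) * e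
    rw [this]; nlinarith [mul_nonneg h3 (mul_nonneg hx hy)]
  · have : ((bval ρ₁:ℝ) * 2^m.length + bval m + 1) * (x * y) =
      bval ρ₁ * x + (bval m + 1) * (x * y) := by
      linear_combination (bval ρ₁ * x : ℝ) * e
    rw [this]
    have : (bval m + 1) * (x * y) ≤ 2^m.length * (x*y) :=
      mul_le_mul_of_nonneg_right h2 (mul_nonneg hx hy)
    have e2 : 2^m.length * (x*y) = x := by linear_combination x * e
    linarith

theorem kctest_unique (R : ℕ → Option (ℕ × Str)) {ρ₁ ρ₂ τ₁ τ₂ : Str} {i j : ℕ}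
    (h1 : kctest R ρ₁ i = Option.some τ₁) (h2 : kctest R ρ₂ j = Option.some τ₂) (h : ρ₁ <+: ρ₂) :
    i = j ∧ ρ₁ = ρ₂ := by
  obtain ⟨r1, a1, b1, c1, d1⟩ := kctest_spec R _ _ _ h1
  obtain ⟨r2, a2, b2, c2, d2⟩ := kctest_spec R _ _ _ h2
  obtain ⟨p1, p2⟩ := pfx_interval h
  have hmono : ∀ a b, a ≤ b → ∑ k ∈ Finset.range a, rwt R k ≤ ∑ k ∈ Finset.range b, rwt R k := by
    intro a b hab
    exact Finset.sum_le_sum_of_subset_of_nonneg (by simpa using hab)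
      (fun _ _ _ => rwt_nonneg R _)
  have pos : (0:ℝ) < (1/2:ℝ)^ρ₂.length := by positivity
  have hij : i = j := by
    rcases lt_trichotomy i j with hl | hl | hl
    · have := hmono (i+1) j hl
      nlinarith
    · exact hl
    · have := hmono (j+1) i hl
      nlinarith
  refine ⟨hij, ?_⟩
  subst hij
  rw [a1] at a2
  have : r1 = r2 := by simpa using congrArg (fun x => (x.map Prod.fst)) a2
  exact h.eq_of_length (by omega)

/-- Kraft-Chaitin for total weight at most one -/
theorem kc_one {U : Str →. Str} (hU : OptimalPF U) (R : ℕ → Option (ℕ × Str)) (hR : Primrec R)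
    (hs : ∀ n, ∑ i ∈ Finset.range n, rwt R i ≤ 1) :
    ∃ c : ℕ, ∀ i r τ, R i = Option.some (r, τ) → KC U τ ≤ ((r + c : ℕ) : ℕ∞) := by
  let M : Str →. Str := fun ρ => Nat.rfindOpt (kctest R ρ)
  have hM : PFMachine M := by
    constructor
    · exact Partrec.rfindOpt (kctest_prim R hR).to_comp
    · intro ρ₁ ρ₂ h1 h2 h
      obtain ⟨i, τ₁, hi⟩ := Nat.rfindOpt_dom.1 h1
      obtain ⟨j, τ₂, hj⟩ := Nat.rfindOpt_dom.1 h2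
      exact (kctest_unique R hi hj h).2
  obtain ⟨c, hc⟩ := hU.2 M hM
  refine ⟨c + 1, fun i r τ hi => ?_⟩
  -- find the code
  set S := ∑ j ∈ Finset.range i, rwt R j with hS
  have hS0 : 0 ≤ S := Finset.sum_nonneg fun j _ => rwt_nonneg R j
  have hw : rwt R i = (1/2:ℝ)^r := by simp [rwt, hi]
  have hS1 : S + (1/2:ℝ)^r ≤ 1 := by
    have := hs (i+1); rw [Finset.sum_range_succ, hw] at this; exact this
  have e : (1/2:ℝ)^r * 2^(r+1) = 2 := by rw [pow_succ, ← mul_assoc, ← mul_pow]; norm_num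
  set a := ⌈S * 2^(r+1)⌉₊ with ha
  have ha1 : S * 2^(r+1) ≤ a := Nat.le_ceil _
  have ha2 : (a:ℝ) < S * 2^(r+1) + 1 := Nat.ceil_lt_add_one (by positivity)
  have ha3 : a < 2^(r+1) := by
    have : (a:ℝ) < 2^(r+1) := by
      have : (0:ℝ) < 2^(r+1) := by positivity
      nlinarith
    exact_mod_cast this
  obtain ⟨ρ, hl, hv⟩ := exists_bval (r+1) a ha3
  have ht : kctest R ρ i = Option.some τ := by
    have hk := kcs_spec R i
    rw [← hS] at hk
    have p2 : (0:ℝ) < 2^(kcs R i).2 := by positivity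
    unfold kctest
    simp only [hi, Option.elim]
    have : (decide (ρ.length = r + 1) &&
      decide ((kcs R i).1 * 2 ^ ρ.length ≤ bval ρ * 2 ^ (kcs R i).2) &&
      decide (bval ρ * 2 ^ (kcs R i).2 < (kcs R i).1 * 2 ^ ρ.length + 2 ^ (kcs R i).2)) = true := by
      simp only [Bool.and_eq_true, decide_eq_true_eq]
      refine ⟨⟨hl, ?_⟩, ?_⟩
      · rw [← Nat.cast_le (α := ℝ)]; push_cast; rw [hk, hl, hv]
        nlinarith
      · rw [← Nat.cast_lt (α := ℝ)]; push_cast; rw [hk, hl, hv]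
        nlinarith
    rw [this]; rfl
  have hm : τ ∈ M ρ := by
    have hd : (M ρ).Dom := Nat.rfindOpt_dom.2 ⟨i, τ, ht⟩
    obtain ⟨j, hj⟩ := Nat.rfindOpt_spec (Part.get_mem hd)
    have := (kctest_unique R ht hj (List.prefix_refl _)).1
    subst this
    have hj' : kctest R ρ i = Option.some ((M ρ).get hd) := hj
    rw [ht] at hj'
    have : τ = (M ρ).get hd := by simpa using hj'
    rw [this]; exact Part.get_mem hd
  calc KC U τ ≤ KC M τ + c := hc τ
    _ ≤ (ρ.length : ℕ∞) + c := by
        gcongr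
        exact iInf_le (fun ρ : {ρ // τ ∈ M ρ} => ((ρ : Str).length : ℕ∞)) ⟨ρ, hm⟩
    _ = _ := by rw [hl]; push_cast; ring

/-- Kraft-Chaitin -/
theorem kc_thm {U : Str →. Str} (hU : OptimalPF U) (R : ℕ → Option (ℕ × Str)) (hR : Primrec R)
    (C : ℕ) (hs : ∀ n, ∑ i ∈ Finset.range n, rwt R i ≤ 2 ^ C) :
    ∃ c : ℕ, ∀ i r τ, R i = Option.some (r, τ) → KC U τ ≤ ((r + c : ℕ) : ℕ∞) := by
  let R' : ℕ → Option (ℕ × Str) := fun i => (R i).elim none fun p => Option.some (p.1 + C, p.2)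
  have hw : ∀ i, rwt R' i = rwt R i * (1/2)^C := by
    intro i; simp only [rwt, R']; cases R i <;> simp [pow_add, mul_comm]
  obtain ⟨c, hc⟩ := kc_one hU R' (by unfold R'; fun_prop) (by
    intro n
    simp only [hw, ← Finset.sum_mul]
    have e : (2:ℝ)^C * (1/2)^C = 1 := by rw [← mul_pow]; norm_num
    have := mul_le_mul_of_nonneg_right (hs n) (show (0:ℝ) ≤ (1/2)^C by positivity)
    linarith)
  refine ⟨C + c, fun i r τ h => ?_⟩
  have := hc i (r + C) τ (by simp [R', h])
  rwa [add_assoc] at this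

theorem KC_le_of_mem {U : Str →. Str} {ρ σ : Str} (h : σ ∈ U ρ) : KC U σ ≤ (ρ.length : ℕ∞) :=
  iInf_le (fun ρ : {ρ // σ ∈ U ρ} => ((ρ : Str).length : ℕ∞)) ⟨ρ, h⟩

theorem le_KC_add {U : Str →. Str} {σ : Str} {K : ℕ∞} {c : ℕ}
    (h : ∀ ρ, σ ∈ U ρ → K ≤ ((ρ.length + c : ℕ) : ℕ∞)) : K ≤ KC U σ + c := by
  unfold KC
  by_cases hn : Nonempty {ρ : Str // σ ∈ U ρ}
  · obtain ⟨⟨ρ, hρ⟩, he⟩ := ciInf_mem (fun ρ : {ρ // σ ∈ U ρ} => ((ρ : Str).length : ℕ∞))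
    have := h ρ hρ
    rw [← he]; exact_mod_cast this
  · rw [not_nonempty_iff] at hn
    rw [iInf_of_empty]; simp

theorem exists_of_KC_le {U : Str →. Str} {σ : Str} {n : ℕ} (h : KC U σ ≤ (n : ℕ∞)) :
    ∃ ρ, σ ∈ U ρ ∧ ρ.length ≤ n := by
  unfold KC at h
  by_cases hn : Nonempty {ρ : Str // σ ∈ U ρ}
  · obtain ⟨⟨ρ, hρ⟩, he⟩ := ciInf_mem (fun ρ : {ρ // σ ∈ U ρ} => ((ρ : Str).length : ℕ∞))
    refine ⟨ρ, hρ, ?_⟩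
    rw [← he] at h
    exact Nat.cast_le.1 h
  · rw [not_nonempty_iff] at hn
    rw [iInf_of_empty] at h; simp at h

/-- weight of an entry list index -/
noncomputable def ew (E : ℕ → Option (Str × Str)) (j : ℕ) : ℝ :=
  (E j).elim 0 fun p => (1 / 2 : ℝ) ^ p.1.length

/-- `E` is a good enumeration of the graph of `U` -/
structure IsEnum (U : Str →. Str) (E : ℕ → Option (Str × Str)) : Prop where
  prim : Primrec E
  sound : ∀ j p, E j = Option.some p → p.2 ∈ U p.1
  len1 : ∀ j p, E j = Option.some p → p.1.length ≤ j
  len2 : ∀ j p, E j = Option.some p → p.2.length ≤ j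
  complete : ∀ ρ σ, σ ∈ U ρ → ∃ j, E j = Option.some (ρ, σ)
  inj : ∀ i j p q, E i = Option.some p → E j = Option.some q → p.1 = q.1 → i = j

@[fun_prop] theorem pr_bind {α β σ : Type*} [Primcodable α] [Primcodable β] [Primcodable σ]
    {f : α → Option β} {g : α → β → Option σ} (hf : Primrec f)
    (hg : Primrec fun p : α × β => g p.1 p.2) : Primrec (fun a => (f a).bind (g a)) :=
  Primrec.option_bind hf hg

@[fun_prop] theorem pr_evaln {α : Type*} [Primcodable α] (c : Nat.Partrec.Code)
    {f g : α → ℕ} (hf : Primrec f) (hg : Primrec g) :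
    Primrec (fun a => Nat.Partrec.Code.evaln (f a) c (g a)) :=
  Nat.Partrec.Code.primrec_evaln.comp (f := fun a : (ℕ × Nat.Partrec.Code) × ℕ =>
    Nat.Partrec.Code.evaln a.1.1 a.1.2 a.2) (g := fun a => ((f a, c), g a)) (by fun_prop)

/-- check the lengths of an entry -/
def entryOk (k x : ℕ) (ρ σ : Str) : Option (Str × Str) :=
  cond (decide (Encodable.encode ρ = x) && decide (ρ.length ≤ k) && decide (σ.length ≤ k))
    (Option.some (ρ, σ)) Option.none

@[fun_prop] theorem pr_entryOk {α : Type*} [Primcodable α] {f g : α → ℕ} {h i : α → Str}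
    (hf : Primrec f) (hg : Primrec g) (hh : Primrec h) (hi : Primrec i) :
    Primrec (fun a => entryOk (f a) (g a) (h a) (i a)) := by
  have he : Primrec (Encodable.encode : Str → ℕ) := Primrec.encode
  unfold entryOk
  fun_prop

/-- decode the value of a stage-`k` computation -/
def evalEntry (c : Nat.Partrec.Code) (k x : ℕ) : Option (Str × Str) :=
  (Encodable.decode (α := Str) x).bind fun ρ =>
    (Nat.Partrec.Code.evaln k c x).bind fun y =>
      (Encodable.decode (α := Str) y).bind fun σ => entryOk k x ρ σ

theorem evalEntry_prim (c : Nat.Partrec.Code) :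
    Primrec fun p : ℕ × ℕ => evalEntry c p.1 p.2 := by
  have hd : Primrec (Encodable.decode : ℕ → Option Str) := Primrec.decode
  unfold evalEntry
  fun_prop

theorem exists_enum {U : Str →. Str} (hU : Partrec U) : ∃ E, IsEnum U E := by
  obtain ⟨c, hc⟩ := Nat.Partrec.Code.exists_code.1 hU
  obtain ⟨val, hvaldef⟩ : ∃ v, v = evalEntry c := ⟨_, rfl⟩
  have hval : ∀ k x p, val k x = Option.some p ↔ Encodable.encode p.1 = x ∧ p.1.length ≤ k ∧
      p.2.length ≤ k ∧ ∃ y, Nat.Partrec.Code.evaln k c x = Option.some y ∧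
        Encodable.decode (α := Str) y = Option.some p.2 := by
    intro k x p
    constructor
    · intro h
      simp only [hvaldef, evalEntry, entryOk, Option.bind_eq_some_iff] at h
      obtain ⟨ρ, h1, y, h2, σ, h3, h4⟩ := h
      cases hb : (decide (Encodable.encode ρ = x) && decide (ρ.length ≤ k) &&
        decide (σ.length ≤ k)) with
      | false => rw [hb] at h4; simp at h4
      | true =>
        rw [hb] at h4
        simp only [cond_true, Option.some.injEq] at h4
        subst h4
        simp only [Bool.and_eq_true, decide_eq_true_eq] at hb
        exact ⟨hb.1.1, hb.1.2, hb.2, y, h2, h3⟩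
    · rintro ⟨h1, h2, h3, y, h4, h5⟩
      simp only [hvaldef, evalEntry, entryOk, Option.bind_eq_some_iff]
      refine ⟨p.1, by rw [← h1, Encodable.encodek], y, h4, p.2, h5, ?_⟩
      simp [h1, h2, h3]
  have hsound : ∀ k x p, val k x = Option.some p → p.2 ∈ U p.1 := by
    intro k x p h
    obtain ⟨h1, h2, h3, y, h4, h5⟩ := (hval k x p).1 h
    have : y ∈ Nat.Partrec.Code.eval c x := Nat.Partrec.Code.evaln_sound h4
    rw [hc, ← h1] at this
    simp only [Encodable.encodek, Part.coe_some, Part.bind_some, Part.mem_map_iff] at this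
    obtain ⟨a, ha, hb⟩ := this
    rw [← hb, Encodable.encodek] at h5
    have : a = p.2 := by simpa using h5
    rw [← this]; exact ha
  have hmono : ∀ k k' x p, k ≤ k' → val k x = Option.some p → val k' x = Option.some p := by
    intro k k' x p hk h
    obtain ⟨h1, h2, h3, y, h4, h5⟩ := (hval k x p).1 h
    exact (hval k' x p).2 ⟨h1, h2.trans hk, h3.trans hk, y,
      Nat.Partrec.Code.evaln_mono hk h4, h5⟩
  have hcomp : ∀ ρ σ, σ ∈ U ρ → ∃ k, val k (Encodable.encode ρ) = Option.some (ρ, σ) := by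
    intro ρ σ h
    have : Encodable.encode σ ∈ Nat.Partrec.Code.eval c (Encodable.encode ρ) := by
      rw [hc]; simp only [Encodable.encodek, Part.coe_some, Part.bind_some, Part.mem_map_iff]
      exact ⟨σ, h, rfl⟩
    obtain ⟨k, hk⟩ := Nat.Partrec.Code.evaln_complete.1 this
    refine ⟨k + ρ.length + σ.length, (hval _ _ _).2 ⟨rfl, ?_, ?_, Encodable.encode σ,
      Nat.Partrec.Code.evaln_mono ?_ hk, Encodable.encodek _⟩⟩
    · simp; omega
    · simp
    · omega
  have hvp : Primrec fun p : ℕ × ℕ => val p.1 p.2 := hvaldef ▸ evalEntry_prim c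
  let E : ℕ → Option (Str × Str) := fun j =>
    cond ((List.range j.unpair.2).all fun k => !(val k j.unpair.1).isSome)
      (val j.unpair.2 j.unpair.1) Option.none
  have hE : ∀ j p, E j = Option.some p → val j.unpair.2 j.unpair.1 = Option.some p ∧
      ∀ k < j.unpair.2, val k j.unpair.1 = Option.none := by
    intro j p h
    simp only [E] at h
    cases hb : ((List.range j.unpair.2).all fun k => !(val k j.unpair.1).isSome) with
    | false => rw [hb] at h; simp at h
    | true =>
      rw [hb] at h
      refine ⟨h, ?_⟩
      simpa using hb
  refine ⟨E, ?_, ?_, ?_, ?_, ?_, ?_⟩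
  · simp only [E]; fun_prop
  · intro j p h; exact hsound _ _ _ (hE j p h).1
  · intro j p h
    exact ((hval _ _ _).1 (hE j p h).1).2.1.trans (Nat.unpair_right_le j)
  · intro j p h
    exact ((hval _ _ _).1 (hE j p h).1).2.2.1.trans (Nat.unpair_right_le j)
  · intro ρ σ h
    have hex := hcomp ρ σ h
    refine ⟨Nat.pair (Encodable.encode ρ) (Nat.find hex), ?_⟩
    have h2 := Nat.find_spec hex
    simp only [E, Nat.unpair_pair]
    have : ((List.range (Nat.find hex)).all fun k => !(val k (Encodable.encode ρ)).isSome) = true := by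
      simp only [List.all_eq_true, List.mem_range, Bool.not_eq_true', Option.isSome_eq_false_iff,
        Option.isNone_iff_eq_none]
      intro k hk
      by_contra hne
      obtain ⟨p, hp⟩ := Option.ne_none_iff_exists'.1 hne
      have h3 := hmono k _ _ _ hk.le hp
      rw [h2] at h3
      have : p = (ρ, σ) := by simpa using h3.symm
      exact Nat.find_min hex hk (this ▸ hp)
    rw [this]; exact h2
  · intro i j p q hi hj hpq
    obtain ⟨a1, b1⟩ := hE i p hi
    obtain ⟨a2, b2⟩ := hE j q hj
    have e1 := ((hval _ _ _).1 a1).1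
    have e2 := ((hval _ _ _).1 a2).1
    have e : i.unpair.1 = j.unpair.1 := by rw [← e1, ← e2, hpq]
    have e' : i.unpair.2 = j.unpair.2 := by
      rcases lt_trichotomy i.unpair.2 j.unpair.2 with h | h | h
      · have := b2 _ h; rw [← e, a1] at this; simp at this
      · exact h
      · have := b1 _ h; rw [e, a2] at this; simp at this
    rw [← Nat.pair_unpair i, ← Nat.pair_unpair j, e, e']

theorem kraft_finset (S : Finset Str) (h : ∀ a ∈ S, ∀ b ∈ S, a <+: b → a = b) :
    ∑ w ∈ S, (1 / 2 : ℝ) ^ w.length ≤ 1 := by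
  by_cases hn : ([] : Str) ∈ S
  · have : S = {[]} := by
      ext a; simp only [Finset.mem_singleton]
      constructor
      · intro ha; exact (h [] hn a ha List.nil_prefix).symm
      · rintro rfl; exact hn
    rw [this]; simp
  · have hu : InformationTheory.UniquelyDecodable (S : Set Str) := by
      intro L₁
      induction L₁ with
      | nil =>
        intro L₂ _ h2 hf
        cases L₂ with
        | nil => rfl
        | cons a L =>
          simp only [List.flatten_nil, List.flatten_cons] at hf
          have := (List.append_eq_nil_iff.1 hf.symm).1
          exact absurd (this ▸ h2 a (by simp)) hn
      | cons a L ih =>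
        intro L₂ h1 h2 hf
        cases L₂ with
        | nil =>
          simp only [List.flatten_nil, List.flatten_cons] at hf
          have := (List.append_eq_nil_iff.1 hf).1
          exact absurd (this ▸ h1 a (by simp)) hn
        | cons b L' =>
          simp only [List.flatten_cons] at hf
          have ha : a ∈ S := h1 a (by simp)
          have hb : b ∈ S := h2 b (by simp)
          have : a = b := by
            have hpa := List.prefix_append a L.flatten
            have hpb : b <+: a ++ L.flatten := hf ▸ List.prefix_append b L'.flatten
            rcases (le_total a.length b.length).imp (List.prefix_of_prefix_length_le hpa hpb)
              (List.prefix_of_prefix_length_le hpb hpa) with hp | hp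
            · exact h a ha b hb hp
            · exact (h b hb a ha hp).symm
          subst this
          rw [ih L' (fun w hw => h1 w (by simp [hw])) (fun w hw => h2 w (by simp [hw]))
            (List.append_cancel_left hf)]
    have := InformationTheory.kraft_mcmillan_inequality hu
    simpa using this

theorem ew_nonneg (E : ℕ → Option (Str × Str)) (j : ℕ) : 0 ≤ ew E j := by
  unfold ew; cases E j <;> simp

theorem kraft_enum {U : Str →. Str} (hU : PFMachine U) {E : ℕ → Option (Str × Str)}
    (hE : IsEnum U E) (F : Finset ℕ) : ∑ j ∈ F, ew E j ≤ 1 := by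
  let F' := F.filter fun j => (E j).isSome
  have h1 : ∑ j ∈ F, ew E j = ∑ j ∈ F', ew E j := by
    symm; apply Finset.sum_subset (Finset.filter_subset _ _)
    intro j hj hj'
    simp only [F', Finset.mem_filter, hj, true_and] at hj'
    cases h : E j with
    | none => simp [ew, h]
    | some p => simp [h] at hj'
  let g : ℕ → Str := fun j => (E j).elim [] fun p => p.1
  have h2 : ∑ j ∈ F', ew E j = ∑ w ∈ F'.image g, (1/2:ℝ)^w.length := by
    rw [Finset.sum_image]
    · apply Finset.sum_congr rfl
      intro j hj
      simp only [F', Finset.mem_filter, Option.isSome_iff_exists] at hj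
      obtain ⟨p, hp⟩ := hj.2
      simp [ew, g, hp]
    · intro i hi j hj hij
      simp only [F', Finset.coe_filter, Set.mem_setOf_eq, Option.isSome_iff_exists] at hi hj
      obtain ⟨p, hp⟩ := hi.2
      obtain ⟨q, hq⟩ := hj.2
      simp only [g, hp, hq, Option.elim] at hij
      exact hE.inj i j p q hp hq hij
  rw [h1, h2]
  apply kraft_finset
  have hd : ∀ a ∈ F'.image g, (U a).Dom := by
    intro a ha
    simp only [Finset.mem_image, F', Finset.mem_filter, Option.isSome_iff_exists] at ha
    obtain ⟨j, ⟨_, p, hp⟩, rfl⟩ := ha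
    have := hE.sound j p hp
    simp only [g, hp, Option.elim]
    exact Part.dom_iff_mem.2 ⟨_, this⟩
  intro a ha b hb hab
  exact hU.2 a b (hd a ha) (hd b hb) hab

/-- monotone primitive recursive approximation of a c.e. set -/
structure IsApprox (A : Set ℕ) (a : ℕ → ℕ → Bool) : Prop where
  prim : Primrec fun p : ℕ × ℕ => a p.1 p.2
  mono : ∀ s t x, s ≤ t → a s x = true → a t x = true
  lim : ∀ x, x ∈ A ↔ ∃ s, a s x = true

theorem exists_approx {A : Set ℕ} (hA : CESet A) : ∃ a, IsApprox A a := by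
  obtain ⟨f, hf, hA⟩ := hA
  obtain ⟨c, hc⟩ := Nat.Partrec.Code.exists_code.1 hf
  refine ⟨fun s x => (Nat.Partrec.Code.evaln s c x).isSome, ?_, ?_, ?_⟩
  · fun_prop
  · intro s t x hst h
    obtain ⟨y, hy⟩ := Option.isSome_iff_exists.1 h
    exact Option.isSome_iff_exists.2 ⟨y, Nat.Partrec.Code.evaln_mono hst hy⟩
  · intro x
    rw [hA, ← hc, Part.dom_iff_mem]
    constructor
    · rintro ⟨y, hy⟩
      obtain ⟨k, hk⟩ := Nat.Partrec.Code.evaln_complete.1 hy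
      exact ⟨k, Option.isSome_iff_exists.2 ⟨y, hk⟩⟩
    · rintro ⟨s, hs⟩
      obtain ⟨y, hy⟩ := Option.isSome_iff_exists.1 hs
      exact ⟨y, Nat.Partrec.Code.evaln_sound hy⟩

theorem ce_of_approx {A : Set ℕ} {a : ℕ → ℕ → Bool} (h : IsApprox A a) : CESet A := by
  refine ⟨fun x => Nat.rfind fun s => Part.some (a s x), ?_, ?_⟩
  · have : Partrec fun x : ℕ => Nat.rfind fun s => Part.some (a s x) := by
      refine Partrec.rfind (p := fun x s => Part.some (a s x)) ?_
      have h1 : Primrec fun p : ℕ × ℕ => a p.2 p.1 :=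
        h.prim.comp (Primrec.snd.pair Primrec.fst)
      exact h1.to_comp
    exact Partrec.nat_iff.1 this
  · intro n
    rw [h.lim]
    refine Iff.trans ?_ Nat.rfind_dom.symm
    constructor
    · rintro ⟨s, hs⟩; exact ⟨s, by simp [hs], fun _ => trivial⟩
    · rintro ⟨s, hs, _⟩; exact ⟨s, by simpa using hs⟩

/-- the tracking lemma -/
theorem track {U : Str →. Str} (hU : OptimalPF U) (V : ℕ → ℕ → Bool) (τ : ℕ → ℕ → Str)
    (r : ℕ → ℕ) (hV : Primrec fun p : ℕ × ℕ => V p.1 p.2)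
    (hτ : Primrec fun p : ℕ × ℕ => τ p.1 p.2) (hr : Primrec r) (hV0 : ∀ j, V 0 j = false)
    (C : ℕ)
    (hs : ∀ S, ∑ s ∈ Finset.range S, ∑ j ∈ Finset.range S,
      (if V (s+1) j = true ∧ (V s j = false ∨ τ (s+1) j ≠ τ s j) then (1/2:ℝ)^(r j) else 0) ≤ 2^C) :
    ∃ c : ℕ, ∀ s j, V s j = true → KC U (τ s j) ≤ ((r j + c : ℕ) : ℕ∞) := by
  let R : ℕ → Option (ℕ × Str) := fun i =>
    cond (V (i.unpair.1 + 1) i.unpair.2 && (!(V i.unpair.1 i.unpair.2) ||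
      !decide (τ (i.unpair.1 + 1) i.unpair.2 = τ i.unpair.1 i.unpair.2)))
      (Option.some (r i.unpair.2, τ (i.unpair.1 + 1) i.unpair.2)) Option.none
  have hRp : Primrec R := by
    simp only [R]; fun_prop
  let g : ℕ × ℕ → ℝ := fun p =>
    (if V (p.1+1) p.2 = true ∧ (V p.1 p.2 = false ∨ τ (p.1+1) p.2 ≠ τ p.1 p.2)
      then (1/2:ℝ)^(r p.2) else 0)
  have hg0 : ∀ p, 0 ≤ g p := by
    intro p; simp only [g]; split_ifs <;> positivity
  have hw : ∀ i, rwt R i = g i.unpair := by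
    intro i
    simp only [rwt, R, g]
    by_cases h : V (i.unpair.1+1) i.unpair.2 = true ∧ (V i.unpair.1 i.unpair.2 = false ∨
      τ (i.unpair.1+1) i.unpair.2 ≠ τ i.unpair.1 i.unpair.2)
    · rw [if_pos h]
      have : (V (i.unpair.1 + 1) i.unpair.2 && (!(V i.unpair.1 i.unpair.2) ||
        !decide (τ (i.unpair.1 + 1) i.unpair.2 = τ i.unpair.1 i.unpair.2))) = true := by
        simpa using h
      rw [this]; rfl
    · rw [if_neg h]
      have : (V (i.unpair.1 + 1) i.unpair.2 && (!(V i.unpair.1 i.unpair.2) ||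
        !decide (τ (i.unpair.1 + 1) i.unpair.2 = τ i.unpair.1 i.unpair.2))) = false := by
        rw [← Bool.not_eq_true]; simpa using h
      rw [this]; rfl
  obtain ⟨c, hc⟩ := kc_thm hU R hRp C (by
    intro n
    refine le_trans ?_ (hs n)
    simp only [hw]
    have h1 : ∑ i ∈ Finset.range n, g i.unpair = ∑ p ∈ (Finset.range n).image Nat.unpair, g p := by
      rw [Finset.sum_image]
      intro i _ j _ hij
      rw [← Nat.pair_unpair i, ← Nat.pair_unpair j, hij]
    rw [h1, ← Finset.sum_product' (Finset.range n) (Finset.range n) (fun a b => g (a, b))]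
    apply Finset.sum_le_sum_of_subset_of_nonneg
    · intro p hp
      simp only [Finset.mem_image, Finset.mem_range] at hp
      obtain ⟨i, hi, rfl⟩ := hp
      simp only [Finset.mem_product, Finset.mem_range]
      exact ⟨(Nat.unpair_left_le i).trans_lt hi, (Nat.unpair_right_le i).trans_lt hi⟩
    · intro p _ _; exact hg0 p)
  refine ⟨c, ?_⟩
  intro s
  induction s with
  | zero => intro j h; rw [hV0] at h; simp at h
  | succ s ih =>
    intro j h
    by_cases h2 : V s j = false ∨ τ (s+1) j ≠ τ s j
    · apply hc (Nat.pair s j)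
      simp only [R, Nat.unpair_pair]
      have : (V (s + 1) j && (!(V s j) || !decide (τ (s + 1) j = τ s j))) = true := by
        simp only [Bool.and_eq_true, h, true_and]; simpa using h2
      rw [this]; rfl
    · push Not at h2
      rw [h2.2]; exact ih j (by simpa using h2.1)

/-- code length of entry `j` -/
def rl (E : ℕ → Option (Str × Str)) (j : ℕ) : ℕ := (E j).elim 0 fun p => p.1.length

/-- output of entry `j` -/
def sg (E : ℕ → Option (Str × Str)) (j : ℕ) : Str := (E j).elim [] fun p => p.2

/-- the first `n` values of `g` as a string -/
def seg (g : ℕ → Bool) (n : ℕ) : Str := (List.range n).map g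

/-- entry `j` describes an initial segment of `g` -/
def valid (E : ℕ → Option (Str × Str)) (g : ℕ → Bool) (j : ℕ) : Bool :=
  (E j).isSome && decide (sg E j = seg g (sg E j).length)

/-- weight of entry `j`, scaled by `2^s` -/
def ewN (E : ℕ → Option (Str × Str)) (s j : ℕ) : ℕ :=
  cond (E j).isSome (2 ^ (s - rl E j)) 0

/-- scaled mass of the descriptions of initial segments of `g` longer than `n` -/
def massN (E : ℕ → Option (Str × Str)) (g : ℕ → Bool) (n s : ℕ) : ℕ :=
  (((List.range s).filter fun j => valid E g j && decide (n < (sg E j).length)).map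
    fun j => ewN E s j).sum

/-- mass of the descriptions of initial segments of `g` longer than `n` -/
noncomputable def mass (E : ℕ → Option (Str × Str)) (g : ℕ → Bool) (n s : ℕ) : ℝ :=
  ∑ j ∈ Finset.range s, if valid E g j = true ∧ n < (sg E j).length then ew E j else 0

section prims
variable {α : Type*} [Primcodable α] {E : ℕ → Option (Str × Str)}

@[fun_prop] theorem pr_rl (hE : Primrec E) {f : α → ℕ} (hf : Primrec f) :
    Primrec (fun a => rl E (f a)) := by unfold rl; fun_prop

@[fun_prop] theorem pr_sg (hE : Primrec E) {f : α → ℕ} (hf : Primrec f) :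
    Primrec (fun a => sg E (f a)) := by unfold sg; fun_prop

@[fun_prop] theorem pr_seg {g : α → ℕ → Bool} (hg : Primrec fun p : α × ℕ => g p.1 p.2)
    {f : α → ℕ} (hf : Primrec f) :
    Primrec (fun a => seg (g a) (f a)) := by unfold seg; fun_prop

@[fun_prop] theorem pr_ewN (hE : Primrec E) {f g : α → ℕ} (hf : Primrec f) (hg : Primrec g) :
    Primrec (fun a => ewN E (f a) (g a)) := by unfold ewN; fun_prop

@[fun_prop] theorem pr_valid (hE : Primrec E) {g : α → ℕ → Bool}
    (hg : Primrec fun p : α × ℕ => g p.1 p.2) {f : α → ℕ} (hf : Primrec f) :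
    Primrec (fun a => valid E (g a) (f a)) := by unfold valid; fun_prop

@[fun_prop] theorem pr_massN (hE : Primrec E) {g : α → ℕ → Bool}
    (hg : Primrec fun p : α × ℕ => g p.1 p.2) {f h : α → ℕ} (hf : Primrec f) (hh : Primrec h) :
    Primrec (fun a => massN E (g a) (f a) (h a)) := by unfold massN; fun_prop

end prims

theorem list_range_sum {M : Type*} [AddCommMonoid M] (f : ℕ → M) (n : ℕ) :
    ((List.range n).map f).sum = ∑ j ∈ Finset.range n, f j := by
  induction n with
  | zero => simp
  | succ n ih => rw [List.range_succ, List.map_append, List.sum_append, ih, Finset.sum_range_succ]; simp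

theorem list_filter_sum {β M : Type*} [AddCommMonoid M] (l : List β) (p : β → Bool) (f : β → M) :
    ((l.filter p).map f).sum = (l.map fun b => if p b = true then f b else 0).sum := by
  induction l with
  | nil => simp
  | cons b l ih => cases h : p b <;> simp [h, ih]

theorem two_mul_half (n : ℕ) : (2:ℝ)^n * (1/2)^n = 1 := by rw [← mul_pow]; norm_num

theorem pow_sub_half {s r : ℕ} (h : r ≤ s) : (2:ℝ)^(s - r) = 2^s * (1/2)^r := by
  have := two_mul_half r
  have e : (2:ℝ)^s = 2^(s-r) * 2^r := by rw [← pow_add]; congr 1; omega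
  rw [e, mul_assoc, this, mul_one]

theorem ewN_spec {U : Str →. Str} {E} (hE : IsEnum U E) {s j : ℕ} (h : j < s) :
    (ewN E s j : ℝ) = 2^s * ew E j := by
  unfold ewN ew rl
  cases hj : E j with
  | none => simp
  | some p =>
    have := hE.len1 j p hj
    simp only [Option.isSome_some, cond_true, Option.elim]
    push_cast
    exact pow_sub_half (by omega)

theorem massN_spec {U : Str →. Str} {E} (hE : IsEnum U E) (g : ℕ → Bool) (n s : ℕ) :
    (massN E g n s : ℝ) = 2^s * mass E g n s := by
  unfold massN mass
  rw [list_filter_sum, list_range_sum, Finset.mul_sum]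
  push_cast
  apply Finset.sum_congr rfl
  intro j hj
  rw [Finset.mem_range] at hj
  have := ewN_spec hE hj
  by_cases h : valid E g j = true ∧ n < (sg E j).length
  · rw [if_pos h, if_pos (by simpa using h), this]
  · rw [if_neg h, if_neg (by simpa using h)]; simp

theorem seg_eq_iff {g h : ℕ → Bool} {n : ℕ} : seg g n = seg h n ↔ ∀ x < n, g x = h x := by
  unfold seg; rw [List.map_inj_left]; simp

@[simp] theorem seg_length (g : ℕ → Bool) (n : ℕ) : (seg g n).length = n := by simp [seg]

theorem valid_iff {E} {g : ℕ → Bool} {j : ℕ} :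
    valid E g j = true ↔ (E j).isSome = true ∧ sg E j = seg g (sg E j).length := by
  simp [valid]

theorem valid_agree {E} {g h : ℕ → Bool} {j : ℕ} (hg : valid E g j = true)
    (hh : valid E h j = true) : ∀ x < (sg E j).length, g x = h x :=
  seg_eq_iff.1 ((valid_iff.1 hg).2.symm.trans (valid_iff.1 hh).2)

theorem valid_of_agree {E} {g h : ℕ → Bool} {j : ℕ} (hg : valid E g j = true)
    (hh : ∀ x < (sg E j).length, g x = h x) : valid E h j = true :=
  valid_iff.2 ⟨(valid_iff.1 hg).1, (valid_iff.1 hg).2.trans (seg_eq_iff.2 hh)⟩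

/-- monotone approximation -/
def Mono (a : ℕ → ℕ → Bool) : Prop := ∀ s t x, s ≤ t → a s x = true → a t x = true

theorem mono_agree {a : ℕ → ℕ → Bool} (ha : Mono a) {s t u x : ℕ} (h1 : s ≤ t) (h2 : t ≤ u)
    (h : a s x = a u x) : a s x = a t x := by
  cases hs : a s x with
  | true => exact (ha s t x h1 hs).symm
  | false =>
    cases ht : a t x with
    | false => rfl
    | true => have := ha t u x h2 ht; rw [← h, hs] at this; exact this

theorem valid_convex {E} {a : ℕ → ℕ → Bool} (ha : Mono a) {s t u j : ℕ} (h1 : s ≤ t)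
    (h2 : t ≤ u) (hs : valid E (a s) j = true) (hu : valid E (a u) j = true) :
    valid E (a t) j = true :=
  valid_of_agree hs fun x hx => mono_agree ha h1 h2 (valid_agree hs hu x hx)

theorem mass_nonneg (E) (g : ℕ → Bool) (n s : ℕ) : 0 ≤ mass E g n s :=
  Finset.sum_nonneg fun j _ => by split_ifs; exacts [ew_nonneg E j, le_rfl]

theorem mass_anti (E) (g : ℕ → Bool) {n m : ℕ} (s : ℕ) (h : n ≤ m) : mass E g m s ≤ mass E g n s := by
  apply Finset.sum_le_sum
  intro j _
  by_cases h1 : valid E g j = true ∧ m < (sg E j).length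
  · rw [if_pos h1, if_pos ⟨h1.1, by omega⟩]
  · rw [if_neg h1]; split_ifs; exacts [ew_nonneg E j, le_rfl]

theorem sum_le_of_unique {S : Finset ℕ} {P : ℕ → Prop} [DecidablePred P] {w : ℝ} (hw : 0 ≤ w)
    (h : ∀ s ∈ S, ∀ t ∈ S, P s → P t → s = t) : ∑ s ∈ S, (if P s then w else 0) ≤ w := by
  rw [← Finset.sum_filter, Finset.sum_const]
  have : (S.filter P).card ≤ 1 := by
    rw [Finset.card_le_one]
    intro a ha b hb
    rw [Finset.mem_filter] at ha hb
    exact h a ha.1 b hb.1 ha.2 hb.2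
  rw [nsmul_eq_mul]
  have h2 : ((S.filter P).card : ℝ) ≤ 1 := by exact_mod_cast this
  nlinarith

theorem approx_agree {A : Set ℕ} {a : ℕ → ℕ → Bool} (h : IsApprox A a) (n : ℕ) :
    ∃ s0, ∀ s ≥ s0, ∀ x < n, a s x = decide (x ∈ A) := by
  induction n with
  | zero => exact ⟨0, fun s _ x hx => absurd hx (by omega)⟩
  | succ n ih =>
    obtain ⟨s0, hs0⟩ := ih
    by_cases hn : n ∈ A
    · obtain ⟨s1, hs1⟩ := (h.lim n).1 hn
      refine ⟨max s0 s1, fun s hs x hx => ?_⟩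
      rcases Nat.lt_succ_iff_lt_or_eq.1 hx with hx | rfl
      · exact hs0 s (le_trans (le_max_left _ _) hs) x hx
      · simp [hn, h.mono s1 s x (le_trans (le_max_right _ _) hs) hs1]
    · refine ⟨s0, fun s hs x hx => ?_⟩
      rcases Nat.lt_succ_iff_lt_or_eq.1 hx with hx | rfl
      · exact hs0 s hs x hx
      · have : a s x ≠ true := fun hh => hn ((h.lim x).2 ⟨s, hh⟩)
        simp [hn, this]

theorem restrSet_eq_seg (A : Set ℕ) (n : ℕ) : restrSet A n = seg (fun i => decide (i ∈ A)) n := rfl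

/-- the mass converges -/
theorem mass_tendsto {U : Str →. Str} (hU : PFMachine U) {E} (hE : IsEnum U E)
    {A : Set ℕ} {a : ℕ → ℕ → Bool} (h : IsApprox A a) (n : ℕ) :
    ∃ l : ℝ, Tendsto (fun s => mass E (a s) n s) atTop (nhds l) := by
  have hsum : Summable (ew E) := summable_of_sum_le (ew_nonneg E) (kraft_enum hU hE)
  let f : ℕ → ℕ → ℝ := fun s j =>
    if j < s ∧ valid E (a s) j = true ∧ n < (sg E j).length then ew E j else 0
  let g : ℕ → ℝ := fun j =>
    if valid E (fun i => decide (i ∈ A)) j = true ∧ n < (sg E j).length then ew E j else 0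
  refine ⟨∑' j, g j, ?_⟩
  have hf : ∀ s, mass E (a s) n s = ∑' j, f s j := by
    intro s
    rw [tsum_eq_sum (s := Finset.range s)]
    · unfold mass
      apply Finset.sum_congr rfl
      intro j hj
      rw [Finset.mem_range] at hj
      simp [f, hj]
    · intro j hj
      rw [Finset.mem_range] at hj
      simp [f, hj]
  simp only [hf]
  apply tendsto_tsum_of_dominated_convergence hsum
  · intro j
    apply tendsto_const_nhds.congr'
    obtain ⟨s0, hs0⟩ := approx_agree h (sg E j).length
    filter_upwards [eventually_ge_atTop s0, eventually_gt_atTop j] with s h1 h2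
    have e : valid E (a s) j = valid E (fun i => decide (i ∈ A)) j := by
      rw [Bool.eq_iff_iff]
      exact ⟨fun hh => valid_of_agree hh (hs0 s h1),
        fun hh => valid_of_agree hh fun x hx => (hs0 s h1 x hx).symm⟩
    simp [f, g, h2, e]
  · filter_upwards with s j
    simp only [f]
    split_ifs
    · rw [Real.norm_of_nonneg (ew_nonneg E j)]
    · simpa using ew_nonneg E j

/-- membership in a list, as a Boolean -/
def memL (L : List ℕ) (x : ℕ) : Bool := L.any fun y => decide (y = x)

@[fun_prop] theorem pr_memL {α : Type*} [Primcodable α] {f : α → List ℕ} {g : α → ℕ}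
    (hf : Primrec f) (hg : Primrec g) : Primrec fun a => memL (f a) (g a) := by
  unfold memL; fun_prop

/-- condition for enumerating `s.unpair.1` into `B` at stage `s` -/
def actN (E : ℕ → Option (Str × Str)) (aA aD : ℕ → ℕ → Bool) (s : ℕ) (L : List ℕ) : Bool :=
  !(memL L s.unpair.1) &&
    decide (massN E (aA s) s.unpair.1 s + massN E (aD s) s.unpair.1 s
      < massN E (memL L) s.unpair.1 s) &&
    decide (4 * 2 ^ s ≤ s.unpair.1 * massN E (memL L) s.unpair.1 s)

/-- stage `s` list of elements of `B` -/
def bL (E : ℕ → Option (Str × Str)) (aA aD : ℕ → ℕ → Bool) (s : ℕ) : List ℕ :=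
  Nat.rec [] (fun t L => cond (actN E aA aD t L) (t.unpair.1 :: L) L) s

theorem pr_actN {E aA aD} (hE : Primrec E) (hA : Primrec fun p : ℕ × ℕ => aA p.1 p.2)
    (hD : Primrec fun p : ℕ × ℕ => aD p.1 p.2) {α : Type*} [Primcodable α] {f : α → ℕ}
    {g : α → List ℕ} (hf : Primrec f) (hg : Primrec g) :
    Primrec fun a => actN E aA aD (f a) (g a) := by
  have h1 : Primrec fun a => massN E (aA (f a)) (f a).unpair.1 (f a) :=
    pr_massN hE (g := fun a => aA (f a)) (by fun_prop) (by fun_prop) hf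
  have h2 : Primrec fun a => massN E (aD (f a)) (f a).unpair.1 (f a) :=
    pr_massN hE (g := fun a => aD (f a)) (by fun_prop) (by fun_prop) hf
  have h3 : Primrec fun a => massN E (memL (g a)) (f a).unpair.1 (f a) :=
    pr_massN hE (g := fun a => memL (g a)) (by fun_prop) (by fun_prop) hf
  unfold actN; fun_prop

theorem pr_bL {E aA aD} (hE : Primrec E) (hA : Primrec fun p : ℕ × ℕ => aA p.1 p.2)
    (hD : Primrec fun p : ℕ × ℕ => aD p.1 p.2) : Primrec (bL E aA aD) := by
  have : Primrec fun p : ℕ × List ℕ => actN E aA aD p.1 p.2 :=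
    pr_actN hE hA hD Primrec.fst Primrec.snd
  unfold bL; fun_prop

/-- the properties of the construction of `B` -/
structure IsB (E : ℕ → Option (Str × Str)) (aA aD b : ℕ → ℕ → Bool) (act : ℕ → Prop) : Prop where
  prim : Primrec fun p : ℕ × ℕ => b p.1 p.2
  zero : ∀ y, b 0 y = false
  step : ∀ s y, b (s+1) y = true ↔ (b s y = true ∨ (act s ∧ y = s.unpair.1))
  act_iff : ∀ s, act s ↔ (b s s.unpair.1 = false ∧
    mass E (aA s) s.unpair.1 s + mass E (aD s) s.unpair.1 s < mass E (b s) s.unpair.1 s ∧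
    4 ≤ s.unpair.1 * mass E (b s) s.unpair.1 s)

theorem exists_isB {U : Str →. Str} {E} (hE : IsEnum U E) {aA aD : ℕ → ℕ → Bool}
    (hA : Primrec fun p : ℕ × ℕ => aA p.1 p.2)
    (hD : Primrec fun p : ℕ × ℕ => aD p.1 p.2) : ∃ b act, IsB E aA aD b act := by
  refine ⟨fun s => memL (bL E aA aD s), fun s => actN E aA aD s (bL E aA aD s) = true, ?_, ?_, ?_, ?_⟩
  · have := pr_bL hE.prim hA hD
    fun_prop
  · intro y; simp [bL, memL]
  · intro s y
    have : bL E aA aD (s+1) =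
      cond (actN E aA aD s (bL E aA aD s)) (s.unpair.1 :: bL E aA aD s) (bL E aA aD s) := rfl
    beta_reduce
    rw [this]
    cases actN E aA aD s (bL E aA aD s) with
    | true => simp [memL]; grind
    | false => simp
  · intro s
    have h2 : (0:ℝ) < 2^s := by positivity
    simp only [actN, Bool.and_eq_true, Bool.not_eq_true', decide_eq_true_eq, and_assoc]
    refine and_congr_right fun _ => and_congr ?_ ?_
    · rw [← Nat.cast_lt (α := ℝ)]
      push_cast
      rw [massN_spec hE, massN_spec hE, massN_spec hE, ← mul_add, mul_lt_mul_iff_right₀ h2]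
    · rw [← Nat.cast_le (α := ℝ)]
      push_cast
      rw [massN_spec hE, mul_left_comm, mul_comm (4:ℝ), mul_le_mul_iff_right₀ h2]

namespace IsB
variable {U : Str →. Str} {E : ℕ → Option (Str × Str)} {aA aD b : ℕ → ℕ → Bool} {act : ℕ → Prop}

theorem mono (h : IsB E aA aD b act) : Mono b := by
  intro s t x hst hs
  induction t, hst using Nat.le_induction with
  | base => exact hs
  | succ n _ ih => exact (h.step n x).2 (Or.inl ih)

theorem approx (h : IsB E aA aD b act) : IsApprox {x | ∃ s, b s x = true} b :=
  ⟨h.prim, h.mono, fun x => Iff.rfl⟩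

theorem act_sum (hU : PFMachine U) (hE : IsEnum U E) (h : IsB E aA aD b act) (S : ℕ) :
    ∑ s ∈ Finset.range S, (if act s then mass E (b s) s.unpair.1 s else 0) ≤ 1 := by
  have h1 : ∀ s ∈ Finset.range S, (if act s then mass E (b s) s.unpair.1 s else 0) ≤
      ∑ j ∈ Finset.range S, if act s ∧ valid E (b s) j = true ∧ s.unpair.1 < (sg E j).length
        then ew E j else 0 := by
    intro s hs
    rw [Finset.mem_range] at hs
    by_cases ha : act s
    · simp only [ha, if_true, true_and]
      unfold mass
      apply Finset.sum_le_sum_of_subset_of_nonneg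
      · exact Finset.range_mono hs.le
      · intros; split_ifs; exacts [ew_nonneg E _, le_rfl]
    · simp [ha]
  refine (Finset.sum_le_sum h1).trans ?_
  rw [Finset.sum_comm]
  refine le_trans (Finset.sum_le_sum fun j _ => ?_) (kraft_enum hU hE (Finset.range S))
  apply sum_le_of_unique (ew_nonneg E j)
  have key : ∀ s t, s < t → act s → valid E (b s) j = true → s.unpair.1 < (sg E j).length →
      valid E (b t) j = true → False := by
    intro s t hst ha hv hl hv2
    have e := valid_agree hv hv2 _ hl
    rw [((h.act_iff s).1 ha).1] at e
    have : b (s+1) s.unpair.1 = true := (h.step s _).2 (Or.inr ⟨ha, rfl⟩)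
    rw [h.mono _ t _ hst this] at e
    exact Bool.noConfusion e
  intro s _ t _ hs ht
  by_contra hne
  rcases lt_or_gt_of_ne hne with hlt | hlt
  · exact key s t hlt hs.1 hs.2.1 hs.2.2 ht.2.1
  · exact key t s hlt ht.1 ht.2.1 ht.2.2 hs.2.1

theorem hole (hU : PFMachine U) (hE : IsEnum U E) (h : IsB E aA aD b act) {n : ℕ} (hn : 1 ≤ n) :
    ∃ x, n ≤ x ∧ x < 2 * n ∧ ∀ s, b s x = false := by
  by_contra hcon
  push Not at hcon
  have hin : ∀ x, n ≤ x → x < 2*n → ∃ s, act s ∧ s.unpair.1 = x := by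
    intro x h1 h2
    obtain ⟨s, hs⟩ := hcon x h1 h2
    replace hs : b s x = true := by simpa using hs
    induction s with
    | zero => rw [h.zero] at hs; exact Bool.noConfusion hs
    | succ s ih =>
      rcases (h.step s x).1 hs with hs | hs
      · exact ih hs
      · exact ⟨s, hs.1, hs.2.symm⟩
  choose! f hf1 hf2 using hin
  obtain ⟨S, hS⟩ : ∃ S, ∀ x ∈ Finset.Ico n (2*n), f x < S :=
    ⟨(Finset.Ico n (2*n)).sup f + 1, fun x hx => Nat.lt_succ_of_le (Finset.le_sup hx)⟩
  have h1 := h.act_sum hU hE S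
  have h2 : ∑ x ∈ Finset.Ico n (2*n), (2/(n:ℝ)) ≤
      ∑ s ∈ Finset.range S, (if act s then mass E (b s) s.unpair.1 s else 0) := by
    have e : ∑ s ∈ (Finset.Ico n (2*n)).image f, (if act s then mass E (b s) s.unpair.1 s else 0) ≤
        ∑ s ∈ Finset.range S, (if act s then mass E (b s) s.unpair.1 s else 0) := by
      apply Finset.sum_le_sum_of_subset_of_nonneg
      · intro s hs
        rw [Finset.mem_image] at hs
        obtain ⟨x, hx, rfl⟩ := hs
        exact Finset.mem_range.2 (hS x hx)
      · intros; split_ifs; exacts [mass_nonneg _ _ _ _, le_rfl]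
    refine le_trans ?_ e
    rw [Finset.sum_image]
    · apply Finset.sum_le_sum
      intro x hx
      rw [Finset.mem_Ico] at hx
      have ha := hf1 x hx.1 hx.2
      rw [if_pos ha]
      have h4 := ((h.act_iff _).1 ha).2.2
      rw [hf2 x hx.1 hx.2] at h4 ⊢
      have hx2 : (x:ℝ) ≤ 2*n := by exact_mod_cast hx.2.le
      have hn' : (0:ℝ) < n := by exact_mod_cast hn
      rw [div_le_iff₀ hn']
      nlinarith [mass_nonneg E (b (f x)) x (f x)]
    · intro x hx y hy hxy
      rw [Finset.mem_coe, Finset.mem_Ico] at hx hy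
      rw [← hf2 x hx.1 hx.2, ← hf2 y hy.1 hy.2, hxy]
  rw [Finset.sum_const, Nat.card_Ico, nsmul_eq_mul] at h2
  have hn' : (0:ℝ) < n := by exact_mod_cast hn
  have : ((2*n - n : ℕ) : ℝ) * (2/n) = 2 := by
    rw [show 2*n - n = n by omega]; field_simp
  linarith

theorem ew_eq_of_valid {g : ℕ → Bool} {j : ℕ} (h : valid E g j = true) :
    (1/2:ℝ)^(rl E j) = ew E j := by
  have := (valid_iff.1 h).1
  unfold rl ew
  cases hj : E j with
  | none => rw [hj] at this; simp at this
  | some p => rfl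

theorem le_of_dom (hU : OptimalPF U) (hE : IsEnum U E) (h : IsB E aA aD b act)
    {X : Set ℕ} {a : ℕ → ℕ → Bool} (ha : IsApprox X a)
    (hdom : ∀ s, act s → mass E (a s) s.unpair.1 s ≤ mass E (b s) s.unpair.1 s) :
    KLeSet U {x | ∃ s, b s x = true} X := by
  have hm : Mono a := ha.mono
  obtain ⟨c, hc⟩ := track hU (fun s j => decide (j < s) && valid E (a s) j)
    (fun s j => seg (b s) (sg E j).length) (rl E) (by
      have h1 := ha.prim; have h2 := hE.prim
      have h3 : Primrec fun p : ℕ × ℕ => valid E (a p.1) p.2 :=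
        pr_valid h2 (g := fun p : ℕ × ℕ => a p.1) (by fun_prop) (by fun_prop)
      fun_prop) (by
      have h1 := h.prim; have h2 := hE.prim
      exact pr_seg (g := fun p : ℕ × ℕ => b p.1) (by fun_prop) (by fun_prop))
    (by have h2 := hE.prim; exact pr_rl h2 Primrec.id) (by simp) 1 (by
    intro S
    have hb : ∀ s j, s < S → j < S →
      (if (decide (j < s+1) && valid E (a (s+1)) j) = true ∧
        ((decide (j < s) && valid E (a s) j) = false ∨
          seg (b (s+1)) (sg E j).length ≠ seg (b s) (sg E j).length) then (1/2:ℝ)^(rl E j) else 0) ≤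
      (if (decide (j < s+1) && valid E (a (s+1)) j) = true ∧
        (decide (j < s) && valid E (a s) j) = false then ew E j else 0) +
      (if act s ∧ j < s ∧ valid E (a s) j = true ∧ s.unpair.1 < (sg E j).length then ew E j else 0) := by
      intro s j _ _
      have hw := ew_nonneg E j
      by_cases h1 : (decide (j < s+1) && valid E (a (s+1)) j) = true
      · have h1' := h1
        rw [Bool.and_eq_true] at h1'
        rw [ew_eq_of_valid h1'.2]
        by_cases h2 : (decide (j < s) && valid E (a s) j) = false
        · simp only [h1, h2, true_or, and_self, if_true]
          have : (0:ℝ) ≤ (if act s ∧ j < s ∧ valid E (a s) j = true ∧ s.unpair.1 < (sg E j).length then ew E j else 0) := by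
            split_ifs; exacts [hw, le_rfl]
          have e : (if True ∧ True then ew E j else 0) = ew E j := by simp
          linarith
        · by_cases h3 : seg (b (s+1)) (sg E j).length = seg (b s) (sg E j).length
          · rw [if_neg (by rintro ⟨-, h4 | h4⟩; exacts [h2 h4, h4 h3])]
            apply add_nonneg <;> (split_ifs; exacts [hw, le_rfl])
          · have h2' : j < s ∧ valid E (a s) j = true := by
              rw [Bool.not_eq_false, Bool.and_eq_true, decide_eq_true_eq] at h2; exact h2
            have h4 : act s ∧ s.unpair.1 < (sg E j).length := by
              by_contra h5
              apply h3
              rw [seg_eq_iff]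
              intro x hx
              rw [Bool.eq_iff_iff, h.step]
              constructor
              · rintro (h6 | ⟨h6, rfl⟩)
                · exact h6
                · exact absurd ⟨h6, hx⟩ h5
              · exact Or.inl
            rw [if_pos ⟨h1, Or.inr h3⟩, if_pos (c := act s ∧ _) ⟨h4.1, h2'.1, h2'.2, h4.2⟩]
            have : (0:ℝ) ≤ (if (decide (j < s+1) && valid E (a (s+1)) j) = true ∧
              (decide (j < s) && valid E (a s) j) = false then ew E j else 0) := by
                split_ifs; exacts [hw, le_rfl]
            linarith
      · rw [if_neg (fun hh => h1 hh.1)]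
        apply add_nonneg <;> (split_ifs; exacts [hw, le_rfl])
    refine (Finset.sum_le_sum fun s hs => Finset.sum_le_sum fun j hj =>
      hb s j (Finset.mem_range.1 hs) (Finset.mem_range.1 hj)).trans ?_
    simp only [Finset.sum_add_distrib]
    have p1 : ∑ s ∈ Finset.range S, ∑ j ∈ Finset.range S,
      (if (decide (j < s+1) && valid E (a (s+1)) j) = true ∧
        (decide (j < s) && valid E (a s) j) = false then ew E j else 0) ≤ 1 := by
      rw [Finset.sum_comm]
      refine le_trans (Finset.sum_le_sum fun j _ => ?_) (kraft_enum hU.1 hE (Finset.range S))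
      apply sum_le_of_unique (ew_nonneg E j)
      have key : ∀ s t, s < t → (decide (j < s+1) && valid E (a (s+1)) j) = true →
          (decide (j < t) && valid E (a t) j) = false →
          (decide (j < t+1) && valid E (a (t+1)) j) = true → False := by
        intro s t hst h1 h2 h3
        rw [Bool.and_eq_true, decide_eq_true_eq] at h1 h3
        have := valid_convex hm (show s+1 ≤ t from hst) (show t ≤ t+1 by omega) h1.2 h3.2
        rw [this, Bool.and_true, decide_eq_false_iff_not] at h2
        omega
      intro s _ t _ hs ht
      by_contra hne
      rcases lt_or_gt_of_ne hne with hlt | hlt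
      · exact key s t hlt hs.1 ht.2 ht.1
      · exact key t s hlt ht.1 hs.2 hs.1
    have p2 : ∑ s ∈ Finset.range S, ∑ j ∈ Finset.range S,
      (if act s ∧ j < s ∧ valid E (a s) j = true ∧ s.unpair.1 < (sg E j).length then ew E j else 0) ≤ 1 := by
      refine le_trans (Finset.sum_le_sum fun s hs => ?_) (h.act_sum hU.1 hE S)
      rw [Finset.mem_range] at hs
      by_cases hact : act s
      · simp only [hact, true_and, if_true]
        refine le_trans (le_of_eq ?_) (hdom s hact)
        unfold mass
        rw [← Finset.sum_subset (Finset.range_mono hs.le)]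
        · apply Finset.sum_congr rfl
          intro j hj
          rw [Finset.mem_range] at hj
          simp [hj]
        · intro j _ hj
          rw [Finset.mem_range] at hj
          simp [hj]
      · simp [hact]
    linarith)
  refine ⟨c, fun n => ?_⟩
  apply le_KC_add
  intro ρ hρ
  obtain ⟨j, hj⟩ := hE.complete _ _ hρ
  have hsg : sg E j = restrSet X n := by simp [sg, hj]
  have hlen : (sg E j).length = n := by rw [hsg]; simp [restrSet]
  have hrl : rl E j = ρ.length := by simp [rl, hj]
  obtain ⟨s1, hs1⟩ := approx_agree ha n
  obtain ⟨s2, hs2⟩ := approx_agree h.approx n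
  let s := max (max s1 s2) (j+1)
  have hv := hc s j (by
    have : j < s := lt_of_lt_of_le (Nat.lt_succ_self j) (le_max_right _ _)
    have h2 : valid E (a s) j = true := by
      rw [valid_iff, hlen, hsg, restrSet_eq_seg]
      refine ⟨by simp [hj], seg_eq_iff.2 fun x hx => (hs1 s ?_ x hx).symm⟩
      exact le_trans (le_max_left s1 s2) (le_max_left _ _)
    simp [this, h2])
  rw [hlen, hrl] at hv
  rw [restrSet_eq_seg]
  have e : seg (b s) n = seg (fun i => decide (i ∈ {x | ∃ s, b s x = true})) n :=
    seg_eq_iff.2 fun x hx => hs2 s (le_trans (le_max_right s1 s2) (le_max_left _ _)) x hx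
  rw [← e]
  exact hv

end IsB

/-- total mass of units at positions `≥ n` -/
noncomputable def tail (G : List (ℕ × ℕ)) (n : ℕ) : ℝ :=
  ((G.filter fun u => decide (n ≤ u.1)).map fun u => (1/2:ℝ)^u.2).sum

theorem ew_of_le {E : ℕ → Option (Str × Str)} {j r : ℕ} (h : (E j).isSome = true)
    (h2 : rl E j ≤ r) : (1/2:ℝ)^r ≤ ew E j := by
  unfold rl at h2
  unfold ew
  cases hj : E j with
  | none => rw [hj] at h; simp at h
  | some p =>
    rw [hj] at h2
    exact pow_le_pow_of_le_one (by norm_num) (by norm_num) h2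

theorem tail_le {E : ℕ → Option (Str × Str)} {g : ℕ → Bool} {G : List (ℕ × ℕ)} {c n x s : ℕ}
    {j : ℕ × ℕ → ℕ} (hnd : (G.map Prod.fst).Nodup) (hx : x < 2 * n)
    (h1 : ∀ u ∈ G, (sg E (j u)).length = 2 * u.1) (h2 : ∀ u ∈ G, valid E g (j u) = true)
    (h3 : ∀ u ∈ G, rl E (j u) ≤ u.2 + c) (h4 : ∀ u ∈ G, j u < s) :
    (1/2:ℝ)^c * tail G n ≤ mass E g x s := by
  let Gf := (G.filter fun u => decide (n ≤ u.1)).toFinset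
  have hG : ∀ u ∈ Gf, u ∈ G ∧ n ≤ u.1 := by intro u hu; simpa [Gf] using hu
  have e1 : tail G n = ∑ u ∈ Gf, (1/2:ℝ)^u.2 := by
    rw [List.sum_toFinset _ ((List.Nodup.of_map _ hnd).filter _)]; rfl
  rw [e1, Finset.mul_sum]
  have e2 : ∑ u ∈ Gf, (1/2:ℝ)^c * (1/2:ℝ)^u.2 ≤ ∑ u ∈ Gf, ew E (j u) := by
    apply Finset.sum_le_sum
    intro u hu
    rw [← pow_add]
    exact ew_of_le (valid_iff.1 (h2 u (hG u hu).1)).1 (by have := h3 u (hG u hu).1; omega)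
  refine e2.trans ?_
  rw [← Finset.sum_image (g := j) (f := fun i => ew E i)]
  · unfold mass
    rw [← Finset.sum_filter]
    apply Finset.sum_le_sum_of_subset_of_nonneg
    · intro i hi
      rw [Finset.mem_image] at hi
      obtain ⟨u, hu, rfl⟩ := hi
      have := hG u hu
      rw [Finset.mem_filter, Finset.mem_range]
      exact ⟨h4 u this.1, h2 u this.1, by rw [h1 u this.1]; omega⟩
    · intros; exact ew_nonneg _ _
  · intro u hu v hv huv
    have hu' := (hG u hu).1
    have hv' := (hG v hv).1
    have := (h1 u hu').symm.trans ((congrArg (fun i => (sg E i).length) huv).trans (h1 v hv'))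
    exact List.inj_on_of_nodup_map hnd hu' hv' (by omega)

theorem IsB.reply {U : Str →. Str} (hU : OptimalPF U) {E} (hE : IsEnum U E) {A D : Set ℕ}
    {aA aD b : ℕ → ℕ → Bool} {act : ℕ → Prop} (hA : IsApprox A aA) (hD : IsApprox D aD)
    (h : IsB E aA aD b act) (ht : KTrivialSet U {x | ∃ s, b s x = true}) :
    ∃ c : ℕ, ∀ G : List (ℕ × ℕ), (G.map Prod.fst).Nodup →
      (∀ u ∈ G, KC U (zeroStr (2 * u.1)) ≤ (u.2 : ℕ∞) ∧ 4 * 2 ^ (u.2 + c) ≤ u.1) →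
      ∃ t0, ∀ t ≥ t0, ∀ u ∈ G,
        (1/2:ℝ)^c * tail G u.1 ≤ mass E (aA t) u.1 t + mass E (aD t) u.1 t := by
  obtain ⟨c, hc⟩ := ht
  refine ⟨c + 1, fun G hnd hG => ?_⟩
  have hj : ∀ u : ℕ × ℕ, ∃ j, u ∈ G → (E j).isSome = true ∧
      sg E j = restrSet {x | ∃ s, b s x = true} (2 * u.1) ∧ rl E j ≤ u.2 + c := by
    intro u
    by_cases hu : u ∈ G
    · have h1 := (hc (2 * u.1)).trans (add_le_add_left (hG u hu).1 _)
      obtain ⟨ρ, hρ, hl⟩ := exists_of_KC_le (n := u.2 + c) (by exact_mod_cast h1)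
      obtain ⟨j, hj⟩ := hE.complete _ _ hρ
      exact ⟨j, fun _ => ⟨by simp [hj], by simp [sg, hj], by simpa [rl, hj] using hl⟩⟩
    · exact ⟨0, fun h => absurd h hu⟩
  choose j hj using hj
  have hlen : ∀ u ∈ G, (sg E (j u)).length = 2 * u.1 := by
    intro u hu; rw [(hj u hu).2.1]; simp [restrSet]
  have hev : ∀ᶠ s in atTop, ∀ u ∈ G, valid E (b s) (j u) = true ∧ j u < s := by
    have : ∀ u ∈ {u | u ∈ G}, ∀ᶠ s in atTop, valid E (b s) (j u) = true ∧ j u < s := by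
      intro u hu
      obtain ⟨s0, hs0⟩ := approx_agree h.approx (2 * u.1)
      filter_upwards [eventually_ge_atTop s0, eventually_gt_atTop (j u)] with s h1 h2
      refine ⟨valid_iff.2 ⟨(hj u hu).1, ?_⟩, h2⟩
      rw [hlen u hu, (hj u hu).2.1, restrSet_eq_seg, seg_eq_iff]
      exact fun x hx => (hs0 s h1 x hx).symm
    exact (Filter.eventually_all_finite (List.finite_toSet G)).2 this
  have main : ∀ u ∈ {u | u ∈ G}, ∀ᶠ t in atTop,
      (1/2:ℝ)^(c+1) * tail G u.1 ≤ mass E (aA t) u.1 t + mass E (aD t) u.1 t := by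
    intro u hu
    have hG2 := (hG u hu).2
    have hn : 1 ≤ u.1 := le_trans (by have := Nat.one_le_two_pow (n := u.2 + (c+1)); omega) hG2
    obtain ⟨x, hx1, hx2, hx3⟩ := h.hole hU.1 hE hn
    have hpos : (1/2:ℝ)^u.2 ≤ tail G u.1 := by
      unfold tail
      apply List.single_le_sum
      · intro y hy
        rw [List.mem_map] at hy
        obtain ⟨v, _, rfl⟩ := hy
        positivity
      · exact List.mem_map.2 ⟨u, by simpa using hu, rfl⟩
    have hmb : ∀ᶠ s in atTop, (1/2:ℝ)^c * tail G u.1 ≤ mass E (b s) x s := by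
      filter_upwards [hev] with s hs
      exact tail_le hnd hx2 hlen (fun v hv => (hs v hv).1) (fun v hv => (hj v hv).2.2)
        (fun v hv => (hs v hv).2)
    obtain ⟨lA, hlA⟩ := mass_tendsto hU.1 hE hA x
    obtain ⟨lD, hlD⟩ := mass_tendsto hU.1 hE hD x
    have hlim := hlA.add hlD
    have hfreq : ∃ᶠ s in atTop, (1/2:ℝ)^c * tail G u.1 ≤
        mass E (aA s) x s + mass E (aD s) x s := by
      rw [frequently_atTop]
      intro s0
      obtain ⟨s1, hs1⟩ := eventually_atTop.1 hmb
      let s := Nat.pair x (max s0 s1)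
      have hs : max s0 s1 ≤ s := Nat.right_le_pair _ _
      have hsx : s.unpair.1 = x := by simp [s]
      refine ⟨s, le_trans (le_max_left _ _) hs, ?_⟩
      have hm := hs1 s (le_trans (le_max_right _ _) hs)
      by_contra hcon
      have hnact : act s := by
        rw [h.act_iff, hsx]
        refine ⟨hx3 s, by linarith, ?_⟩
        have h4 : (4:ℝ) * 2^(u.2 + (c+1)) ≤ x := by exact_mod_cast hG2.trans hx1
        have h5 : (1/2:ℝ)^(u.2 + (c+1)) ≤ mass E (b s) x s := by
          have h6 : (1/2:ℝ)^(u.2 + (c+1)) ≤ (1/2:ℝ)^c * (1/2)^u.2 := by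
            rw [← pow_add]
            exact pow_le_pow_of_le_one (by norm_num) (by norm_num) (by omega)
          have h7 : (1/2:ℝ)^c * (1/2)^u.2 ≤ (1/2:ℝ)^c * tail G u.1 :=
            mul_le_mul_of_nonneg_left hpos (by positivity)
          linarith
        have h8 := two_mul_half (u.2 + (c+1))
        calc (4:ℝ) = 4 * 2^(u.2 + (c+1)) * (1/2)^(u.2 + (c+1)) := by rw [mul_assoc, h8, mul_one]
          _ ≤ x * mass E (b s) x s :=
            mul_le_mul h4 h5 (by positivity) (by positivity)
      have : b (s+1) x = true := (h.step s x).2 (Or.inr ⟨hnact, hsx.symm⟩)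
      rw [hx3] at this
      exact Bool.noConfusion this
    have hge : (1/2:ℝ)^c * tail G u.1 ≤ lA + lD := by
      by_contra hcon
      obtain ⟨s, h1, h2⟩ := (hfreq.and_eventually
        (hlim.eventually (gt_mem_nhds (not_le.1 hcon)))).exists
      linarith
    have hp : (0:ℝ) < (1/2:ℝ)^c * tail G u.1 :=
      mul_pos (by positivity) (lt_of_lt_of_le (by positivity) hpos)
    have hlt : (1/2:ℝ)^(c+1) * tail G u.1 < lA + lD := by
      have : (1/2:ℝ)^(c+1) * tail G u.1 = (1/2) * ((1/2:ℝ)^c * tail G u.1) := by ring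
      linarith
    filter_upwards [hlim.eventually (lt_mem_nhds hlt)] with t ht
    have := mass_anti E (aA t) t hx1
    have := mass_anti E (aD t) t hx1
    linarith
  have := (Filter.eventually_all_finite (List.finite_toSet G)).2 main
  exact eventually_atTop.1 this

/-! ### The stack machine -/

section morepr
variable {α β γ σ : Type*} [Primcodable α] [Primcodable β] [Primcodable γ] [Primcodable σ]

@[fun_prop] theorem pr_foldr {f : α → List β} {g : α → σ} {h : α → β → σ → σ}
    (hf : Primrec f) (hg : Primrec g) (hh : Primrec fun p : α × β × σ => h p.1 p.2.1 p.2.2) :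
    Primrec (fun a => (f a).foldr (h a) (g a)) :=
  Primrec.list_foldr (h := fun a p => h a p.1 p.2) hf hg hh

@[fun_prop] theorem pr_head? {f : α → List β} (hf : Primrec f) : Primrec (fun a => (f a).head?) :=
  Primrec.list_head?.comp hf

@[fun_prop] theorem pr_tail {f : α → List β} (hf : Primrec f) : Primrec (fun a => (f a).tail) :=
  Primrec.list_tail.comp hf

end morepr

/-- a packet: start, label time, goal exponent, units `(n, q)` -/
abbrev Pkt := ℕ × ℕ × ℕ × List (ℕ × ℕ)

/-- a frame: `(lev, q, s, k)`, packets (latest first), pending `(s, units)` -/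
abbrev Frm := (ℕ × ℕ × ℕ × ℕ) × List Pkt × Option (ℕ × List (ℕ × ℕ))

/-- time and stack -/
abbrev Stt := ℕ × List Frm

section machine
variable (E : ℕ → Option (Str × Str)) (a : Bool → ℕ → ℕ → Bool)

/-- label of a unit `(e, n, q)` -/
def labB (v : ℕ × ℕ × ℕ) : Bool :=
  decide (massN E (a false v.1) v.2.1 v.1 ≤ massN E (a true v.1) v.2.1 v.1)

/-- the side `X` approximation changed below `n` between `e` and `t` -/
def chgB (t : ℕ) (X : Bool) (v : ℕ × ℕ × ℕ) : Bool :=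
  !decide (seg (a X t) v.2.1 = seg (a X v.1) v.2.1)

/-- the unit is lost at `t` -/
def lostB (t : ℕ) (v : ℕ × ℕ × ℕ) : Bool := chgB a t (labB E a v) v

/-- labelled units of a list of packets -/
def fl (P : List Pkt) : List (ℕ × ℕ × ℕ) := P.flatMap fun p => p.2.2.2.map fun u => (p.2.1, u)

/-- scaled sum of units -/
def usN (t : ℕ) (l : List (ℕ × ℕ × ℕ)) : ℕ := (l.map fun v => 2 ^ (t - v.2.2)).sum

/-- scaled lost mass -/
def lossN (t : ℕ) (P : List Pkt) : ℕ := usN t ((fl P).filter fun v => lostB E a t v)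

/-- active with label `X` -/
def actB (t : ℕ) (X : Bool) (v : ℕ × ℕ × ℕ) : Bool := decide (labB E a v = X) && !(lostB E a t v)

/-- scaled active mass -/
def acN (t : ℕ) (X : Bool) (P : List Pkt) : ℕ := usN t ((fl P).filter fun v => actB E a t X v)

/-- entry `j` describes a zero string -/
def isZ (j : ℕ) : Bool := (E j).isSome && (sg E j).all fun b => !b

/-- scaled mass of zero string descriptions -/
def zN (t y k : ℕ) : ℕ :=
  (((List.range k).filter fun j => isZ E j).map fun j => 2 ^ (t - (y + rl E j))).sum

/-- scaled tail of a list of units -/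
def tailN (t : ℕ) (G : List (ℕ × ℕ)) (n : ℕ) : ℕ :=
  ((G.filter fun u => decide (n ≤ u.1)).map fun u => 2 ^ (t - u.2)).sum

/-- response condition for a single position -/
def rspN1 (d t : ℕ) (G : List (ℕ × ℕ)) (n : ℕ) : Bool :=
  decide (tailN t G n ≤ 2 ^ (2 * d) * (massN E (a true t) n t + massN E (a false t) n t))

/-- response condition -/
def rspN (d t : ℕ) (G : List (ℕ × ℕ)) : Bool := G.all fun u => rspN1 E a d t G u.1

/-- greedy step -/
def grStep (t cap : ℕ) (u : ℕ × ℕ) (r : List (ℕ × ℕ) × ℕ) : List (ℕ × ℕ) × ℕ :=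
  cond (decide (r.2 + 2 ^ (t - u.2) ≤ cap)) (u :: r.1, r.2 + 2 ^ (t - u.2)) r

/-- greedy sublist of mass at most `cap` -/
def greedy (t cap : ℕ) (l : List (ℕ × ℕ)) : List (ℕ × ℕ) :=
  (l.foldr (fun u r => grStep t cap u r) ([], 0)).1

/-- the constant `c0` -/
def c0 (d : ℕ) : ℕ := 2 * d + 8

/-- complete event for side `X` -/
def cmpX (d t : ℕ) (X : Bool) (f : Frm) : Bool :=
  decide (zN E t (f.1.2.1 + c0 d) f.1.2.2.2 <
    acN E a t X f.2.1 + 2 ^ (t - (f.1.2.1 + c0 d + f.1.2.2.2)))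

/-- the frame has lost its goal -/
def fullB (t : ℕ) (f : Frm) : Bool := decide (2 ^ (t - f.1.2.1) ≤ lossN E a t f.2.1)

/-- pop, giving the units `G` to the parent -/
def popTo (t s : ℕ) (G : List (ℕ × ℕ)) (rest : List Frm) : Stt :=
  (t, rest.head?.elim [] fun g => (g.1, g.2.1, Option.some (s, G)) :: rest.tail)

/-- position of the unit issued by a level `0` frame -/
def newPos (d t : ℕ) (f : Frm) : ℕ := t + 2 ^ (f.1.2.1 + 2 * d + 2)

/-- lost units of a frame -/
def lostL (t : ℕ) (f : Frm) : List (ℕ × ℕ) :=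
  ((fl f.2.1).filter fun v => lostB E a t v).map fun v => v.2

/-- step for a frame with pending units -/
def stepPend (d t : ℕ) (f : Frm) (rest : List Frm) (sG : ℕ × List (ℕ × ℕ)) : Stt :=
  cond (rspN E a d t sG.2)
    (t + 1, (f.1, (sG.1, t, f.1.2.1 + c0 d + f.1.2.2.2, sG.2) :: f.2.1, Option.none) :: rest)
    (t + 1, f :: rest)

/-- the pushed child frame -/
def child (d t : ℕ) (f : Frm) : Frm :=
  ((f.1.1 - 1, f.1.2.1 + c0 d + f.1.2.2.2, t, 0), [], Option.none)

/-- step for a frame without pending units -/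
def stepNone (d t : ℕ) (f : Frm) (rest : List Frm) : Stt :=
  cond (fullB E a t f)
    (popTo (t + 1) f.1.2.2.1 (greedy t (2 ^ (t - f.1.2.1)) (lostL E a t f)) rest)
    (cond (cmpX E a d t true f || cmpX E a d t false f)
      (t + 1, ((f.1.1, f.1.2.1, f.1.2.2.1, f.1.2.2.2 + 1), f.2) :: rest)
      (t + (f.1.2.1 + c0 d + f.1.2.2.2) + c0 d + 1, child d t f :: f :: rest))

/-- step with the top frame `f` -/
def stepF (d t : ℕ) (f : Frm) (rest : List Frm) : Stt :=
  cond (decide (f.1.1 = 0))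
    (popTo (newPos d t f + 1) f.1.2.2.1 [(newPos d t f, f.1.2.1)] rest)
    (f.2.2.elim (stepNone E a d t f rest) (fun sG => stepPend E a d t f rest sG))

/-- one step -/
def step (d : ℕ) (σ : Stt) : Stt :=
  σ.2.head?.elim σ fun f => stepF E a d σ.1 f σ.2.tail

/-- unit issued at the step -/
def issue (d : ℕ) (σ : Stt) : Option (ℕ × ℕ) :=
  σ.2.head?.elim Option.none fun f =>
    cond (decide (f.1.1 = 0)) (Option.some (newPos d σ.1 f, f.1.2.1)) Option.none

/-- initial state -/
def init (d : ℕ) : Stt :=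
  (c0 d + 2, [((2 ^ (2 * d + 4), 1, 0, 0), [], Option.none)])

/-- the run -/
def run (d T : ℕ) : Stt := Nat.rec (init d) (fun _ σ => step E a d σ) T

end machine

section prims
variable {α : Type*} [Primcodable α] {E : ℕ → Option (Str × Str)} {a : Bool → ℕ → ℕ → Bool}

theorem pr_a (ha : Primrec fun p : Bool × ℕ × ℕ => a p.1 p.2.1 p.2.2)
    {f : α → Bool} {g h : α → ℕ} (hf : Primrec f) (hg : Primrec g) (hh : Primrec h) :
    Primrec (fun x => a (f x) (g x) (h x)) := ha.comp (hf.pair (hg.pair hh))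

theorem pr_massA (hE : Primrec E) (ha : Primrec fun p : Bool × ℕ × ℕ => a p.1 p.2.1 p.2.2)
    (X : Bool) {f g h : α → ℕ} (hf : Primrec f) (hg : Primrec g) (hh : Primrec h) :
    Primrec (fun x => massN E (a X (f x)) (g x) (h x)) := by
  refine pr_massN (g := fun x => a X (f x)) hE ?_ hg hh
  exact pr_a ha (by fun_prop) (by fun_prop) (by fun_prop)

theorem pr_labB (hE : Primrec E) (ha : Primrec fun p : Bool × ℕ × ℕ => a p.1 p.2.1 p.2.2) :
    Primrec (labB E a) := by
  have h1 := pr_massA (α := ℕ × ℕ × ℕ) (f := fun v => v.1) (g := fun v => v.2.1)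
    (h := fun v => v.1) hE ha true (by fun_prop) (by fun_prop) (by fun_prop)
  have h2 := pr_massA (α := ℕ × ℕ × ℕ) (f := fun v => v.1) (g := fun v => v.2.1)
    (h := fun v => v.1) hE ha false (by fun_prop) (by fun_prop) (by fun_prop)
  unfold labB; fun_prop

theorem pr_chgB (ha : Primrec fun p : Bool × ℕ × ℕ => a p.1 p.2.1 p.2.2)
    {t : α → ℕ} {X : α → Bool} {v : α → ℕ × ℕ × ℕ} (ht : Primrec t) (hX : Primrec X)
    (hv : Primrec v) : Primrec (fun x => chgB a (t x) (X x) (v x)) := by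
  have h1 : Primrec fun x => seg (a (X x) (t x)) (v x).2.1 :=
    pr_seg (g := fun x => a (X x) (t x)) (pr_a ha (by fun_prop) (by fun_prop) (by fun_prop))
      (by fun_prop)
  have h2 : Primrec fun x => seg (a (X x) (v x).1) (v x).2.1 :=
    pr_seg (g := fun x => a (X x) (v x).1) (pr_a ha (by fun_prop) (by fun_prop) (by fun_prop))
      (by fun_prop)
  unfold chgB; fun_prop

theorem pr_lostB (hE : Primrec E) (ha : Primrec fun p : Bool × ℕ × ℕ => a p.1 p.2.1 p.2.2)
    {t : α → ℕ} {v : α → ℕ × ℕ × ℕ} (ht : Primrec t)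
    (hv : Primrec v) : Primrec (fun x => lostB E a (t x) (v x)) := by
  have := pr_labB hE ha
  unfold lostB
  exact pr_chgB ha ht (by fun_prop) hv

@[fun_prop] theorem pr_fl {P : α → List Pkt} (hP : Primrec P) : Primrec (fun x => fl (P x)) := by
  unfold fl; fun_prop

@[fun_prop] theorem pr_usN {t : α → ℕ} {l : α → List (ℕ × ℕ × ℕ)} (ht : Primrec t)
    (hl : Primrec l) : Primrec (fun x => usN (t x) (l x)) := by
  unfold usN; fun_prop

theorem pr_lossN (hE : Primrec E) (ha : Primrec fun p : Bool × ℕ × ℕ => a p.1 p.2.1 p.2.2)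
    {t : α → ℕ} {P : α → List Pkt} (ht : Primrec t) (hP : Primrec P) :
    Primrec (fun x => lossN E a (t x) (P x)) := by
  have : Primrec fun p : α × ℕ × ℕ × ℕ => lostB E a (t p.1) p.2 :=
    pr_lostB hE ha (by fun_prop) (by fun_prop)
  unfold lossN; fun_prop

theorem pr_actB (hE : Primrec E) (ha : Primrec fun p : Bool × ℕ × ℕ => a p.1 p.2.1 p.2.2)
    {t : α → ℕ} {X : α → Bool} {v : α → ℕ × ℕ × ℕ} (ht : Primrec t) (hX : Primrec X)
    (hv : Primrec v) : Primrec (fun x => actB E a (t x) (X x) (v x)) := by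
  have := pr_lostB hE ha ht hv
  have := pr_labB hE ha
  unfold actB; fun_prop

theorem pr_acN (hE : Primrec E) (ha : Primrec fun p : Bool × ℕ × ℕ => a p.1 p.2.1 p.2.2)
    {t : α → ℕ} {X : α → Bool} {P : α → List Pkt} (ht : Primrec t) (hX : Primrec X)
    (hP : Primrec P) : Primrec (fun x => acN E a (t x) (X x) (P x)) := by
  have : Primrec fun p : α × ℕ × ℕ × ℕ => actB E a (t p.1) (X p.1) p.2 :=
    pr_actB hE ha (by fun_prop) (by fun_prop) (by fun_prop)
  unfold acN; fun_prop

theorem pr_isZ (hE : Primrec E) : Primrec (isZ E) := by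
  have : Primrec (sg E) := pr_sg hE Primrec.id
  unfold isZ; fun_prop

theorem pr_zN (hE : Primrec E) {t y k : α → ℕ} (ht : Primrec t) (hy : Primrec y)
    (hk : Primrec k) : Primrec (fun x => zN E (t x) (y x) (k x)) := by
  have := pr_isZ hE
  have : Primrec (rl E) := pr_rl hE Primrec.id
  unfold zN; fun_prop

@[fun_prop] theorem pr_tailN {t n : α → ℕ} {G : α → List (ℕ × ℕ)} (ht : Primrec t)
    (hG : Primrec G) (hn : Primrec n) : Primrec (fun x => tailN (t x) (G x) (n x)) := by
  unfold tailN; fun_prop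

theorem pr_rspN1 (hE : Primrec E) (ha : Primrec fun p : Bool × ℕ × ℕ => a p.1 p.2.1 p.2.2)
    {d t n : α → ℕ} {G : α → List (ℕ × ℕ)} (hd : Primrec d) (ht : Primrec t)
    (hG : Primrec G) (hn : Primrec n) :
    Primrec (fun x => rspN1 E a (d x) (t x) (G x) (n x)) := by
  have h1 := pr_massA hE ha true ht hn ht
  have h2 := pr_massA hE ha false ht hn ht
  unfold rspN1; fun_prop

theorem pr_rspN (hE : Primrec E) (ha : Primrec fun p : Bool × ℕ × ℕ => a p.1 p.2.1 p.2.2)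
    {d t : α → ℕ} {G : α → List (ℕ × ℕ)} (hd : Primrec d) (ht : Primrec t)
    (hG : Primrec G) : Primrec (fun x => rspN E a (d x) (t x) (G x)) := by
  have : Primrec fun p : α × ℕ × ℕ => rspN1 E a (d p.1) (t p.1) (G p.1) p.2.1 :=
    pr_rspN1 hE ha (by fun_prop) (by fun_prop) (by fun_prop) (by fun_prop)
  unfold rspN; fun_prop

@[fun_prop] theorem pr_grStep {t c : α → ℕ} {u : α → ℕ × ℕ} {r : α → List (ℕ × ℕ) × ℕ}
    (ht : Primrec t) (hc : Primrec c) (hu : Primrec u) (hr : Primrec r) :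
    Primrec (fun x => grStep (t x) (c x) (u x) (r x)) := by
  unfold grStep; fun_prop

@[fun_prop] theorem pr_greedy {t c : α → ℕ} {l : α → List (ℕ × ℕ)} 
    (ht : Primrec t) (hc : Primrec c) (hl : Primrec l) :
    Primrec (fun x => greedy (t x) (c x) (l x)) := by
  unfold greedy; fun_prop

@[fun_prop] theorem pr_c0 {d : α → ℕ} (hd : Primrec d) : Primrec (fun x => c0 (d x)) := by
  unfold c0; fun_prop

theorem pr_cmpX (hE : Primrec E) (ha : Primrec fun p : Bool × ℕ × ℕ => a p.1 p.2.1 p.2.2)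
    {d t : α → ℕ} {X : α → Bool} {f : α → Frm} (hd : Primrec d) (ht : Primrec t)
    (hX : Primrec X) (hf : Primrec f) :
    Primrec (fun x => cmpX E a (d x) (t x) (X x) (f x)) := by
  have h1 : Primrec fun x => acN E a (t x) (X x) (f x).2.1 := pr_acN hE ha ht hX (by fun_prop)
  have h2 : Primrec fun x => zN E (t x) ((f x).1.2.1 + c0 (d x)) (f x).1.2.2.2 :=
    pr_zN hE ht (by fun_prop) (by fun_prop)
  unfold cmpX; fun_prop

theorem pr_fullB (hE : Primrec E) (ha : Primrec fun p : Bool × ℕ × ℕ => a p.1 p.2.1 p.2.2)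
    {t : α → ℕ} {f : α → Frm} (ht : Primrec t) (hf : Primrec f) :
    Primrec (fun x => fullB E a (t x) (f x)) := by
  have h1 : Primrec fun x => lossN E a (t x) (f x).2.1 := pr_lossN hE ha ht (by fun_prop)
  unfold fullB; fun_prop

@[fun_prop] theorem pr_popTo {t s : α → ℕ} {G : α → List (ℕ × ℕ)} {r : α → List Frm}
    (ht : Primrec t) (hs : Primrec s) (hG : Primrec G) (hr : Primrec r) :
    Primrec (fun x => popTo (t x) (s x) (G x) (r x)) := by
  unfold popTo; fun_prop

@[fun_prop] theorem pr_newPos {d t : α → ℕ} {f : α → Frm} (hd : Primrec d) (ht : Primrec t)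
    (hf : Primrec f) : Primrec (fun x => newPos (d x) (t x) (f x)) := by
  unfold newPos; fun_prop

theorem pr_lostL (hE : Primrec E) (ha : Primrec fun p : Bool × ℕ × ℕ => a p.1 p.2.1 p.2.2)
    {t : α → ℕ} {f : α → Frm} (ht : Primrec t) (hf : Primrec f) :
    Primrec (fun x => lostL E a (t x) (f x)) := by
  have : Primrec fun p : α × ℕ × ℕ × ℕ => lostB E a (t p.1) p.2 :=
    pr_lostB hE ha (by fun_prop) (by fun_prop)
  unfold lostL; fun_prop

theorem pr_stepPend (hE : Primrec E) (ha : Primrec fun p : Bool × ℕ × ℕ => a p.1 p.2.1 p.2.2)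
    {d t : α → ℕ} {f : α → Frm} {r : α → List Frm} {sG : α → ℕ × List (ℕ × ℕ)}
    (hd : Primrec d) (ht : Primrec t) (hf : Primrec f) (hr : Primrec r) (hs : Primrec sG) :
    Primrec (fun x => stepPend E a (d x) (t x) (f x) (r x) (sG x)) := by
  have h1 : Primrec fun x => rspN E a (d x) (t x) (sG x).2 := pr_rspN hE ha hd ht (by fun_prop)
  have h2 : Primrec fun x => ((sG x).1, t x, (f x).1.2.1 + c0 (d x) + (f x).1.2.2.2, (sG x).2) := by
    fun_prop
  unfold stepPend; fun_prop

@[fun_prop] theorem pr_child {d t : α → ℕ} {f : α → Frm} (hd : Primrec d) (ht : Primrec t)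
    (hf : Primrec f) : Primrec (fun x => child (d x) (t x) (f x)) := by
  unfold child; fun_prop

theorem pr_stepNone (hE : Primrec E) (ha : Primrec fun p : Bool × ℕ × ℕ => a p.1 p.2.1 p.2.2)
    {d t : α → ℕ} {f : α → Frm} {r : α → List Frm} 
    (hd : Primrec d) (ht : Primrec t) (hf : Primrec f) (hr : Primrec r) :
    Primrec (fun x => stepNone E a (d x) (t x) (f x) (r x)) := by
  have h1 := pr_fullB hE ha ht hf
  have h2 := pr_lostL hE ha ht hf
  have h3 := pr_cmpX hE ha hd ht (pr_const true) hf
  have h4 := pr_cmpX hE ha hd ht (pr_const false) hf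
  have h5 : Primrec fun x => popTo (t x + 1) (f x).1.2.2.1
    (greedy (t x) (2 ^ (t x - (f x).1.2.1)) (lostL E a (t x) (f x))) (r x) := by fun_prop
  have h6 : Primrec fun x => (t x + 1,
    (((f x).1.1, (f x).1.2.1, (f x).1.2.2.1, (f x).1.2.2.2 + 1), (f x).2) :: r x) := by fun_prop
  have h7 : Primrec fun x => (t x + ((f x).1.2.1 + c0 (d x) + (f x).1.2.2.2) + c0 (d x) + 1,
    child (d x) (t x) (f x) :: f x :: r x) := by fun_prop
  unfold stepNone
  exact Primrec.cond h1 h5 (Primrec.cond (Primrec.or.comp h3 h4) h6 h7)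

theorem pr_stepF (hE : Primrec E) (ha : Primrec fun p : Bool × ℕ × ℕ => a p.1 p.2.1 p.2.2)
    {d t : α → ℕ} {f : α → Frm} {r : α → List Frm} 
    (hd : Primrec d) (ht : Primrec t) (hf : Primrec f) (hr : Primrec r) :
    Primrec (fun x => stepF E a (d x) (t x) (f x) (r x)) := by
  have h1 := pr_stepNone hE ha hd ht hf hr
  have h2 : Primrec fun p : α × ℕ × List (ℕ × ℕ) =>
      stepPend E a (d p.1) (t p.1) (f p.1) (r p.1) p.2 :=
    pr_stepPend hE ha (by fun_prop) (by fun_prop) (by fun_prop) (by fun_prop) (by fun_prop)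
  have h3 : Primrec fun x => popTo (newPos (d x) (t x) (f x) + 1) (f x).1.2.2.1
      [(newPos (d x) (t x) (f x), (f x).1.2.1)] (r x) := by fun_prop
  unfold stepF
  exact Primrec.cond (by fun_prop) h3 (pr_elim (by fun_prop) h1 h2)

theorem pr_step (hE : Primrec E) (ha : Primrec fun p : Bool × ℕ × ℕ => a p.1 p.2.1 p.2.2)
    {d : α → ℕ} {σ : α → Stt} (hd : Primrec d) (hσ : Primrec σ) :
    Primrec (fun x => step E a (d x) (σ x)) := by
  have h2 : Primrec fun p : α × Frm => stepF E a (d p.1) (σ p.1).1 p.2 (σ p.1).2.tail :=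
    pr_stepF hE ha (by fun_prop) (by fun_prop) (by fun_prop) (by fun_prop)
  unfold step
  exact pr_elim (by fun_prop) hσ h2

@[fun_prop] theorem pr_issue {d : α → ℕ} {σ : α → Stt} (hd : Primrec d) (hσ : Primrec σ) :
    Primrec (fun x => issue (d x) (σ x)) := by
  unfold issue; fun_prop

theorem pr_run (hE : Primrec E) (ha : Primrec fun p : Bool × ℕ × ℕ => a p.1 p.2.1 p.2.2)
    {d T : α → ℕ} (hd : Primrec d) (hT : Primrec T) :
    Primrec (fun x => run E a (d x) (T x)) := by
  have h1 : Primrec fun x => init (d x) := by unfold init; fun_prop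
  unfold run
  exact pr_rec hT h1 (pr_step hE ha (by fun_prop) (by fun_prop))

end prims

/-! ### Real valued meaning of the quantities of the machine -/

/-- mass of the units satisfying `φ` -/
noncomputable def us (φ : ℕ × ℕ × ℕ → Prop) (l : List (ℕ × ℕ × ℕ)) : ℝ :=
  (l.map fun v => if φ v then (1/2:ℝ)^v.2.2 else 0).sum

/-- mass of a list of units -/
noncomputable def gm (G : List (ℕ × ℕ)) : ℝ := (G.map fun u => (1/2:ℝ)^u.2).sum

theorem us_nonneg (φ) (l) : 0 ≤ us φ l := by
  apply List.sum_nonneg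
  intro x hx
  rw [List.mem_map] at hx
  obtain ⟨v, _, rfl⟩ := hx
  split_ifs <;> positivity

theorem gm_nonneg (G) : 0 ≤ gm G := by
  apply List.sum_nonneg
  intro x hx
  rw [List.mem_map] at hx
  obtain ⟨v, _, rfl⟩ := hx
  positivity

@[simp] theorem us_nil (φ) : us φ [] = 0 := rfl
@[simp] theorem gm_nil : gm [] = 0 := rfl

theorem us_cons (φ v l) : us φ (v :: l) = (if φ v then (1/2:ℝ)^v.2.2 else 0) + us φ l := by
  simp [us]

theorem gm_cons (u G) : gm (u :: G) = (1/2:ℝ)^u.2 + gm G := by simp [gm]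

theorem us_append (φ l l') : us φ (l ++ l') = us φ l + us φ l' := by simp [us]

theorem us_mono {φ ψ : ℕ × ℕ × ℕ → Prop} {l : List (ℕ × ℕ × ℕ)} (h : ∀ v ∈ l, φ v → ψ v) :
    us φ l ≤ us ψ l := by
  apply List.sum_le_sum
  intro v hv
  by_cases h1 : φ v
  · rw [if_pos h1, if_pos (h v hv h1)]
  · rw [if_neg h1]; split_ifs <;> positivity

theorem us_split (φ ψ : ℕ × ℕ × ℕ → Prop) (l : List (ℕ × ℕ × ℕ)) :
    us φ l = us (fun v => φ v ∧ ψ v) l + us (fun v => φ v ∧ ¬ ψ v) l := by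
  induction l with
  | nil => simp
  | cons v l ih =>
    rw [us_cons, us_cons, us_cons, ih]
    by_cases h1 : φ v <;> by_cases h2 : ψ v <;> simp [h1, h2] <;> ring

theorem us_congr {φ ψ : ℕ × ℕ × ℕ → Prop} {l : List (ℕ × ℕ × ℕ)} (h : ∀ v ∈ l, φ v ↔ ψ v) :
    us φ l = us ψ l :=
  le_antisymm (us_mono fun v hv => (h v hv).1) (us_mono fun v hv => (h v hv).2)

theorem us_filter (φ : ℕ × ℕ × ℕ → Bool) (l) :
    ((l.filter φ).map fun v => (1/2:ℝ)^v.2.2).sum = us (fun v => φ v = true) l := by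
  unfold us
  induction l with
  | nil => simp
  | cons v l ih => by_cases hv : φ v = true <;> simp_all [List.filter_cons]

/-- mass of a packet -/
theorem us_true_pkt (e : ℕ) (G : List (ℕ × ℕ)) :
    us (fun _ => True) (G.map fun u => (e, u)) = gm G := by
  simp [us, gm, Function.comp_def]

theorem usN_spec {t : ℕ} {l : List (ℕ × ℕ × ℕ)} (h : ∀ v ∈ l, v.2.2 ≤ t) :
    (usN t l : ℝ) = 2^t * (l.map fun v => (1/2:ℝ)^v.2.2).sum := by
  unfold usN
  induction l with
  | nil => simp
  | cons v l ih =>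
    simp only [List.map_cons, List.sum_cons, Nat.cast_add]
    rw [ih (fun w hw => h w (List.mem_cons_of_mem _ hw)), mul_add]
    push_cast
    rw [pow_sub_half (h v List.mem_cons_self)]

theorem usN_filter {t : ℕ} {l : List (ℕ × ℕ × ℕ)} (φ : ℕ × ℕ × ℕ → Bool) (h : ∀ v ∈ l, v.2.2 ≤ t) :
    (usN t (l.filter φ) : ℝ) = 2^t * us (fun v => φ v = true) l := by
  rw [usN_spec (fun v hv => h v (List.mem_of_mem_filter hv)), us_filter]

section
variable (E : ℕ → Option (Str × Str)) (a : Bool → ℕ → ℕ → Bool)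

/-- mass of zero string descriptions among the first `k` entries, of length `< n` -/
noncomputable def zw (k n : ℕ) : ℝ :=
  ∑ j ∈ Finset.range k, if isZ E j = true ∧ (sg E j).length < n then ew E j else 0

/-- mass of zero string descriptions among the first `k` entries -/
noncomputable def zC (k : ℕ) : ℝ :=
  ∑ j ∈ Finset.range k, if isZ E j = true then ew E j else 0

/-- lost mass -/
noncomputable def loss (t : ℕ) (P : List Pkt) : ℝ := us (fun v => lostB E a t v = true) (fl P)

/-- active mass -/
noncomputable def ac (t : ℕ) (X : Bool) (P : List Pkt) : ℝ :=
  us (fun v => actB E a t X v = true) (fl P)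

/-- entry `j` was valid for `X` and is not any more at `t` -/
def died (X : Bool) (t j : ℕ) : Prop :=
  ∃ t' ≤ t, j < t' ∧ valid E (a X t') j = true ∧ valid E (a X t) j = false

/-- mass of dead descriptions with output length in `(s, b]` -/
noncomputable def LM (X : Bool) (s b t : ℕ) : ℝ :=
  ∑ j ∈ Finset.range t,
    if s < (sg E j).length ∧ (sg E j).length ≤ b ∧ died E a X t j then ew E j else 0

/-- both sides -/
noncomputable def LMt (s b t : ℕ) : ℝ := LM E a true s b t + LM E a false s b t
end

/-- standing assumptions -/
structure Ctx (U : Str →. Str) (E : ℕ → Option (Str × Str)) (a : Bool → ℕ → ℕ → Bool) : Prop where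
  hU : OptimalPF U
  hE : IsEnum U E
  ha : Primrec fun p : Bool × ℕ × ℕ => a p.1 p.2.1 p.2.2
  mono : ∀ X, Mono (a X)

namespace Ctx
variable {U : Str →. Str} {E : ℕ → Option (Str × Str)} {a : Bool → ℕ → ℕ → Bool}

theorem zw_nonneg (k n : ℕ) : 0 ≤ zw E k n :=
  Finset.sum_nonneg fun j _ => by split_ifs; exacts [ew_nonneg E j, le_rfl]

theorem zC_nonneg (k : ℕ) : 0 ≤ zC E k :=
  Finset.sum_nonneg fun j _ => by split_ifs; exacts [ew_nonneg E j, le_rfl]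

theorem zC_le_one (h : Ctx U E a) (k : ℕ) : zC E k ≤ 1 := by
  refine le_trans (Finset.sum_le_sum fun j _ => ?_) (kraft_enum h.hU.1 h.hE (Finset.range k))
  split_ifs; exacts [le_rfl, ew_nonneg E j]

theorem zw_le_zC (k n : ℕ) : zw E k n ≤ zC E k := by
  apply Finset.sum_le_sum
  intro j _
  by_cases h1 : isZ E j = true ∧ (sg E j).length < n
  · rw [if_pos h1, if_pos h1.1]
  · rw [if_neg h1]; split_ifs; exacts [ew_nonneg E j, le_rfl]

theorem zw_mono {k k' n : ℕ} (h : k ≤ k') : zw E k n ≤ zw E k' n := by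
  apply Finset.sum_le_sum_of_subset_of_nonneg (Finset.range_mono h)
  intro j _ _; split_ifs; exacts [ew_nonneg E j, le_rfl]

theorem sg_length_le (h : Ctx U E a) (j : ℕ) : (sg E j).length ≤ j := by
  unfold sg
  cases hj : E j with
  | none => simp
  | some p => exact h.hE.len2 j p hj

theorem rl_le (h : Ctx U E a) (j : ℕ) : rl E j ≤ j := by
  unfold rl
  cases hj : E j with
  | none => simp
  | some p => exact h.hE.len1 j p hj

theorem zw_eq_zC (h : Ctx U E a) {k n : ℕ} (hk : k ≤ n) : zw E k n = zC E k := by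
  apply Finset.sum_congr rfl
  intro j hj
  have h1 := h.sg_length_le j
  have h2 := Finset.mem_range.1 hj
  have : (sg E j).length < n := by omega
  simp [this]

theorem ew_isZ {j : ℕ} (h : isZ E j = true) : ew E j = (1/2:ℝ)^(rl E j) := by
  unfold isZ at h
  unfold ew rl
  cases hj : E j with
  | none => rw [hj] at h; simp at h
  | some p => rfl

theorem zN_spec (h : Ctx U E a) {t y k : ℕ} (ht : y + k ≤ t) :
    (zN E t y k : ℝ) = 2^t * ((1/2)^y * zC E k) := by
  unfold zN zC
  rw [list_filter_sum, list_range_sum, Finset.mul_sum, Finset.mul_sum]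
  push_cast
  apply Finset.sum_congr rfl
  intro j hj
  have h1 := h.rl_le j
  have h2 := Finset.mem_range.1 hj
  by_cases hz : isZ E j = true
  · rw [if_pos hz, if_pos hz, ew_isZ hz, pow_sub_half (by omega), pow_add]
  · rw [if_neg hz, if_neg hz]; simp

theorem fullB_iff {t : ℕ} {f : Frm} (h1 : ∀ v ∈ fl f.2.1, v.2.2 ≤ t) (h2 : f.1.2.1 ≤ t) :
    fullB E a t f = true ↔ (1/2:ℝ)^f.1.2.1 ≤ loss E a t f.2.1 := by
  unfold fullB lossN
  rw [decide_eq_true_eq, ← Nat.cast_le (α := ℝ), usN_filter _ h1]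
  push_cast
  rw [pow_sub_half h2, mul_le_mul_iff_right₀ (by positivity)]
  rfl

theorem cmpX_iff (h : Ctx U E a) {d t : ℕ} {X : Bool} {f : Frm} (h1 : ∀ v ∈ fl f.2.1, v.2.2 ≤ t)
    (h2 : f.1.2.1 + c0 d + f.1.2.2.2 ≤ t) :
    cmpX E a d t X f = true ↔ (1/2:ℝ)^(f.1.2.1 + c0 d) * zC E f.1.2.2.2 <
      ac E a t X f.2.1 + (1/2)^(f.1.2.1 + c0 d + f.1.2.2.2) := by
  unfold cmpX acN
  rw [decide_eq_true_eq, ← Nat.cast_lt (α := ℝ)]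
  push_cast
  rw [usN_filter _ h1, h.zN_spec h2, pow_sub_half h2, ← mul_add,
    mul_lt_mul_iff_right₀ (by positivity)]
  rfl

theorem tailN_spec {t n : ℕ} {G : List (ℕ × ℕ)} (h : ∀ u ∈ G, u.2 ≤ t) :
    (tailN t G n : ℝ) = 2^t * tail G n := by
  unfold tailN tail
  induction G with
  | nil => simp
  | cons v l ih =>
    have := ih (fun w hw => h w (List.mem_cons_of_mem _ hw))
    by_cases hn : n ≤ v.1
    · simp only [List.filter_cons, hn, decide_true, if_true, List.map_cons, List.sum_cons,
        Nat.cast_add]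
      rw [this, mul_add]
      push_cast
      rw [pow_sub_half (h v List.mem_cons_self)]
    · simpa [List.filter_cons, hn] using this

theorem rspN_iff (h : Ctx U E a) {d t : ℕ} {G : List (ℕ × ℕ)} (hG : ∀ u ∈ G, u.2 ≤ t) :
    rspN E a d t G = true ↔ ∀ u ∈ G, (1/2:ℝ)^(2*d) * tail G u.1 ≤
      mass E (a true t) u.1 t + mass E (a false t) u.1 t := by
  unfold rspN rspN1
  rw [List.all_eq_true]
  refine forall₂_congr fun u _ => ?_
  rw [decide_eq_true_eq, ← Nat.cast_le (α := ℝ)]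
  push_cast
  rw [tailN_spec hG, massN_spec h.hE, massN_spec h.hE, ← mul_add, mul_left_comm,
    mul_le_mul_iff_right₀ (by positivity)]
  have e := two_mul_half (2*d)
  have p1 : (0:ℝ) < 2^(2*d) := by positivity
  constructor
  · intro hh
    calc _ ≤ (1/2:ℝ)^(2*d) * (2^(2*d) * _) := mul_le_mul_of_nonneg_left hh (by positivity)
      _ = _ := by rw [← mul_assoc, mul_comm ((1/2:ℝ)^(2*d)), e, one_mul]
  · intro hh
    calc tail G u.1 = 2^(2*d) * ((1/2:ℝ)^(2*d) * tail G u.1) := by rw [← mul_assoc, e, one_mul]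
      _ ≤ _ := mul_le_mul_of_nonneg_left hh p1.le

/-! #### greedy selection -/

theorem greedy_cons (t cap u l) : l.foldr (fun u r => grStep t cap u r) ([], 0) =
    (greedy t cap l, (l.foldr (fun u r => grStep t cap u r) ([], 0)).2) ∧
    (u :: l).foldr (fun u r => grStep t cap u r) ([], 0) =
      grStep t cap u (l.foldr (fun u r => grStep t cap u r) ([], 0)) := ⟨rfl, rfl⟩

theorem greedy_spec {t q η : ℕ} {l : List (ℕ × ℕ)} (hq : q ≤ t) (h : ∀ u ∈ l, u.2 ≤ t)
    (h2 : ∀ u ∈ l, η ≤ u.2) :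
    (greedy t (2^(t-q)) l).Sublist l ∧ gm (greedy t (2^(t-q)) l) ≤ (1/2)^q ∧
    (gm (greedy t (2^(t-q)) l) = gm l ∨ (1/2:ℝ)^q - (1/2)^η ≤ gm (greedy t (2^(t-q)) l)) := by
  suffices H : (greedy t (2^(t-q)) l).Sublist l ∧
      ((l.foldr (fun u r => grStep t (2^(t-q)) u r) ([], 0)).2 : ℝ) =
        2^t * gm (greedy t (2^(t-q)) l) ∧
      gm (greedy t (2^(t-q)) l) ≤ (1/2)^q ∧
      (gm (greedy t (2^(t-q)) l) = gm l ∨ (1/2:ℝ)^q - (1/2)^η ≤ gm (greedy t (2^(t-q)) l)) from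
    ⟨H.1, H.2.2.1, H.2.2.2⟩
  induction l with
  | nil => simp [greedy]
  | cons u l ih =>
    obtain ⟨i1, i2, i3, i4⟩ := ih (fun w hw => h w (List.mem_cons_of_mem _ hw))
      (fun w hw => h2 w (List.mem_cons_of_mem _ hw))
    have hu := h u List.mem_cons_self
    have hu2 := h2 u List.mem_cons_self
    have p : (0:ℝ) < 2^t := by positivity
    obtain ⟨r, hr⟩ : ∃ r, l.foldr (fun u r => grStep t (2^(t-q)) u r) ([], 0) = r := ⟨_, rfl⟩
    have e : (u :: l).foldr (fun u r => grStep t (2^(t-q)) u r) ([], 0) =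
      grStep t (2^(t-q)) u r := by rw [List.foldr_cons, hr]
    have e1 : greedy t (2^(t-q)) l = r.1 := by unfold greedy; rw [hr]
    have e2 : greedy t (2^(t-q)) (u :: l) = (grStep t (2^(t-q)) u r).1 := by unfold greedy; rw [e]
    rw [e2, e]
    rw [hr] at i2
    rw [e1] at i1 i2 i3 i4
    have key : r.2 + 2^(t-u.2) ≤ 2^(t-q) ↔ (1/2:ℝ)^u.2 + gm r.1 ≤ (1/2)^q := by
      rw [← Nat.cast_le (α := ℝ)]
      push_cast
      rw [i2, pow_sub_half hu, pow_sub_half hq, ← mul_add, mul_le_mul_iff_right₀ p, add_comm]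
    unfold grStep
    by_cases hc : r.2 + 2^(t-u.2) ≤ 2^(t-q)
    · simp only [hc, decide_true, cond_true, gm_cons]
      refine ⟨i1.cons_cons u, ?_, key.1 hc, ?_⟩
      · push_cast; rw [i2, pow_sub_half hu]; ring
      · rcases i4 with i4 | i4
        · left; rw [i4]
        · right; have : (0:ℝ) ≤ (1/2)^u.2 := by positivity
          linarith
    · simp only [hc, decide_false, cond_false, gm_cons]
      refine ⟨i1.cons u, i2, i3, Or.inr ?_⟩
      have h3 := fun hh => hc (key.2 hh)
      have h4 : (1/2:ℝ)^u.2 ≤ (1/2)^η := pow_le_pow_of_le_one (by norm_num) (by norm_num) hu2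
      linarith [not_le.1 h3]

/-! #### dead descriptions -/

theorem LM_eq {X : Bool} {s b t M : ℕ} (h : t ≤ M) : LM E a X s b t = ∑ j ∈ Finset.range M,
    if s < (sg E j).length ∧ (sg E j).length ≤ b ∧ died E a X t j then ew E j else 0 := by
  unfold LM
  apply Finset.sum_subset (Finset.range_mono h)
  intro j _ hj
  rw [if_neg]
  rintro ⟨_, _, t', h1, h2, _⟩
  exact hj (Finset.mem_range.2 (by omega))

theorem LM_nonneg (X : Bool) (s b t : ℕ) : 0 ≤ LM E a X s b t :=
  Finset.sum_nonneg fun j _ => by split_ifs; exacts [ew_nonneg E j, le_rfl]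

theorem LM_le_one (h : Ctx U E a) (X : Bool) (s b t : ℕ) : LM E a X s b t ≤ 1 := by
  refine le_trans (Finset.sum_le_sum fun j _ => ?_) (kraft_enum h.hU.1 h.hE (Finset.range t))
  split_ifs; exacts [le_rfl, ew_nonneg E j]

theorem died_mono (h : Ctx U E a) {X : Bool} {t t' j : ℕ} (ht : t ≤ t') (hd : died E a X t j) :
    died E a X t' j := by
  obtain ⟨r, h1, h2, h3, h4⟩ := hd
  refine ⟨r, h1.trans ht, h2, h3, ?_⟩
  by_contra h5
  rw [Bool.not_eq_false] at h5
  rw [valid_convex (h.mono X) h1 ht h3 h5] at h4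
  exact Bool.noConfusion h4

theorem LM_mono (h : Ctx U E a) {X : Bool} {s b b' t t' : ℕ} (hb : b ≤ b') (ht : t ≤ t') :
    LM E a X s b t ≤ LM E a X s b' t' := by
  rw [LM_eq ht, LM]
  apply Finset.sum_le_sum
  intro j _
  by_cases h1 : s < (sg E j).length ∧ (sg E j).length ≤ b ∧ died E a X t j
  · rw [if_pos h1, if_pos ⟨h1.1, h1.2.1.trans hb, h.died_mono ht h1.2.2⟩]
  · rw [if_neg h1]; split_ifs; exacts [ew_nonneg E j, le_rfl]

theorem LM_mono_left {X : Bool} {s s' b t : ℕ} (hs : s' ≤ s) :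
    LM E a X s b t ≤ LM E a X s' b t := by
  apply Finset.sum_le_sum
  intro j _
  by_cases h1 : s < (sg E j).length ∧ (sg E j).length ≤ b ∧ died E a X t j
  · rw [if_pos h1, if_pos ⟨by omega, h1.2⟩]
  · rw [if_neg h1]; split_ifs; exacts [ew_nonneg E j, le_rfl]

theorem LM_add {X : Bool} {s b b' c t : ℕ} (h1 : s ≤ b) (h2 : b ≤ b') (h3 : b' ≤ c) :
    LM E a X s b t + LM E a X b' c t ≤ LM E a X s c t := by
  unfold LM
  rw [← Finset.sum_add_distrib]
  apply Finset.sum_le_sum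
  intro j _
  have := ew_nonneg E j
  by_cases hd : died E a X t j
  · by_cases h4 : s < (sg E j).length ∧ (sg E j).length ≤ b
    · rw [if_pos ⟨h4.1, h4.2, hd⟩, if_neg (by omega), if_pos ⟨h4.1, by omega, hd⟩, add_zero]
    · rw [if_neg (by tauto), zero_add]
      by_cases h5 : b' < (sg E j).length ∧ (sg E j).length ≤ c
      · rw [if_pos ⟨h5.1, h5.2, hd⟩, if_pos ⟨by omega, h5.2, hd⟩]
      · rw [if_neg (by tauto)]; split_ifs; exacts [this, le_rfl]
  · simp [hd]

theorem LM_packet (h : Ctx U E a) {X : Bool} {s e n t : ℕ} (hn : s ≤ n) (ht : e ≤ t)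
    (hc : seg (a X t) n ≠ seg (a X e) n) :
    LM E a X s e e + mass E (a X e) n e ≤ LM E a X s e t := by
  have hlt : ∀ j, e ≤ j → valid E (a X e) j = true → True := fun _ _ _ => trivial
  rw [LM_eq ht, mass]
  have : ∑ j ∈ Finset.range e, (if valid E (a X e) j = true ∧ n < (sg E j).length then ew E j else 0)
    = ∑ j ∈ Finset.range t, if j < e ∧ valid E (a X e) j = true ∧ n < (sg E j).length then ew E j else 0 := by
    rw [← Finset.sum_subset (Finset.range_mono ht)]
    · apply Finset.sum_congr rfl
      intro j hj; simp [Finset.mem_range.1 hj]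
    · intro j _ hj
      rw [Finset.mem_range] at hj
      simp [hj]
  rw [this, ← Finset.sum_add_distrib, LM]
  apply Finset.sum_le_sum
  intro j _
  have hw := ew_nonneg E j
  by_cases h1 : s < (sg E j).length ∧ (sg E j).length ≤ e ∧ died E a X e j
  · have h5 : ¬ (j < e ∧ valid E (a X e) j = true ∧ n < (sg E j).length) := by
      rintro ⟨_, h2, _⟩
      obtain ⟨_, _, _, _, _, _, h3⟩ := h1
      rw [h2] at h3; exact Bool.noConfusion h3
    rw [if_pos h1, if_neg h5, add_zero, if_pos ⟨h1.1, h1.2.1, h.died_mono ht h1.2.2⟩]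
  · rw [if_neg h1, zero_add]
    by_cases h2 : j < e ∧ valid E (a X e) j = true ∧ n < (sg E j).length
    · have hl := h.sg_length_le j
      have h6 : valid E (a X t) j = false := by
        by_contra h3
        rw [Bool.not_eq_false] at h3
        exact hc (seg_eq_iff.2 fun x hx => (valid_agree h3 h2.2.1 x (by omega)))
      rw [if_pos h2, if_pos ⟨by omega, by omega, e, ht, h2.1, h2.2.1, h6⟩]
    · rw [if_neg h2]; split_ifs; exacts [hw, le_rfl]

theorem LMt_le_two (h : Ctx U E a) (s b t : ℕ) : LMt E a s b t ≤ 2 := by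
  have := h.LM_le_one true s b t
  have := h.LM_le_one false s b t
  unfold LMt; linarith

theorem LMt_mono (h : Ctx U E a) {s b b' t t' : ℕ} (hb : b ≤ b') (ht : t ≤ t') :
    LMt E a s b t ≤ LMt E a s b' t' :=
  add_le_add (h.LM_mono hb ht) (h.LM_mono hb ht)

theorem LMt_add {s b b' c t : ℕ} (h1 : s ≤ b) (h2 : b ≤ b') (h3 : b' ≤ c) :
    LMt E a s b t + LMt E a b' c t ≤ LMt E a s c t := by
  have := LM_add (E := E) (a := a) (X := true) (t := t) h1 h2 h3
  have := LM_add (E := E) (a := a) (X := false) (t := t) h1 h2 h3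
  unfold LMt; linarith

end Ctx

/-! ### Packets, chains and losses -/

/-- packets are consecutive, latest first, inside `[lo, hi]` -/
def chain (lo : ℕ) : List Pkt → ℕ → Prop
  | [], hi => lo ≤ hi
  | p :: P, hi => p.2.1 ≤ hi ∧ p.1 ≤ p.2.1 ∧ chain lo P p.1

/-- promised mass of the packets -/
noncomputable def prm (P : List Pkt) : ℝ := (P.map fun p => (1/2:ℝ)^p.2.2.1).sum

/-- a good packet of a frame of level `lev` and goal `q` -/
structure PkOK (E : ℕ → Option (Str × Str)) (a : Bool → ℕ → ℕ → Bool) (d : ℕ)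
    (Q : ℕ × ℕ → Prop) (lev q : ℕ) (p : Pkt) : Prop where
  rng : ∀ u ∈ p.2.2.2, p.1 ≤ u.1 ∧ u.1 < p.2.1 ∧ q + c0 d ≤ u.2 ∧ u.2 ≤ p.2.1
  iss : ∀ u ∈ p.2.2.2, Q u
  nd : (p.2.2.2.map Prod.fst).Nodup
  rsp : ∀ u ∈ p.2.2.2, (1/2:ℝ)^(2*d) * tail p.2.2.2 u.1 ≤
      mass E (a true p.2.1) u.1 p.2.1 + mass E (a false p.2.1) u.1 p.2.1
  lo : (1 - (1/2:ℝ)^(c0 d)) * (1/2)^p.2.2.1 ≤ gm p.2.2.2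
  hi : gm p.2.2.2 ≤ (1/2)^p.2.2.1
  low : ((lev:ℝ) - 1) * ((1/2:ℝ)^(2*d) / 2) * gm p.2.2.2 ≤ LMt E a p.1 p.2.1 p.2.1

section
variable {U : Str →. Str} {E : ℕ → Option (Str × Str)} {a : Bool → ℕ → ℕ → Bool}

theorem chain_le {lo hi : ℕ} {P : List Pkt} (h : chain lo P hi) : lo ≤ hi := by
  induction P generalizing hi with
  | nil => exact h
  | cons p P ih => exact (ih h.2.2).trans (h.2.1.trans h.1)

theorem chain_mono {lo hi hi' : ℕ} {P : List Pkt} (h : chain lo P hi) (hh : hi ≤ hi') :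
    chain lo P hi' := by
  cases P with
  | nil => exact le_trans h hh
  | cons p P => exact ⟨h.1.trans hh, h.2⟩

theorem chain_mem {lo hi : ℕ} {P : List Pkt} (h : chain lo P hi) {p : Pkt} (hp : p ∈ P) :
    lo ≤ p.1 ∧ p.1 ≤ p.2.1 ∧ p.2.1 ≤ hi := by
  induction P generalizing hi with
  | nil => simp at hp
  | cons p' P ih =>
    rcases List.mem_cons.1 hp with rfl | hp
    · exact ⟨chain_le h.2.2, h.2.1, h.1⟩
    · have := ih h.2.2 hp
      have h1 := h.1; have h2 := h.2.1
      exact ⟨this.1, this.2.1, by omega⟩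

theorem fl_nil : fl [] = [] := rfl

theorem fl_cons (p : Pkt) (P) : fl (p :: P) = (p.2.2.2.map fun u => (p.2.1, u)) ++ fl P := rfl

theorem mem_fl {P : List Pkt} {v : ℕ × ℕ × ℕ} :
    v ∈ fl P ↔ ∃ p ∈ P, ∃ u ∈ p.2.2.2, (p.2.1, u) = v := by
  unfold fl; simp [List.mem_flatMap]

theorem prm_nonneg (P) : 0 ≤ prm P := by
  apply List.sum_nonneg
  intro x hx
  rw [List.mem_map] at hx
  obtain ⟨v, _, rfl⟩ := hx
  positivity

theorem prm_cons (p : Pkt) (P) : prm (p :: P) = (1/2:ℝ)^p.2.2.1 + prm P := by simp [prm]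

theorem us_le_gm (φ) (e : ℕ) (G : List (ℕ × ℕ)) : us φ (G.map fun u => (e, u)) ≤ gm G := by
  rw [← us_true_pkt e G]; exact us_mono fun _ _ _ => trivial

theorem us_le_tail {φ : ℕ × ℕ × ℕ → Prop} {e n : ℕ} {G : List (ℕ × ℕ)}
    (h : ∀ u ∈ G, φ (e, u) → n ≤ u.1) : us φ (G.map fun u => (e, u)) ≤ tail G n := by
  unfold tail
  induction G with
  | nil => simp
  | cons u G ih =>
    have := ih fun w hw => h w (List.mem_cons_of_mem _ hw)
    have p : (0:ℝ) ≤ (1/2)^u.2 := by positivity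
    rw [List.map_cons, us_cons, List.filter_cons]
    by_cases h1 : φ (e, u)
    · have h2 := h u List.mem_cons_self h1
      simp only [h1, h2, if_true, decide_true, List.map_cons, List.sum_cons]
      linarith
    · rw [if_neg h1, zero_add]
      split_ifs
      · simp only [List.map_cons, List.sum_cons]; linarith
      · exact this

namespace Ctx

theorem chg_mono (h : Ctx U E a) {t t' : ℕ} {X : Bool} {v : ℕ × ℕ × ℕ} (h1 : v.1 ≤ t) (h2 : t ≤ t')
    (hl : chgB a t X v = true) : chgB a t' X v = true := by
  unfold chgB at *
  simp only [Bool.not_eq_true', decide_eq_false_iff_not] at *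
  intro h3
  apply hl
  rw [seg_eq_iff] at *
  intro x hx
  exact (mono_agree (h.mono X) h1 h2 (h3 x hx).symm).symm

theorem lost_mono (h : Ctx U E a) {t t' : ℕ} {v : ℕ × ℕ × ℕ} (h1 : v.1 ≤ t) (h2 : t ≤ t')
    (hl : lostB E a t v = true) : lostB E a t' v = true := h.chg_mono h1 h2 hl

theorem act_anti (h : Ctx U E a) {t t' : ℕ} {X : Bool} {v : ℕ × ℕ × ℕ} (h1 : v.1 ≤ t) (h2 : t ≤ t')
    (hl : actB E a t' X v = true) : actB E a t X v = true := by
  unfold actB at *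
  simp only [Bool.and_eq_true, Bool.not_eq_true', decide_eq_true_eq] at *
  refine ⟨hl.1, ?_⟩
  by_contra h3
  rw [Bool.not_eq_false] at h3
  rw [h.lost_mono h1 h2 h3] at hl
  exact Bool.noConfusion hl.2

theorem us_total (t : ℕ) (l : List (ℕ × ℕ × ℕ)) : us (fun _ => True) l =
    us (fun v => lostB E a t v = true) l + (us (fun v => actB E a t true v = true) l +
      us (fun v => actB E a t false v = true) l) := by
  rw [us_split (fun _ => True) (fun v => lostB E a t v = true)]
  congr 1
  · exact us_congr fun v _ => by simp
  · rw [us_split _ (fun v => labB E a v = true)]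
    congr 1
    · exact us_congr fun v _ => by simp [actB, and_comm]
    · exact us_congr fun v _ => by simp [actB, and_comm]

theorem packet_X (h : Ctx U E a) {d lev q t : ℕ} {Q} {p : Pkt} (hp : PkOK E a d Q lev q p)
    (ht : p.2.1 ≤ t) (X : Bool) :
    (1/2:ℝ)^(2*d)/2 * us (fun v => lostB E a t v = true ∧ labB E a v = X)
      (p.2.2.2.map fun u => (p.2.1, u)) + LM E a X p.1 p.2.1 p.2.1 ≤ LM E a X p.1 p.2.1 t := by
  obtain ⟨s, e, r, G⟩ := p
  simp only at *
  have hpos : (0:ℝ) < (1/2)^(2*d) := by positivity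
  by_cases hex : ∃ n, ∃ u ∈ G, (lostB E a t (e, u) = true ∧ labB E a (e, u) = X) ∧ u.1 = n
  · obtain ⟨u, hu, ⟨hl, hX⟩, hn⟩ := Nat.find_spec hex
    have h1 : us (fun v => lostB E a t v = true ∧ labB E a v = X) (G.map fun u => (e, u)) ≤
        tail G u.1 := by
      apply us_le_tail
      intro w hw hφ
      rw [hn]
      exact Nat.find_min' hex ⟨w, hw, hφ, rfl⟩
    have h2 := hp.rsp u hu
    simp only at h2
    have h3 : mass E (a true e) u.1 e + mass E (a false e) u.1 e ≤ 2 * mass E (a X e) u.1 e := by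
      have h4 : ∀ Y, (massN E (a Y e) u.1 e : ℝ) = _ := fun Y => massN_spec h.hE (a Y e) u.1 e
      unfold labB at hX
      have hp2 : (0:ℝ) < 2^e := by positivity
      cases X with
      | true =>
        rw [decide_eq_true_eq, ← Nat.cast_le (α := ℝ), h4, h4, mul_le_mul_iff_right₀ hp2] at hX
        linarith
      | false =>
        rw [decide_eq_false_iff_not, not_le, ← Nat.cast_lt (α := ℝ), h4, h4,
          mul_lt_mul_iff_right₀ hp2] at hX
        linarith
    have h5 := h.LM_packet (X := X) (s := s) (n := u.1) (hp.rng u hu).1 ht (by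
      unfold lostB chgB at hl
      rw [hX] at hl
      simpa using hl)
    have h6 := mul_le_mul_of_nonneg_left h1 hpos.le
    linarith
  · have h1 : us (fun v => lostB E a t v = true ∧ labB E a v = X) (G.map fun u => (e, u)) = 0 := by
      apply le_antisymm _ (us_nonneg _ _)
      have : us (fun _ => False) (G.map fun u => (e, u)) = 0 := by simp [us, Function.comp_def]
      rw [← this]
      apply us_mono
      intro v hv hφ
      rw [List.mem_map] at hv
      obtain ⟨u, hu, rfl⟩ := hv
      exact hex ⟨_, u, hu, hφ, rfl⟩
    rw [h1, mul_zero, zero_add]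
    exact h.LM_mono le_rfl ht

theorem packet_loss (h : Ctx U E a) {d lev q t : ℕ} {Q} {p : Pkt} (hp : PkOK E a d Q lev q p)
    (hlev : 1 ≤ lev) (ht : p.2.1 ≤ t) :
    (lev:ℝ) * ((1/2:ℝ)^(2*d)/2) * us (fun v => lostB E a t v = true)
      (p.2.2.2.map fun u => (p.2.1, u)) ≤ LMt E a p.1 p.2.1 t := by
  have h1 := h.packet_X hp ht true
  have h2 := h.packet_X hp ht false
  have h3 := us_split (fun v => lostB E a t v = true) (fun v => labB E a v = true)
    (p.2.2.2.map fun u => (p.2.1, u))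
  simp only [Bool.not_eq_true] at h3
  have h4 := hp.low
  have hpos : (0:ℝ) < (1/2)^(2*d) := by positivity
  have h5 : (0:ℝ) ≤ (lev:ℝ) - 1 := by
    have : (1:ℝ) ≤ lev := by exact_mod_cast hlev
    linarith
  have h6 := mul_le_mul_of_nonneg_left (us_le_gm (fun v => lostB E a t v = true) p.2.1 p.2.2.2)
    (mul_nonneg h5 (by positivity : (0:ℝ) ≤ (1/2)^(2*d)/2))
  have h7 : (lev:ℝ) * ((1/2:ℝ)^(2*d)/2) * us (fun v => lostB E a t v = true)
      (p.2.2.2.map fun u => (p.2.1, u)) = ((lev:ℝ) - 1) * ((1/2:ℝ)^(2*d)/2) *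
      us (fun v => lostB E a t v = true) (p.2.2.2.map fun u => (p.2.1, u)) +
      (1/2:ℝ)^(2*d)/2 * us (fun v => lostB E a t v = true) (p.2.2.2.map fun u => (p.2.1, u)) := by
    ring
  rw [h7]
  unfold LMt at *
  rw [h3, mul_add] at *
  linarith

theorem loss_cons (t : ℕ) (p : Pkt) (P) : loss E a t (p :: P) =
    us (fun v => lostB E a t v = true) (p.2.2.2.map fun u => (p.2.1, u)) + loss E a t P := by
  unfold loss; rw [fl_cons, us_append]

theorem ac_cons (t : ℕ) (X) (p : Pkt) (P) : ac E a t X (p :: P) =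
    us (fun v => actB E a t X v = true) (p.2.2.2.map fun u => (p.2.1, u)) + ac E a t X P := by
  unfold ac; rw [fl_cons, us_append]

theorem chain_loss (h : Ctx U E a) {d lev q t lo hi : ℕ} {Q} {P : List Pkt}
    (hP : ∀ p ∈ P, PkOK E a d Q lev q p) (hlev : 1 ≤ lev) (hc : chain lo P hi) (ht : hi ≤ t) :
    (lev:ℝ) * ((1/2:ℝ)^(2*d)/2) * loss E a t P ≤ LMt E a lo hi t := by
  induction P generalizing hi with
  | nil =>
    simp only [loss, fl_nil, us_nil, mul_zero]
    exact add_nonneg (LM_nonneg _ _ _ _) (LM_nonneg _ _ _ _)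
  | cons p P ih =>
    obtain ⟨c1, c2, c3⟩ := hc
    have h1 := ih (fun p hp => hP p (List.mem_cons_of_mem _ hp)) c3 (by omega)
    have h2 := h.packet_loss (hP p List.mem_cons_self) hlev (c1.trans ht)
    rw [loss_cons, mul_add]
    have h3 := LMt_add (E := E) (a := a) (t := t) (chain_le c3) le_rfl c2
    have h4 := h.LMt_mono (s := lo) c1 (le_refl t)
    linarith

theorem gm_sum (t : ℕ) {P : List Pkt} {d lev q : ℕ} {Q} (hP : ∀ p ∈ P, PkOK E a d Q lev q p) :
    (1 - (1/2:ℝ)^(c0 d)) * prm P ≤ loss E a t P + (ac E a t true P + ac E a t false P) := by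
  induction P with
  | nil => simp [prm, loss, ac, fl_nil]
  | cons p P ih =>
    have h1 := ih (fun p hp => hP p (List.mem_cons_of_mem _ hp))
    rw [loss_cons, ac_cons, ac_cons, prm_cons, mul_add]
    have h2 := (hP p List.mem_cons_self).lo
    rw [← us_true_pkt p.2.1, us_total (E := E) (a := a) t] at h2
    linarith

theorem loss_mono (h : Ctx U E a) {t t' : ℕ} {P : List Pkt} (hP : ∀ v ∈ fl P, v.1 ≤ t)
    (ht : t ≤ t') : loss E a t P ≤ loss E a t' P :=
  us_mono fun v hv => h.lost_mono (hP v hv) ht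

theorem ac_anti (h : Ctx U E a) {t t' : ℕ} {X} {P : List Pkt} (hP : ∀ v ∈ fl P, v.1 ≤ t)
    (ht : t ≤ t') : ac E a t' X P ≤ ac E a t X P :=
  us_mono fun v hv => h.act_anti (hP v hv) ht

theorem fl_nodup {d lev q lo hi : ℕ} {Q} {P : List Pkt}
    (hP : ∀ p ∈ P, PkOK E a d Q lev q p) (hc : chain lo P hi) :
    ((fl P).map fun v => v.2.1).Nodup := by
  induction P generalizing hi with
  | nil => simp [fl_nil]
  | cons p P ih =>
    obtain ⟨c1, c2, c3⟩ := hc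
    rw [fl_cons, List.map_append, List.nodup_append]
    refine ⟨?_, ih (fun p hp => hP p (List.mem_cons_of_mem _ hp)) c3, ?_⟩
    · rw [List.map_map]; exact (hP p List.mem_cons_self).nd
    · intro x hx y hy
      rw [List.mem_map] at hx hy
      obtain ⟨v, hv, rfl⟩ := hx
      obtain ⟨w, hw, rfl⟩ := hy
      rw [List.mem_map] at hv
      obtain ⟨u, hu, rfl⟩ := hv
      obtain ⟨p', hp', u', hu', rfl⟩ := mem_fl.1 hw
      have h1 := ((hP p List.mem_cons_self).rng u hu).1
      have h2 := ((hP p' (List.mem_cons_of_mem _ hp')).rng u' hu').2.1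
      have h3 := (chain_mem c3 hp').2.2
      simp only
      omega

end Ctx
end

/-! ### Invariants of frames -/

section
variable (E : ℕ → Option (Str × Str)) (a : Bool → ℕ → ℕ → Bool) (d : ℕ) (Q : ℕ × ℕ → Prop)

/-- invariant of a frame whose packets end before `hi` -/
structure Base (t lev q s k : ℕ) (P : List Pkt) (hi : ℕ) : Prop where
  ch : chain s P hi
  hit : hi ≤ t
  ok : ∀ p ∈ P, PkOK E a d Q lev q p
  rk : ∀ p ∈ P, p.2.2.1 ≤ q + c0 d + k
  tm : q + c0 d + k ≤ t
  J : ∀ X n, us (fun v => actB E a t X v = true ∧ v.2.1 < n) (fl P) ≤ (1/2)^(q + c0 d) * zw E k n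
  R : prm P ≤ (1/2)^q * (1 + 5 * (1/2)^(c0 d))
  levN : lev ≤ 2^(2*d+4)
  z : lev = 0 → P = []

/-- the frame has requested a packet -/
structure Wait (t q k : ℕ) (P : List Pkt) : Prop where
  w : ∀ X, ac E a t X P + (1/2:ℝ)^(q + c0 d + k) ≤ (1/2)^(q + c0 d) * zC E k
  r : prm P + (1/2:ℝ)^(q + c0 d + k) ≤ (1/2)^q * (1 + 5 * (1/2)^(c0 d))

/-- units that can be handed over -/
structure GOK (t lev y s' : ℕ) (G : List (ℕ × ℕ)) : Prop where
  rng : ∀ u ∈ G, s' ≤ u.1 ∧ u.1 < t ∧ y ≤ u.2 ∧ u.2 ≤ t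
  iss : ∀ u ∈ G, Q u
  nd : (G.map Prod.fst).Nodup
  lo : (1 - (1/2:ℝ)^(c0 d)) * (1/2)^y ≤ gm G
  hi : gm G ≤ (1/2)^y
  low : ((lev:ℝ) - 1) * ((1/2:ℝ)^(2*d) / 2) * gm G ≤ LMt E a s' t t

/-- the frame has units pending -/
structure PendOK (t lev q s k : ℕ) (P : List Pkt) (s' : ℕ) (G : List (ℕ × ℕ)) : Prop where
  base : Base E a d Q t lev q s k P s'
  wait : Wait E a d t q k P
  lev1 : 1 ≤ lev
  ks : k ≤ s'
  g : GOK E a d Q t lev (q + c0 d + k) s' G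

end

namespace Ctx
variable {U : Str →. Str} {E : ℕ → Option (Str × Str)} {a : Bool → ℕ → ℕ → Bool} {d : ℕ}
  {Q : ℕ × ℕ → Prop} {t t' lev q s k hi : ℕ} {P : List Pkt} {s' : ℕ} {G : List (ℕ × ℕ)}

theorem base_units (hb : Base E a d Q t lev q s k P hi) {v : ℕ × ℕ × ℕ} (hv : v ∈ fl P) :
    v.1 ≤ hi ∧ s ≤ v.2.1 ∧ v.2.1 < hi ∧ q + c0 d ≤ v.2.2 ∧ v.2.2 ≤ hi ∧ Q v.2 := by
  obtain ⟨p, hp, u, hu, rfl⟩ := mem_fl.1 hv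
  have h1 := (hb.ok p hp).rng u hu
  have h2 := chain_mem hb.ch hp
  have h3 := (hb.ok p hp).iss u hu
  simp only
  exact ⟨h2.2.2, by omega, by omega, by omega, by omega, h3⟩

theorem base_time (h : Ctx U E a) (hb : Base E a d Q t lev q s k P hi) (ht : t ≤ t') :
    Base E a d Q t' lev q s k P hi where
  ch := hb.ch
  hit := hb.hit.trans ht
  ok := hb.ok
  rk := hb.rk
  tm := hb.tm.trans ht
  J := fun X n => le_trans (us_mono fun v hv h1 =>
    ⟨h.act_anti ((base_units hb hv).1.trans hb.hit) ht h1.1, h1.2⟩) (hb.J X n)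
  R := hb.R
  levN := hb.levN
  z := hb.z

theorem base_hi (hb : Base E a d Q t lev q s k P hi) {hi' : ℕ} (h1 : hi ≤ hi') (h2 : hi' ≤ t) :
    Base E a d Q t lev q s k P hi' :=
  ⟨chain_mono hb.ch h1, h2, hb.ok, hb.rk, hb.tm, hb.J, hb.R, hb.levN, hb.z⟩

theorem base_k (h : Ctx U E a) (hb : Base E a d Q t lev q s k P t) :
    Base E a d Q (t+1) lev q s (k+1) P (t+1) := by
  have h1 := base_hi (h.base_time hb (Nat.le_succ t)) (Nat.le_succ t) le_rfl
  refine ⟨h1.ch, h1.hit, h1.ok, fun p hp => ?_, ?_, fun X n => (h1.J X n).trans ?_, h1.R, h1.levN, h1.z⟩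
  · have := h1.rk p hp; omega
  · have := hb.tm; omega
  · exact mul_le_mul_of_nonneg_left (zw_mono (Nat.le_succ k)) (by positivity)

theorem wait_time (h : Ctx U E a) (hb : Base E a d Q t lev q s k P hi) (hw : Wait E a d t q k P)
    (ht : t ≤ t') : Wait E a d t' q k P :=
  ⟨fun X => le_trans (by
    have := h.ac_anti (X := X) (fun v hv => (base_units hb hv).1.trans hb.hit) ht
    linarith) (hw.w X), hw.r⟩

theorem gok_time (h : Ctx U E a) {y : ℕ} (hg : GOK E a d Q t lev y s' G) (ht : t ≤ t') :
    GOK E a d Q t' lev y s' G :=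
  ⟨fun u hu => by have := hg.rng u hu; omega, hg.iss, hg.nd, hg.lo, hg.hi,
    hg.low.trans (h.LMt_mono ht ht)⟩

theorem pend_time (h : Ctx U E a) (hp : PendOK E a d Q t lev q s k P s' G) (ht : t ≤ t') :
    PendOK E a d Q t' lev q s k P s' G :=
  ⟨h.base_time hp.base ht, h.wait_time hp.base hp.wait ht, hp.lev1, hp.ks, h.gok_time hp.g ht⟩

theorem pend_respond (h : Ctx U E a) (hp : PendOK E a d Q t lev q s k P s' G)
    (hr : rspN E a d t G = true) :
    Base E a d Q (t+1) lev q s k ((s', t, q + c0 d + k, G) :: P) (t+1) := by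
  have hb := h.base_time hp.base (Nat.le_succ t)
  have hr' := (h.rspN_iff fun u hu => (hp.g.rng u hu).2.2.2).1 hr
  refine ⟨⟨Nat.le_succ t, hp.base.hit, hp.base.ch⟩, le_rfl, ?_, ?_, hb.tm, ?_, ?_, hb.levN, ?_⟩
  · intro p hpm
    rcases List.mem_cons.1 hpm with rfl | hpm
    · exact ⟨fun u hu => by have := hp.g.rng u hu; simp only; omega, hp.g.iss, hp.g.nd, hr',
        hp.g.lo, hp.g.hi, hp.g.low⟩
    · exact hb.ok p hpm
  · intro p hpm
    rcases List.mem_cons.1 hpm with rfl | hpm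
    · exact le_rfl
    · exact hb.rk p hpm
  · intro X n
    rw [fl_cons, us_append]
    simp only
    by_cases hn : n ≤ s'
    · have h0 : us (fun v => actB E a (t+1) X v = true ∧ v.2.1 < n) (G.map fun u => (t, u)) ≤ 0 := by
        have : us (fun _ => False) (G.map fun u => (t, u)) = 0 := by simp [us, Function.comp_def]
        rw [← this]
        apply us_mono
        intro v hv hφ
        rw [List.mem_map] at hv
        obtain ⟨u, hu, rfl⟩ := hv
        have := (hp.g.rng u hu).1
        have := hφ.2
        simp only at this
        omega
      linarith [hb.J X n]
    · have hk := hp.ks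
      rw [h.zw_eq_zC (by omega)]
      have h1 := hp.wait.w X
      have h2 := us_le_gm (fun v => actB E a (t+1) X v = true ∧ v.2.1 < n) t G
      have h3 := hp.g.hi
      have h4 : us (fun v => actB E a (t+1) X v = true ∧ v.2.1 < n) (fl P) ≤ ac E a t X P :=
        us_mono fun v hv h5 => h.act_anti ((base_units hp.base hv).1.trans hp.base.hit)
          (Nat.le_succ t) h5.1
      linarith
  · rw [prm_cons]; linarith [hp.wait.r]
  · intro hl; have := hp.lev1; omega

theorem eps_le (d : ℕ) : (1/2:ℝ)^(c0 d) ≤ 1/8 := by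
  have : (1/2:ℝ)^(c0 d) ≤ (1/2)^3 :=
    pow_le_pow_of_le_one (by norm_num) (by norm_num) (by unfold c0; omega)
  linarith

/-- a frame that is neither full nor complete may request -/
theorem request (h : Ctx U E a) {pd} (hb : Base E a d Q t lev q s k P t)
    (hf : fullB E a t ((lev,q,s,k),P,pd) = false)
    (hc : ∀ X, cmpX E a d t X ((lev,q,s,k),P,pd) = false) : Wait E a d t q k P := by
  have hu : ∀ v ∈ fl P, v.2.2 ≤ t := fun v hv => (base_units hb hv).2.2.2.2.1
  have hw : ∀ X, ac E a t X P + (1/2:ℝ)^(q + c0 d + k) ≤ (1/2)^(q + c0 d) * zC E k := by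
    intro X
    have h1 := (h.cmpX_iff (d := d) (t := t) (X := X) (f := ((lev,q,s,k),P,pd)) hu hb.tm).not
    rw [hc X, not_lt] at h1
    exact h1.1 (by simp)
  refine ⟨hw, ?_⟩
  have hq := hb.tm
  have h2 := (fullB_iff (E := E) (a := a) (f := ((lev,q,s,k),P,pd)) hu (by simp only; omega)).not
  rw [hf, not_le] at h2
  have h3 := h2.1 (by simp)
  simp only at h3
  have h4 := gm_sum t hb.ok
  have hp : (0:ℝ) < (1/2)^q := by positivity
  have he : (0:ℝ) < (1/2)^(c0 d) := by positivity
  have he2 := eps_le d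
  have hk : (1/2:ℝ)^(q + c0 d + k) ≤ (1/2)^q * (1/2)^(c0 d) := by
    rw [← pow_add]; exact pow_le_pow_of_le_one (by norm_num) (by norm_num) (by omega)
  have hk0 : (0:ℝ) < (1/2)^(q + c0 d + k) := by positivity
  have hz : (1/2:ℝ)^(q + c0 d) * zC E k ≤ (1/2)^q * (1/2)^(c0 d) := by
    rw [← pow_add]
    exact mul_le_of_le_one_right (by positivity) (h.zC_le_one k)
  have h5 := hw true
  have h6 := hw false
  have hR : (1 - (1/2:ℝ)^(c0 d)) * prm P ≤ (1/2)^q * (1 + 2 * (1/2)^(c0 d)) := by linarith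
  generalize (1/2:ℝ)^(c0 d) = ε at *
  generalize (1/2:ℝ)^q = p at *
  have h7 : (1 - ε) * prm P ≤ (1 - ε) * (p * (1 + 4 * ε)) := by
    nlinarith [mul_pos hp he]
  have h8 := le_of_mul_le_mul_left h7 (by linarith)
  nlinarith

/-- a full frame hands over its lost units -/
theorem full_gok (h : Ctx U E a) {pd} (hb : Base E a d Q t lev q s k P t) (hl : 1 ≤ lev)
    (hf : fullB E a t ((lev,q,s,k),P,pd) = true) :
    GOK E a d Q (t+1) (lev+1) q s
      (greedy t (2^(t-q)) (lostL E a t ((lev,q,s,k),P,pd))) := by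
  have hu : ∀ v ∈ fl P, v.2.2 ≤ t := fun v hv => (base_units hb hv).2.2.2.2.1
  have hq := hb.tm
  have h2 := (fullB_iff (E := E) (a := a) (f := ((lev,q,s,k),P,pd)) hu (by simp only; omega)).1 hf
  simp only at h2
  have hmem : ∀ u ∈ lostL E a t ((lev,q,s,k),P,pd), ∃ v ∈ fl P, v.2 = u := by
    intro u hu
    unfold lostL at hu
    rw [List.mem_map] at hu
    obtain ⟨v, hv, rfl⟩ := hu
    exact ⟨v, List.mem_of_mem_filter hv, rfl⟩
  obtain ⟨g1, g2, g3⟩ := greedy_spec (t := t) (q := q) (η := q + c0 d)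
    (l := lostL E a t ((lev,q,s,k),P,pd)) (by omega)
    (fun u hu' => by obtain ⟨v, hv, rfl⟩ := hmem u hu'; exact hu v hv)
    (fun u hu' => by obtain ⟨v, hv, rfl⟩ := hmem u hu'; exact (base_units hb hv).2.2.2.1)
  have hgl : gm (lostL E a t ((lev,q,s,k),P,pd)) = loss E a t P := by
    unfold gm lostL loss
    rw [List.map_map, ← us_filter]
    rfl
  rw [hgl] at g3
  have hmem2 : ∀ u ∈ greedy t (2^(t-q)) (lostL E a t ((lev,q,s,k),P,pd)), ∃ v ∈ fl P, v.2 = u :=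
    fun u hu => hmem u (g1.subset hu)
  have hp : (0:ℝ) < (1/2)^q := by positivity
  have he : (0:ℝ) < (1/2)^(c0 d) := by positivity
  refine ⟨?_, ?_, ?_, ?_, g2, ?_⟩
  · intro u hu'
    obtain ⟨v, hv, rfl⟩ := hmem2 u hu'
    have := base_units hb hv
    omega
  · intro u hu'
    obtain ⟨v, hv, rfl⟩ := hmem2 u hu'
    exact (base_units hb hv).2.2.2.2.2
  · refine List.Sublist.nodup (g1.map Prod.fst) ?_
    have h3 := fl_nodup hb.ok hb.ch
    unfold lostL
    rw [List.map_map]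
    exact List.Sublist.nodup (List.Sublist.map _ List.filter_sublist) h3
  · rw [pow_add] at g3
    rcases g3 with g3 | g3
    · rw [g3]; nlinarith [mul_pos hp he]
    · linarith
  · have h4 := h.chain_loss hb.ok hl hb.ch le_rfl
    have h5 := h.LMt_mono (s := s) (Nat.le_succ t) (Nat.le_succ t)
    have h6 : gm (greedy t (2^(t-q)) (lostL E a t ((lev,q,s,k),P,pd))) ≤ loss E a t P := by
      rcases g3 with g3 | g3
      · rw [g3]
      · exact g2.trans h2
    have h7 : (0:ℝ) ≤ (lev:ℝ) * ((1/2:ℝ)^(2*d)/2) := by positivity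
    have h8 := mul_le_mul_of_nonneg_left h6 h7
    push_cast
    rw [add_sub_cancel_right]
    linarith

/-- the bottom frame is never full -/
theorem bottom_not_full (h : Ctx U E a) {pd} (hb : Base E a d Q t (2^(2*d+4)) 1 s k P t) :
    fullB E a t ((2^(2*d+4),1,s,k),P,pd) = false := by
  by_contra hf
  rw [Bool.not_eq_false] at hf
  have hu : ∀ v ∈ fl P, v.2.2 ≤ t := fun v hv => (base_units hb hv).2.2.2.2.1
  have hq := hb.tm
  have h2 := (fullB_iff (E := E) (a := a) (f := ((2^(2*d+4),1,s,k),P,pd)) hu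
    (by simp only; omega)).1 hf
  simp only [pow_one] at h2
  have h4 := h.chain_loss hb.ok Nat.one_le_two_pow hb.ch le_rfl
  have h5 := h.LMt_le_two s t t
  push_cast at h4
  have h6 : (2:ℝ)^(2*d+4) * ((1/2)^(2*d)/2) = 8 := by
    rw [pow_add, show (2:ℝ)^(2*d) * 2^4 * ((1/2)^(2*d)/2) = (2^(2*d) * (1/2)^(2*d)) * 8 by ring,
      two_mul_half, one_mul]
  rw [h6] at h4
  linarith

end Ctx

/-! ### Invariant of the whole state -/

section
variable (E : ℕ → Option (Str × Str)) (a : Bool → ℕ → ℕ → Bool) (d : ℕ) (Q : ℕ × ℕ → Prop)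

/-- invariant of the top frame -/
def TopOK (t : ℕ) (f : Frm) : Prop :=
  (f.2.2 = Option.none ∧ Base E a d Q t f.1.1 f.1.2.1 f.1.2.2.1 f.1.2.2.2 f.2.1 t) ∨
  ∃ s' G, f.2.2 = Option.some (s', G) ∧
    PendOK E a d Q t f.1.1 f.1.2.1 f.1.2.2.1 f.1.2.2.2 f.2.1 s' G

/-- invariant of a frame with child of level `lev`, goal `q` and start `s` -/
structure ParOK (t : ℕ) (f : Frm) (lev q s : ℕ) : Prop where
  pd : f.2.2 = Option.none
  base : Base E a d Q t f.1.1 f.1.2.1 f.1.2.2.1 f.1.2.2.2 f.2.1 s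
  wait : Wait E a d t f.1.2.1 f.1.2.2.2 f.2.1
  hl : lev + 1 = f.1.1
  hq : q = f.1.2.1 + c0 d + f.1.2.2.2
  ks : f.1.2.2.2 ≤ s

/-- invariant of the frames below -/
def OKrest (t : ℕ) : ℕ → ℕ → ℕ → List Frm → Prop
  | lev, q, _, [] => lev = 2^(2*d+4) ∧ q = 1
  | lev, q, s, f :: r => ParOK E a d Q t f lev q s ∧ OKrest t f.1.1 f.1.2.1 f.1.2.2.1 r

/-- invariant of the state -/
def SInv (σ : Stt) : Prop := ∃ f r, σ.2 = f :: r ∧ TopOK E a d Q σ.1 f ∧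
  OKrest E a d Q σ.1 f.1.1 f.1.2.1 f.1.2.2.1 r

/-- weight of a frame -/
noncomputable def wt (f : Frm) : ℝ := (1 + 10 * (1/2)^(c0 d) * ((f.1.1:ℝ) - 1)) *
  (prm f.2.1 + if f.2.2.isSome = true then (1/2:ℝ)^(f.1.2.1 + c0 d + f.1.2.2.2) else 0)

/-- potential of the stack -/
noncomputable def pot (l : List Frm) : ℝ := (l.map fun f => wt d f).sum

/-- issued mass of the step -/
noncomputable def issw (σ : Stt) : ℝ := (issue d σ).elim 0 fun u => (1/2:ℝ)^u.2

/-- classification of steps -/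
inductive Cls : Stt → Stt → Prop
  | pop (t t' : ℕ) (f g : Frm) (r : List Frm) (s' : ℕ) (G : List (ℕ × ℕ)) (ht : t < t')
      (hg : g.2.2 = Option.none) :
      Cls (t, f :: g :: r) (t', (g.1, g.2.1, Option.some (s', G)) :: r)
  | resp (t t' : ℕ) (c : ℕ × ℕ × ℕ × ℕ) (P : List Pkt) (sG : ℕ × List (ℕ × ℕ)) (p : Pkt)
      (r : List Frm) (ht : t < t') :
      Cls (t, (c, P, Option.some sG) :: r) (t', (c, p :: P, Option.none) :: r)
  | stay (t t' : ℕ) (c : ℕ × ℕ × ℕ × ℕ) (P : List Pkt) (sG : ℕ × List (ℕ × ℕ))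
      (r : List Frm) (ht : t < t') (hr : rspN E a d t sG.2 = false) :
      Cls (t, (c, P, Option.some sG) :: r) (t', (c, P, Option.some sG) :: r)
  | kk (t t' lev q s k : ℕ) (P : List Pkt) (r : List Frm) (ht : t < t') (hl : lev ≠ 0)
      (hf : fullB E a t ((lev,q,s,k),P,Option.none) = false)
      (hc : ∃ X, cmpX E a d t X ((lev,q,s,k),P,Option.none) = true) :
      Cls (t, ((lev,q,s,k),P,Option.none) :: r) (t', ((lev,q,s,k+1),P,Option.none) :: r)
  | push (t t' : ℕ) (f c : Frm) (r : List Frm) (ht : t < t') (hf : f.2.2 = Option.none) :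
      Cls (t, f :: r) (t', c :: f :: r)

end

namespace Ctx
variable {U : Str →. Str} {E : ℕ → Option (Str × Str)} {a : Bool → ℕ → ℕ → Bool} {d : ℕ}
  {Q : ℕ × ℕ → Prop} {t t' lev q s k hi : ℕ} {P : List Pkt} {s' : ℕ} {G : List (ℕ × ℕ)}

theorem rest_time (h : Ctx U E a) {r : List Frm} (hr : OKrest E a d Q t lev q s r) (ht : t ≤ t') :
    OKrest E a d Q t' lev q s r := by
  induction r generalizing lev q s with
  | nil => exact hr
  | cons f r ih =>
    obtain ⟨h1, h2⟩ := hr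
    exact ⟨⟨h1.pd, h.base_time h1.base ht, h.wait_time h1.base h1.wait ht, h1.hl, h1.hq, h1.ks⟩,
      ih h2⟩

theorem pop_top (h : Ctx U E a) {g : Frm} (hg : ParOK E a d Q t g lev q s) (ht : t ≤ t')
    (hG : GOK E a d Q t' (lev+1) q s G) :
    TopOK E a d Q t' (g.1, g.2.1, Option.some (s, G)) := by
  refine Or.inr ⟨s, G, rfl, h.base_time hg.base ht, h.wait_time hg.base hg.wait ht, ?_, hg.ks, ?_⟩
  · have := hg.hl; simp only; omega
  · rw [hg.hl, hg.hq] at hG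
    exact hG

theorem unit_gok (n : ℕ) (hn : s ≤ n) (hq : q ≤ n) (hQ : Q (n, q)) :
    GOK E a d Q (n+1) 1 q s [(n, q)] := by
  have hp : (0:ℝ) < (1/2)^q := by positivity
  have he : (0:ℝ) < (1/2)^(c0 d) := by positivity
  refine ⟨by simp; omega, by simpa using hQ, by simp, ?_, ?_, ?_⟩
  · simp only [gm_cons, gm_nil]; nlinarith [mul_pos hp he]
  · simp [gm_cons]
  · simp only [Nat.cast_one, sub_self, zero_mul]
    exact add_nonneg (LM_nonneg _ _ _ _) (LM_nonneg _ _ _ _)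

theorem beta (d : ℕ) {lev : ℕ} (h1 : 1 ≤ lev) (h2 : lev ≤ 2^(2*d+4)) :
    0 ≤ 1 + 10 * (1/2:ℝ)^(c0 d) * ((lev:ℝ) - 1) ∧
    (1 + 10 * (1/2:ℝ)^(c0 d) * ((lev:ℝ) - 1)) * (1 + 5 * (1/2)^(c0 d)) ≤
      1 + 10 * (1/2:ℝ)^(c0 d) * lev ∧ 1 + 10 * (1/2:ℝ)^(c0 d) * lev ≤ 2 := by
  have he : (0:ℝ) < (1/2)^(c0 d) := by positivity
  have hl1 : (1:ℝ) ≤ lev := by exact_mod_cast h1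
  have hl2 : (lev:ℝ) ≤ 2^(2*d+4) := by exact_mod_cast h2
  have h3 : (1/2:ℝ)^(c0 d) * 2^(2*d+4) = 1/16 := by
    unfold c0
    rw [pow_add, pow_add, show (1/2:ℝ)^(2*d) * (1/2)^8 * (2^(2*d) * 2^4) =
      (2^(2*d) * (1/2)^(2*d)) * (1/16) by ring, two_mul_half, one_mul]
  have h4 : (1/2:ℝ)^(c0 d) * lev ≤ 1/16 := h3 ▸ mul_le_mul_of_nonneg_left hl2 he.le
  generalize (1/2:ℝ)^(c0 d) = ε at *
  refine ⟨?_, ?_, by linarith⟩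
  · have : 0 ≤ ε * ((lev:ℝ) - 1) := mul_nonneg he.le (by linarith)
    linarith
  · nlinarith [mul_le_mul_of_nonneg_left h4 he.le, mul_pos he he]

theorem pot_cons (f : Frm) (r) : pot d (f :: r) = wt d f + pot d r := by simp [pot]

theorem wt_pop {g : Frm} (hg : ParOK E a d Q t g lev q s) {sG} : 
    wt d (g.1, g.2.1, Option.some sG) = wt d g + (1 + 10 * (1/2:ℝ)^(c0 d) * lev) * (1/2)^q := by
  unfold wt
  have := hg.hl
  have h2 : (g.1.1 : ℝ) = lev + 1 := by exact_mod_cast this.symm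
  rw [hg.pd, hg.hq, h2]
  simp
  ring

theorem pot_le {r : List Frm} (hr : OKrest E a d Q t lev q s r) :
    pot d r + (1 + 10 * (1/2:ℝ)^(c0 d) * lev) * (1/2)^q ≤ 1 := by
  induction r generalizing lev q s with
  | nil =>
    obtain ⟨rfl, rfl⟩ := hr
    have := (beta d (lev := 2^(2*d+4)) Nat.one_le_two_pow le_rfl).2.2
    simp only [pot, List.map_nil, List.sum_nil, pow_one]
    linarith
  | cons g r ih =>
    obtain ⟨h1, h2⟩ := hr
    have h3 := ih h2
    have h4 := h1.wait.r
    have hl := h1.hl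
    obtain ⟨b1, b2, _⟩ := beta d (lev := g.1.1) (by omega) h1.base.levN
    have h5 : wt d g = (1 + 10 * (1/2)^(c0 d) * ((g.1.1:ℝ) - 1)) * prm g.2.1 := by
      unfold wt; rw [h1.pd]; simp
    have h6 : (lev:ℝ) = (g.1.1:ℝ) - 1 := by rw [← hl]; push_cast; ring
    rw [pot_cons, h5, h6, h1.hq]
    have h7 := mul_le_mul_of_nonneg_left h4 b1
    have h8 := mul_le_mul_of_nonneg_left b2 (by positivity : (0:ℝ) ≤ (1/2)^g.1.2.1)
    nlinarith

theorem pot_le_one {σ : Stt} (hσ : SInv E a d Q σ) : pot d σ.2 ≤ 1 := by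
  obtain ⟨f, r, hs, ht, hr⟩ := hσ
  have h1 := pot_le hr
  rw [hs, pot_cons]
  suffices h2 : wt d f ≤ (1 + 10 * (1/2:ℝ)^(c0 d) * f.1.1) * (1/2)^f.1.2.1 by linarith
  have hp : (0:ℝ) < (1/2)^f.1.2.1 := by positivity
  rcases ht with ⟨pd, hb⟩ | ⟨s', G, pd, hb⟩
  · unfold wt; rw [pd]
    simp only [Option.isSome_none, Bool.false_eq_true, if_false, add_zero]
    rcases Nat.eq_zero_or_pos f.1.1 with h0 | h0
    · rw [hb.z h0]; simp only [prm, List.map_nil, List.sum_nil, mul_zero]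
      positivity
    · obtain ⟨b1, b2, _⟩ := beta d h0 hb.levN
      have h7 := mul_le_mul_of_nonneg_left hb.R b1
      nlinarith
  · unfold wt; rw [pd]
    simp only [Option.isSome_some, if_true]
    obtain ⟨b1, b2, _⟩ := beta d hb.lev1 hb.base.levN
    have h7 := mul_le_mul_of_nonneg_left hb.wait.r b1
    nlinarith

theorem step_all (h : Ctx U E a) {σ : Stt} (hσ : SInv E a d Q σ)
    (hQ : ∀ u, issue d σ = Option.some u → Q u) :
    SInv E a d Q (step E a d σ) ∧ Cls E a d σ (step E a d σ) ∧
      pot d σ.2 + issw d σ ≤ pot d (step E a d σ).2 := by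
  obtain ⟨t, st⟩ := σ
  obtain ⟨⟨⟨lev, q, s, k⟩, P, pd⟩, r, hs, ht, hr⟩ := hσ
  simp only at hs ht hr
  subst hs
  have hstep : step E a d (t, ((lev,q,s,k),P,pd) :: r) = stepF E a d t ((lev,q,s,k),P,pd) r := rfl
  have hiss : issue d (t, ((lev,q,s,k),P,pd) :: r) = cond (decide (lev = 0))
    (Option.some (newPos d t ((lev,q,s,k),P,pd), q)) Option.none := rfl
  rw [hstep]
  rw [hiss] at hQ
  unfold issw
  rw [hiss]
  unfold stepF
  simp only
  by_cases hl0 : lev = 0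
  · -- a unit is issued
    subst hl0
    simp only [decide_true, cond_true] at hQ ⊢
    have hQ' := hQ _ rfl
    rcases ht with ⟨hpd, hb⟩ | ⟨s', G, hpd, hb⟩
    · simp only at hpd hb
      subst hpd
      cases r with
      | nil =>
        exfalso
        have := hr.1
        have : (0:ℕ) < 2^(2*d+4) := by positivity
        omega
      | cons g r =>
        obtain ⟨hg, hr⟩ := hr
        have hn : t ≤ newPos d t ((0,q,s,k),P,Option.none) := Nat.le_add_right _ _
        set n := newPos d t ((0,q,s,k),P,Option.none) with hnd
        have hst := chain_le hb.ch
        have htm := hb.tm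
        have hG : GOK E a d Q (n+1) (0+1) q s [(n, q)] :=
          unit_gok n (by omega) (by omega) hQ'
        have htop := h.pop_top hg (by omega : t ≤ n+1) hG
        refine ⟨⟨_, r, rfl, htop, h.rest_time hr (by show t ≤ n + 1; omega)⟩, ?_, ?_⟩
        · exact Cls.pop t (n+1) _ g r s _ (by omega) hg.pd
        · show pot d (_ :: g :: r) + _ ≤ pot d ((g.1, g.2.1, Option.some (s, [(n,q)])) :: r)
          rw [pot_cons, pot_cons, pot_cons, wt_pop hg]
          have hw : wt d ((0,q,s,k),P,Option.none) = 0 := by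
            unfold wt; rw [hb.z rfl]; simp [prm]
          rw [hw]
          simp only [Option.elim_some, Nat.cast_zero, mul_zero, add_zero, one_mul]
          linarith
    · exact absurd hb.lev1 (by simp)
  · simp only [hl0, decide_false, cond_false, Option.elim_none, add_zero]
    rcases ht with ⟨hpd, hb⟩ | ⟨s', G, hpd, hb⟩
    · simp only at hpd hb
      subst hpd
      simp only [Option.elim_none]
      unfold stepNone
      by_cases hf : fullB E a t ((lev,q,s,k),P,Option.none) = true
      · rw [hf, cond_true]
        cases r with
        | nil =>
          exfalso
          obtain ⟨h1, h2⟩ := hr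
          subst h1 h2
          rw [h.bottom_not_full hb] at hf
          exact Bool.noConfusion hf
        | cons g r =>
          obtain ⟨hg, hr⟩ := hr
          have hG := h.full_gok hb (by omega) hf
          have htop := h.pop_top hg (Nat.le_succ t) hG
          refine ⟨⟨_, r, rfl, htop, h.rest_time hr (Nat.le_succ t)⟩, ?_, ?_⟩
          · exact Cls.pop t (t+1) _ g r s _ (by omega) hg.pd
          · show pot d (_ :: g :: r) ≤ pot d ((g.1, g.2.1, Option.some (s, _)) :: r)
            rw [pot_cons, pot_cons, pot_cons, wt_pop hg]
            suffices h2 : wt d ((lev,q,s,k),P,Option.none) ≤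
              (1 + 10 * (1/2:ℝ)^(c0 d) * lev) * (1/2)^q by linarith
            have hp : (0:ℝ) < (1/2)^q := by positivity
            unfold wt
            simp only [Option.isSome_none, Bool.false_eq_true, if_false, add_zero]
            obtain ⟨b1, b2, _⟩ := beta d (by omega : 1 ≤ lev) hb.levN
            have h7 := mul_le_mul_of_nonneg_left hb.R b1
            nlinarith
      · rw [Bool.not_eq_true] at hf
        rw [hf, cond_false]
        by_cases hc : (cmpX E a d t true ((lev,q,s,k),P,Option.none) ||
            cmpX E a d t false ((lev,q,s,k),P,Option.none)) = true
        · rw [hc, cond_true]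
          simp only
          refine ⟨⟨_, r, rfl, Or.inl ⟨rfl, h.base_k hb⟩, h.rest_time hr (Nat.le_succ t)⟩, ?_, ?_⟩
          · refine Cls.kk t (t+1) lev q s k P r (by omega) hl0 hf ?_
            rw [Bool.or_eq_true] at hc
            rcases hc with hc | hc
            exacts [⟨_, hc⟩, ⟨_, hc⟩]
          · rw [pot_cons, pot_cons]
            apply le_of_eq
            congr 1
        · rw [Bool.not_eq_true] at hc
          rw [hc, cond_false]
          rw [Bool.or_eq_false_iff] at hc
          have hw := h.request hb hf (fun X => by cases X; exacts [hc.2, hc.1])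
          simp only
          have htm := hb.tm
          have hlevN := hb.levN
          set T := t + (q + c0 d + k) + c0 d + 1 with hT
          have htT : t ≤ T := by omega
          refine ⟨⟨_, _, rfl, Or.inl ⟨rfl, ?_⟩, ⟨rfl, ?_, ?_, ?_, rfl, ?_⟩, ?_⟩, ?_, ?_⟩
          · refine ⟨htT, le_rfl, by simp [child], by simp [child], ?_, ?_, ?_, ?_, fun _ => rfl⟩
            · simp only [child]; omega
            · intro X n
              simp only [child, fl_nil, us_nil]
              exact mul_nonneg (by positivity) (zw_nonneg _ _)
            · simp only [child, prm, List.map_nil, List.sum_nil]; positivity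
            · simp only [child]; omega
          · exact h.base_time hb htT
          · exact h.wait_time hb hw htT
          · simp only [child]; omega
          · simp only [child]; omega
          · exact h.rest_time hr htT
          · exact Cls.push t T _ _ r (by omega) rfl
          · rw [pot_cons _ (_ :: r)]
            have : wt d (child d t ((lev,q,s,k),P,Option.none)) = 0 := by
              unfold wt child; simp [prm]
            rw [this, zero_add]
    · simp only at hpd hb
      subst hpd
      simp only [Option.elim_some]
      unfold stepPend
      by_cases hc : rspN E a d t G = true
      · simp only [hc, cond_true]
        refine ⟨⟨_, r, rfl, Or.inl ⟨rfl, h.pend_respond hb hc⟩, h.rest_time hr (Nat.le_succ t)⟩,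
          ?_, ?_⟩
        · exact Cls.resp t (t+1) _ P _ _ r (by omega)
        · rw [pot_cons, pot_cons]
          apply le_of_eq
          congr 1
          unfold wt
          simp only [Option.isSome_some, Option.isSome_none, if_true, Bool.false_eq_true, if_false]
          rw [prm_cons]; ring
      · rw [Bool.not_eq_true] at hc
        simp only [hc, cond_false]
        refine ⟨⟨_, r, rfl, Or.inr ⟨s', G, rfl, h.pend_time hb (Nat.le_succ t)⟩,
          h.rest_time hr (Nat.le_succ t)⟩, ?_, le_rfl⟩
        exact Cls.stay t (t+1) _ P _ r (by omega) hc

end Ctx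

/-! ### The run and the issued units -/

section
variable (E : ℕ → Option (Str × Str)) (a : Bool → ℕ → ℕ → Bool) (d : ℕ)

/-- the unit is issued during the run -/
def Qd (u : ℕ × ℕ) : Prop := ∃ T, issue d (run E a d T) = Option.some u

/-- request sequence describing zero strings -/
def rq (i : ℕ) : Option (ℕ × Str) :=
  (issue i.unpair.1 (run E a i.unpair.1 i.unpair.2)).elim Option.none fun u =>
    Option.some (u.2 + i.unpair.1 + 1, (List.range (2 * u.1)).map fun _ => false)

end

namespace Ctx
variable {U : Str →. Str} {E : ℕ → Option (Str × Str)} {a : Bool → ℕ → ℕ → Bool} {d : ℕ}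

theorem run_succ (T : ℕ) : run E a d (T+1) = step E a d (run E a d T) := rfl

theorem run_inv (h : Ctx U E a) (T : ℕ) : SInv E a d (Qd E a d) (run E a d T) := by
  induction T with
  | zero =>
    refine ⟨_, [], rfl, Or.inl ⟨rfl, ?_⟩, rfl, rfl⟩
    refine ⟨Nat.zero_le _, le_rfl, by simp, by simp, ?_, ?_, ?_, le_rfl, fun _ => rfl⟩
    · show 1 + c0 d + 0 ≤ c0 d + 2; omega
    · intro X n
      simp only [fl_nil, us_nil]
      exact mul_nonneg (by positivity) (zw_nonneg _ _)
    · simp only [prm, List.map_nil, List.sum_nil]; positivity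
  | succ T ih => exact (h.step_all ih (fun u hu => ⟨T, hu⟩)).1

theorem run_cls (h : Ctx U E a) (T : ℕ) : Cls E a d (run E a d T) (run E a d (T+1)) :=
  (h.step_all (h.run_inv T) (fun u hu => ⟨T, hu⟩)).2.1

theorem issued_sum (h : Ctx U E a) (d S : ℕ) :
    ∑ T ∈ Finset.range S, issw d (run E a d T) ≤ 1 := by
  refine le_trans ?_ (pot_le_one (h.run_inv (d := d) S))
  induction S with
  | zero =>
    simp only [Finset.range_zero, Finset.sum_empty]
    apply le_of_eq
    show 0 = pot d [_]
    simp [pot, wt, prm]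
  | succ S ih =>
    rw [Finset.sum_range_succ]
    have := (h.step_all (h.run_inv (d := d) S) (fun u hu => ⟨S, hu⟩)).2.2
    rw [run_succ]
    linarith

theorem issw_nonneg (d σ) : 0 ≤ issw d σ := by
  unfold issw
  cases issue d σ with
  | none => exact le_rfl
  | some u => simp only [Option.elim_some]; positivity

theorem sum_half_le (n : ℕ) : ∑ d ∈ Finset.range n, (1/2:ℝ)^(d+1) ≤ 1 := by
  have : ∑ d ∈ Finset.range n, (1/2:ℝ)^(d+1) = 1 - (1/2)^n := by
    induction n with
    | zero => simp
    | succ n ih => rw [Finset.sum_range_succ, ih, pow_succ]; ring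
  rw [this]
  have : (0:ℝ) ≤ (1/2)^n := by positivity
  linarith

theorem issued_K (h : Ctx U E a) : ∃ e : ℕ, ∀ d u, Qd E a d u →
    KC U (zeroStr (2 * u.1)) ≤ ((u.2 + d + 1 + e : ℕ) : ℕ∞) := by
  have hp : Primrec (rq E a) := by
    have h1 : Primrec fun i : ℕ => run E a i.unpair.1 i.unpair.2 :=
      pr_run h.hE.prim h.ha (by fun_prop) (by fun_prop)
    unfold rq; fun_prop
  let g : ℕ × ℕ → ℝ := fun p => (1/2:ℝ)^(p.1+1) * issw p.1 (run E a p.1 p.2)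
  have hg : ∀ p, 0 ≤ g p := fun p => mul_nonneg (by positivity) (issw_nonneg _ _)
  have hw : ∀ i, rwt (rq E a) i = g i.unpair := by
    intro i
    simp only [rwt, rq, g, issw]
    cases issue i.unpair.1 (run E a i.unpair.1 i.unpair.2) with
    | none => simp
    | some u => simp only [Option.elim_some]; rw [← pow_add]; congr 1; omega
  obtain ⟨e, he⟩ := kc_thm h.hU (rq E a) hp 0 (by
    intro n
    simp only [hw, pow_zero]
    have h1 : ∑ i ∈ Finset.range n, g i.unpair = ∑ p ∈ (Finset.range n).image Nat.unpair, g p := by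
      rw [Finset.sum_image]
      intro i _ j _ hij
      rw [← Nat.pair_unpair i, ← Nat.pair_unpair j, hij]
    rw [h1]
    refine le_trans (Finset.sum_le_sum_of_subset_of_nonneg
      (t := Finset.range n ×ˢ Finset.range n) ?_ fun p _ _ => hg p) ?_
    · intro p hp
      simp only [Finset.mem_image, Finset.mem_range] at hp
      obtain ⟨i, hi, rfl⟩ := hp
      simp only [Finset.mem_product, Finset.mem_range]
      exact ⟨(Nat.unpair_left_le i).trans_lt hi, (Nat.unpair_right_le i).trans_lt hi⟩
    · rw [Finset.sum_product]
      refine le_trans (Finset.sum_le_sum fun d _ => ?_) (sum_half_le n)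
      simp only [g]
      rw [← Finset.mul_sum]
      exact mul_le_of_le_one_right (by positivity) (h.issued_sum d n))
  refine ⟨e, fun d u ⟨T, hu⟩ => ?_⟩
  have h2 := he (Nat.pair d T) (u.2 + d + 1) ((List.range (2 * u.1)).map fun _ => false) (by
    unfold rq; rw [Nat.unpair_pair]; simp only; rw [hu]; rfl)
  have h3 : zeroStr (2 * u.1) = (List.range (2 * u.1)).map fun _ => false := by
    unfold zeroStr; simp
  rw [h3]
  exact h2

theorem issued_pos {u : ℕ × ℕ} (hu : Qd E a d u) : 2^(u.2 + 2*d + 2) ≤ u.1 := by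
  obtain ⟨T, hu⟩ := hu
  unfold issue at hu
  cases hf : (run E a d T).2.head? with
  | none => rw [hf] at hu; simp at hu
  | some f =>
    rw [hf] at hu
    simp only [Option.elim_some] at hu
    cases hd : decide (f.1.1 = 0) with
    | false => rw [hd] at hu; simp at hu
    | true =>
      rw [hd] at hu
      simp only [cond_true, Option.some.injEq] at hu
      subst hu
      exact Nat.le_add_left _ _

theorem tail_shift (G : List (ℕ × ℕ)) (m n : ℕ) :
    tail (G.map fun u => (u.1, u.2 + m)) n = (1/2)^m * tail G n := by
  unfold tail
  induction G with
  | nil => simp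
  | cons u G ih =>
    rw [List.map_cons, List.filter_cons, List.filter_cons]
    by_cases hn : n ≤ u.1
    · simp only [hn, decide_true, if_true, List.map_cons, List.sum_cons]
      rw [ih, pow_add]; ring
    · simp only [hn, decide_false, Bool.false_eq_true, if_false]
      exact ih

/-- pending units are eventually answered -/
theorem answered {b e : ℕ} (hd : d = b + e + 1)
    (hrep : ∀ G : List (ℕ × ℕ), (G.map Prod.fst).Nodup →
      (∀ u ∈ G, KC U (zeroStr (2 * u.1)) ≤ (u.2 : ℕ∞) ∧ 4 * 2 ^ (u.2 + b) ≤ u.1) →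
      ∃ t0, ∀ t ≥ t0, ∀ u ∈ G,
        (1/2:ℝ)^b * tail G u.1 ≤ mass E (a true t) u.1 t + mass E (a false t) u.1 t)
    (he : ∀ d u, Qd E a d u → KC U (zeroStr (2 * u.1)) ≤ ((u.2 + d + 1 + e : ℕ) : ℕ∞))
    {G : List (ℕ × ℕ)} (hnd : (G.map Prod.fst).Nodup) (hQ : ∀ u ∈ G, Qd E a d u) :
    ∃ t0, ∀ t ≥ t0, ∀ u ∈ G,
      (1/2:ℝ)^(2*d) * tail G u.1 ≤ mass E (a true t) u.1 t + mass E (a false t) u.1 t := by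
  obtain ⟨t0, h0⟩ := hrep (G.map fun u => (u.1, u.2 + (d + 1 + e))) (by
    rw [List.map_map]; exact hnd) (by
    intro u hu
    rw [List.mem_map] at hu
    obtain ⟨w, hw, rfl⟩ := hu
    refine ⟨?_, ?_⟩
    · have := he d w (hQ w hw)
      simpa [add_assoc] using this
    · have := issued_pos (hQ w hw)
      refine le_trans (le_of_eq ?_) this
      simp only
      rw [show 4 = 2^2 by norm_num, ← pow_add]
      congr 1; omega)
  refine ⟨t0, fun t ht u hu => ?_⟩
  have h1 := h0 t ht (u.1, u.2 + (d + 1 + e)) (List.mem_map.2 ⟨u, hu, rfl⟩)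
  rw [tail_shift, ← mul_assoc, ← pow_add] at h1
  rw [show 2 * d = b + (d + 1 + e) by omega]
  exact h1

end Ctx

/-! ### The permanent frame -/

section
variable (E : ℕ → Option (Str × Str)) (a : Bool → ℕ → ℕ → Bool) (d : ℕ)

/-- event at a frame -/
def evF (X : Bool) (t : ℕ) (f : Frm) : Bool :=
  !decide (f.1.1 = 0) && !f.2.2.isSome && !fullB E a t f && cmpX E a d t X f

/-- event at a step of the run -/
def evB (X : Bool) (l τ0 T : ℕ) : Bool :=
  decide (τ0 ≤ T) && decide ((run E a d T).2.length = l) &&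
    (run E a d T).2.head?.elim false fun f => evF E a d X (run E a d T).1 f

/-- evolution of a frame inside the stack -/
inductive Evo (t : ℕ) (pre : List Frm) (f : Frm) (pre' : List Frm) (f' : Frm) : Prop
  | pend (sG : ℕ × List (ℕ × ℕ)) (h1 : f.2.2 = Option.none)
      (h2 : f' = (f.1, f.2.1, Option.some sG)) : Evo t pre f pre' f'
  | pack (p : Pkt) (h1 : f.2.2.isSome = true) (h2 : f' = (f.1, p :: f.2.1, Option.none)) :
      Evo t pre f pre' f'
  | kk (X : Bool) (h0 : pre = []) (h1 : evF E a d X t f = true)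
      (h2 : f' = ((f.1.1, f.1.2.1, f.1.2.2.1, f.1.2.2.2 + 1), f.2)) : Evo t pre f pre' f'
  | stay (sG : ℕ × List (ℕ × ℕ)) (h1 : f.2.2 = Option.some sG) (h2 : f' = f)
      (h3 : pre = []) (h4 : pre' = []) (h5 : rspN E a d t sG.2 = false) : Evo t pre f pre' f'
  | other (h2 : f' = f) (h3 : pre' ≠ []) : Evo t pre f pre' f'

end

/-- progress measure of a frame -/
def msr (f : Frm) : ℕ := f.1.2.2.2 + 2 * f.2.1.length + cond f.2.2.isSome 1 0

section
variable {E : ℕ → Option (Str × Str)} {a : Bool → ℕ → ℕ → Bool} {d : ℕ}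

theorem evo_of_cls {σ σ' : Stt} (hc : Cls E a d σ σ') {pre : List Frm} {f : Frm} {R : List Frm}
    (hs : σ.2 = pre ++ f :: R) (hl : R.length < σ'.2.length) :
    ∃ pre' f', σ'.2 = pre' ++ f' :: R ∧ Evo E a d σ.1 pre f pre' f' := by
  cases hc with
  | pop t t' f1 g r s' G ht hg =>
    simp only at hs hl ⊢
    cases pre with
    | nil =>
      rw [List.nil_append, List.cons.injEq] at hs
      rw [← hs.2] at hl
      simp at hl
    | cons x pre =>
      rw [List.cons_append, List.cons.injEq] at hs
      obtain ⟨_, hs⟩ := hs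
      cases pre with
      | nil =>
        rw [List.nil_append, List.cons.injEq] at hs
        obtain ⟨rfl, rfl⟩ := hs
        exact ⟨[], _, rfl, Evo.pend _ hg rfl⟩
      | cons y pre =>
        rw [List.cons_append, List.cons.injEq] at hs
        obtain ⟨_, rfl⟩ := hs
        exact ⟨_ :: pre, f, rfl, Evo.other rfl (by simp)⟩
  | resp t t' c P sG p r ht =>
    simp only at hs hl ⊢
    cases pre with
    | nil =>
      rw [List.nil_append, List.cons.injEq] at hs
      obtain ⟨rfl, rfl⟩ := hs
      exact ⟨[], _, rfl, Evo.pack p rfl rfl⟩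
    | cons x pre =>
      rw [List.cons_append, List.cons.injEq] at hs
      obtain ⟨_, rfl⟩ := hs
      exact ⟨_ :: pre, f, rfl, Evo.other rfl (by simp)⟩
  | stay t t' c P sG r ht hr =>
    simp only at hs hl ⊢
    cases pre with
    | nil =>
      rw [List.nil_append, List.cons.injEq] at hs
      obtain ⟨rfl, rfl⟩ := hs
      exact ⟨[], _, rfl, Evo.stay sG rfl rfl rfl rfl hr⟩
    | cons x pre =>
      rw [List.cons_append, List.cons.injEq] at hs
      obtain ⟨_, rfl⟩ := hs
      exact ⟨_ :: pre, f, rfl, Evo.other rfl (by simp)⟩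
  | kk t t' lev q s k P r ht hl0 hf hc =>
    simp only at hs hl ⊢
    cases pre with
    | nil =>
      rw [List.nil_append, List.cons.injEq] at hs
      obtain ⟨rfl, rfl⟩ := hs
      obtain ⟨X, hc⟩ := hc
      refine ⟨[], _, rfl, Evo.kk X rfl ?_ rfl⟩
      unfold evF
      simp [hl0, hf, hc]
    | cons x pre =>
      rw [List.cons_append, List.cons.injEq] at hs
      obtain ⟨_, rfl⟩ := hs
      exact ⟨_ :: pre, f, rfl, Evo.other rfl (by simp)⟩
  | push t t' f1 c r ht hf =>
    simp only at hs hl ⊢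
    rw [hs]
    exact ⟨c :: pre, f, rfl, Evo.other rfl (by simp)⟩

theorem evo_basic {t : ℕ} {pre pre' : List Frm} {f f' : Frm} (he : Evo E a d t pre f pre' f') :
    f'.1.1 = f.1.1 ∧ f'.1.2.1 = f.1.2.1 ∧ f.1.2.2.2 ≤ f'.1.2.2.2 ∧ f.2.1 <:+ f'.2.1 ∧
    (f' = f ∨ msr f < msr f') ∧
    (f.1.2.2.2 < f'.1.2.2.2 → pre = [] ∧ ∃ X, evF E a d X t f = true) := by
  cases he with
  | pend sG h1 h2 =>
    subst h2
    refine ⟨rfl, rfl, le_rfl, List.suffix_rfl, Or.inr ?_, fun h => absurd h (lt_irrefl _)⟩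
    unfold msr; rw [h1]; simp
  | pack p h1 h2 =>
    subst h2
    refine ⟨rfl, rfl, le_rfl, List.suffix_cons _ _, Or.inr ?_, fun h => absurd h (lt_irrefl _)⟩
    unfold msr; rw [h1]; simp; omega
  | kk X h0 h1 h2 =>
    subst h2
    refine ⟨rfl, rfl, Nat.le_succ _, List.suffix_rfl, Or.inr ?_, fun _ => ⟨h0, X, h1⟩⟩
    unfold msr; simp
  | stay sG h1 h2 h3 h4 h5 =>
    subst h2
    exact ⟨rfl, rfl, le_rfl, List.suffix_rfl, Or.inl rfl, fun h => absurd h (lt_irrefl _)⟩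
  | other h2 h3 =>
    subst h2
    exact ⟨rfl, rfl, le_rfl, List.suffix_rfl, Or.inl rfl, fun h => absurd h (lt_irrefl _)⟩

theorem evo_event {X : Bool} {t : ℕ} {f : Frm}
    (he : evF E a d X t f = true) : f.1.1 ≠ 0 ∧ f.2.2 = Option.none ∧ fullB E a t f = false ∧
      cmpX E a d t X f = true := by
  unfold evF at he
  simpa [Bool.and_eq_true, and_assoc] using he

theorem liminf_attained {f : ℕ → ℕ} {M : ℕ} (hM : ∀ T, f T ≤ M) :
    ∃ l, (∃ τ0, ∀ T ≥ τ0, l ≤ f T) ∧ ∀ T, ∃ T' ≥ T, f T' = l := by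
  have hex : ∃ l, ∀ T, ∃ T' ≥ T, f T' ≤ l := ⟨M, fun T => ⟨T, le_rfl, hM T⟩⟩
  have h1 : ∃ τ0, ∀ T ≥ τ0, Nat.find hex ≤ f T := by
    rcases Nat.eq_zero_or_pos (Nat.find hex) with h0 | h0
    · exact ⟨0, fun T _ => by omega⟩
    · have := Nat.find_min hex (m := Nat.find hex - 1) (by omega)
      push Not at this
      obtain ⟨τ0, h2⟩ := this
      exact ⟨τ0, fun T hT => by have := h2 T hT; omega⟩
  refine ⟨Nat.find hex, h1, fun T => ?_⟩
  obtain ⟨τ0, h1⟩ := h1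
  obtain ⟨T', h2, h3⟩ := Nat.find_spec hex (max T τ0)
  exact ⟨T', le_trans (le_max_left _ _) h2,
    le_antisymm h3 (h1 T' (le_trans (le_max_right _ _) h2))⟩

end

/-- the permanent frame -/
structure Perm (E : ℕ → Option (Str × Str)) (a : Bool → ℕ → ℕ → Bool) (d τ0 : ℕ) (R : List Frm)
    (pr : ℕ → List Frm) (fr : ℕ → Frm) : Prop where
  st : ∀ T ≥ τ0, (run E a d T).2 = pr T ++ fr T :: R
  evo : ∀ T ≥ τ0, Evo E a d (run E a d T).1 (pr T) (fr T) (pr (T+1)) (fr (T+1))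
  inf : ∀ B, ∃ T ≥ B, pr T = []

namespace Ctx
variable {U : Str →. Str} {E : ℕ → Option (Str × Str)} {a : Bool → ℕ → ℕ → Bool} {d : ℕ}

theorem rest_len {Q} {t lev q s : ℕ} {r : List Frm} (hr : OKrest E a d Q t lev q s r) :
    lev + r.length = 2^(2*d+4) := by
  induction r generalizing lev q s with
  | nil => exact hr.1
  | cons f r ih =>
    have := ih hr.2
    have := hr.1.hl
    simp only [List.length_cons]
    omega

theorem run_len (h : Ctx U E a) (T : ℕ) : (run E a d T).2.length ≤ 2^(2*d+4) + 1 := by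
  obtain ⟨f, r, hs, _, hr⟩ := h.run_inv (d := d) T
  have := rest_len hr
  rw [hs, List.length_cons]; omega

theorem cls_time {σ σ' : Stt} (hc : Cls E a d σ σ') : σ.1 < σ'.1 := by
  cases hc with
  | pop t t' f g r s' G ht hg => exact ht
  | resp t t' c P sG p r ht => exact ht
  | stay t t' c P sG r ht hr => exact ht
  | kk t t' lev q s k P r ht hl hf hc => exact ht
  | push t t' f c r ht hf => exact ht

theorem run_time (h : Ctx U E a) (T : ℕ) : (run E a d T).1 < (run E a d (T+1)).1 :=
  cls_time (h.run_cls (d := d) T)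

theorem run_time_mono (h : Ctx U E a) : StrictMono fun T => (run E a d T).1 :=
  strictMono_nat_of_lt_succ fun T => h.run_time T

theorem exists_perm (h : Ctx U E a) : ∃ τ0 R pr fr, Perm E a d τ0 R pr fr := by
  obtain ⟨l, ⟨τ1, h1⟩, h2⟩ := liminf_attained (h.run_len (d := d))
  obtain ⟨τ0, h3, h4⟩ := h2 τ1
  obtain ⟨f0, R, hs0, _, _⟩ := h.run_inv (d := d) τ0
  have hlR : R.length + 1 = l := by rw [← h4, hs0]; rfl
  have hst : ∀ n, ∃ pre f, (run E a d (τ0 + n)).2 = pre ++ f :: R := by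
    intro n
    induction n with
    | zero => exact ⟨[], f0, hs0⟩
    | succ n ih =>
      obtain ⟨pre, f, hp⟩ := ih
      obtain ⟨pre', f', hp', _⟩ := evo_of_cls (h.run_cls (τ0+n)) hp
        (by have := h1 (τ0+n+1) (by omega); omega)
      exact ⟨pre', f', hp'⟩
  have hst2 : ∀ T, ∃ x : List Frm × Frm, T ≥ τ0 → (run E a d T).2 = x.1 ++ x.2 :: R := by
    intro T
    by_cases hT : T ≥ τ0
    · obtain ⟨n, rfl⟩ := Nat.exists_eq_add_of_le hT
      obtain ⟨pre, f, hp⟩ := hst n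
      exact ⟨(pre, f), fun _ => hp⟩
    · exact ⟨([], f0), fun h => absurd h hT⟩
  choose x hx using hst2
  refine ⟨τ0, R, fun T => (x T).1, fun T => (x T).2, hx, fun T hT => ?_, fun B => ?_⟩
  · obtain ⟨pre', f', hp', he⟩ := evo_of_cls (h.run_cls T) (hx T hT)
      (by have := h1 (T+1) (by omega); omega)
    have h5 := hx (T+1) (by omega)
    rw [hp'] at h5
    obtain ⟨rfl, h6⟩ := List.append_inj' h5 rfl
    rw [List.cons.injEq] at h6
    obtain ⟨rfl, _⟩ := h6
    exact he
  · obtain ⟨T, hT, hT2⟩ := h2 (max B τ0)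
    refine ⟨T, le_trans (le_max_left _ _) hT, ?_⟩
    rw [hx T (le_trans (le_max_right _ _) hT)] at hT2
    simp only [List.length_append, List.length_cons] at hT2
    exact List.eq_nil_of_length_eq_zero (by omega)

section perm
variable {τ0 : ℕ} {R : List Frm} {pr : ℕ → List Frm} {fr : ℕ → Frm}

theorem perm_mono (hp : Perm E a d τ0 R pr fr) {T T' : ℕ} (h0 : τ0 ≤ T) (hT : T ≤ T') :
    (fr T').1.1 = (fr T).1.1 ∧ (fr T').1.2.1 = (fr T).1.2.1 ∧
    (fr T).1.2.2.2 ≤ (fr T').1.2.2.2 ∧ (fr T).2.1 <:+ (fr T').2.1 ∧ msr (fr T) ≤ msr (fr T') := by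
  induction T', hT using Nat.le_induction with
  | base => exact ⟨rfl, rfl, le_rfl, List.suffix_rfl, le_rfl⟩
  | succ n hn ih =>
    obtain ⟨e1, e2, e3, e4, e5, _⟩ := evo_basic (hp.evo n (by omega))
    obtain ⟨i1, i2, i3, i4, i5⟩ := ih
    refine ⟨e1.trans i1, e2.trans i2, i3.trans e3, i4.trans e4, ?_⟩
    rcases e5 with e5 | e5
    · rw [e5]; exact i5
    · omega

/-- the invariant at the permanent frame when it is on top -/
theorem perm_top (h : Ctx U E a) (hp : Perm E a d τ0 R pr fr) {T : ℕ} (hT : τ0 ≤ T)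
    (ht : pr T = []) : TopOK E a d (Qd E a d) (run E a d T).1 (fr T) := by
  obtain ⟨f, r, hs, h1, _⟩ := h.run_inv (d := d) T
  rw [hp.st T hT, ht, List.nil_append, List.cons.injEq] at hs
  rw [hs.1]; exact h1

theorem perm_progress (h : Ctx U E a) (hp : Perm E a d τ0 R pr fr)
    (hans : ∀ G : List (ℕ × ℕ), (G.map Prod.fst).Nodup → (∀ u ∈ G, Qd E a d u) →
      ∃ t0, ∀ t ≥ t0, ∀ u ∈ G,
      (1/2:ℝ)^(2*d) * tail G u.1 ≤ mass E (a true t) u.1 t + mass E (a false t) u.1 t)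
    {T : ℕ} (hT : τ0 ≤ T) : ∃ T' > T, msr (fr T) < msr (fr T') := by
  by_contra hcon
  push Not at hcon
  have hfr : ∀ T' ≥ T, fr T' = fr T := by
    intro T' hT'
    induction T', hT' using Nat.le_induction with
    | base => rfl
    | succ n hn ih =>
      obtain ⟨_, _, _, _, e5, _⟩ := evo_basic (hp.evo n (by omega))
      have := hcon (n+1) (by omega)
      rw [ih] at e5
      rcases e5 with e5 | e5
      · exact e5
      · omega
  have hE : ∀ T' ≥ T, (∃ sG, (fr T).2.2 = Option.some sG ∧ pr T' = [] ∧ pr (T'+1) = [] ∧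
      rspN E a d (run E a d T').1 sG.2 = false) ∨ pr (T'+1) ≠ [] := by
    intro T' hT'
    have he := hp.evo T' (by omega)
    rw [hfr T' hT', hfr (T'+1) (by omega)] at he
    cases he with
    | pend sG h1 h2 => rw [h2] at h1; simp at h1
    | pack p h1 h2 => rw [h2] at h1; simp at h1
    | kk X h0 h1 h2 =>
      have : (fr T).1.2.2.2 = (fr T).1.2.2.2 + 1 := congrArg (fun f : Frm => f.1.2.2.2) h2
      omega
    | stay sG h1 h2 h3 h4 h5 => exact Or.inl ⟨sG, h1, h3, h4, h5⟩
    | other h2 h3 => exact Or.inr h3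
  obtain ⟨T1, hT1, hT1'⟩ := hp.inf (T+1)
  rcases hE (T1 - 1) (by omega) with ⟨⟨s', G⟩, hsG, h2, _⟩ | h2
  · have hall : ∀ T' ≥ T, pr (T'+1) = [] := by
      intro T' hT'
      by_contra hne
      -- once above, never back
      have : ∀ T'' ≥ T' + 1, pr T'' ≠ [] := by
        intro T'' hT''
        induction T'', hT'' using Nat.le_induction with
        | base => exact hne
        | succ n hn ih =>
          rcases hE n (by omega) with ⟨_, _, h3, _⟩ | h3
          · exact absurd h3 ih
          · exact h3
      obtain ⟨T2, h4, h5⟩ := hp.inf (T'+1)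
      exact this T2 h4 h5
    have htop := h.perm_top hp (by omega : τ0 ≤ T1) hT1'
    rw [hfr T1 (by omega)] at htop
    rcases htop with ⟨hpd, _⟩ | ⟨s2, G2, hpd, hpend⟩
    · rw [hsG] at hpd; simp at hpd
    · rw [hsG] at hpd
      simp only [Option.some.injEq, Prod.mk.injEq] at hpd
      obtain ⟨rfl, rfl⟩ := hpd
      obtain ⟨t0, ht0⟩ := hans G hpend.g.nd hpend.g.iss
      have hm := h.run_time_mono (d := d)
      set T2 := max T1 t0 with hT2
      rcases hE T2 (by omega) with ⟨sG2, h6, _, _, h7⟩ | h6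
      · rw [hsG, Option.some.injEq] at h6
        subst h6
        have h8 : T2 ≤ (run E a d T2).1 := hm.le_apply
        have h9 : (run E a d T1).1 ≤ (run E a d T2).1 := hm.monotone (by omega)
        have := (h.rspN_iff (d := d) (t := (run E a d T2).1) (G := G) (fun u hu => by
          have := (hpend.g.rng u hu).2.2.2; omega)).2 (ht0 _ (by omega))
        simp only at h7
        rw [this] at h7
        exact Bool.noConfusion h7
      · exact h6 (hall T2 (by omega))
  · rw [Nat.sub_add_cancel (by omega)] at h2
    exact h2 hT1'

end perm
end Ctx

/-! ### Infinitely many events at the permanent frame -/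

namespace Ctx
variable {U : Str →. Str} {E : ℕ → Option (Str × Str)} {a : Bool → ℕ → ℕ → Bool} {d : ℕ}
variable {τ0 : ℕ} {R : List Frm} {pr : ℕ → List Frm} {fr : ℕ → Frm}

theorem prm_card {P : List Pkt} {m : ℕ} (h : ∀ p ∈ P, p.2.2.1 ≤ m) :
    (P.length : ℝ) * (1/2)^m ≤ prm P := by
  induction P with
  | nil => simp [prm]
  | cons p P ih =>
    have h1 := ih fun x hx => h x (List.mem_cons_of_mem _ hx)
    have h2 : (1/2:ℝ)^m ≤ (1/2)^p.2.2.1 :=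
      pow_le_pow_of_le_one (by norm_num) (by norm_num) (h p List.mem_cons_self)
    rw [prm_cons, List.length_cons]
    push_cast
    linarith

theorem base_card {Q t lev q s k P hi} (hb : Base E a d Q t lev q s k P hi) :
    P.length ≤ 6 * 2^(c0 d + k) := by
  have h1 := (prm_card hb.rk).trans hb.R
  have h2 : (1/2:ℝ)^(c0 d) ≤ 1 := pow_le_one₀ (by norm_num) (by norm_num)
  have hq : (0:ℝ) < (1/2)^q := by positivity
  have h3 : (P.length : ℝ) * (1/2)^(c0 d + k) ≤ 6 := by
    rw [add_assoc, pow_add] at h1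
    have : (1/2:ℝ)^q * ((P.length : ℝ) * (1/2)^(c0 d + k)) ≤ (1/2)^q * 6 := by nlinarith
    exact le_of_mul_le_mul_left this hq
  have h4 := two_mul_half (c0 d + k)
  have h5 : (P.length : ℝ) ≤ 6 * 2^(c0 d + k) := by
    calc (P.length : ℝ) = 2^(c0 d + k) * (P.length * (1/2)^(c0 d + k)) := by
          rw [mul_left_comm, h4, mul_one]
      _ ≤ 2^(c0 d + k) * 6 := mul_le_mul_of_nonneg_left h3 (by positivity)
      _ = _ := by ring
  exact_mod_cast h5

theorem perm_base (h : Ctx U E a) (hp : Perm E a d τ0 R pr fr) {T : ℕ} (hT : τ0 ≤ T)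
    (ht : pr T = []) : ∃ hi, Base E a d (Qd E a d) (run E a d T).1 (fr T).1.1 (fr T).1.2.1
      (fr T).1.2.2.1 (fr T).1.2.2.2 (fr T).2.1 hi := by
  rcases h.perm_top hp hT ht with ⟨_, hb⟩ | ⟨s', G, _, hb⟩
  · exact ⟨_, hb⟩
  · exact ⟨_, hb.base⟩

/-- every request is answered -/
def Ans (E : ℕ → Option (Str × Str)) (a : Bool → ℕ → ℕ → Bool) (d : ℕ) : Prop :=
  ∀ G : List (ℕ × ℕ), (G.map Prod.fst).Nodup → (∀ u ∈ G, Qd E a d u) →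
      ∃ t0, ∀ t ≥ t0, ∀ u ∈ G,
      (1/2:ℝ)^(2*d) * tail G u.1 ≤ mass E (a true t) u.1 t + mass E (a false t) u.1 t

theorem k_unbounded (h : Ctx U E a) (hp : Perm E a d τ0 R pr fr) (hans : Ans E a d) (K : ℕ) :
    ∃ T ≥ τ0, K ≤ (fr T).1.2.2.2 := by
  by_contra hcon
  push Not at hcon
  have hm : ∀ m, ∃ T ≥ τ0, m ≤ msr (fr T) := by
    intro m
    induction m with
    | zero => exact ⟨τ0, le_rfl, Nat.zero_le _⟩
    | succ m ih =>
      obtain ⟨T, hT, h1⟩ := ih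
      obtain ⟨T', hT', h2⟩ := h.perm_progress hp hans hT
      exact ⟨T', by omega, by omega⟩
  obtain ⟨T, hT, h1⟩ := hm (K + 2 * (6 * 2^(c0 d + K)) + 2)
  obtain ⟨T', hT', h2⟩ := hp.inf T
  obtain ⟨hi, hb⟩ := h.perm_base hp (by omega : τ0 ≤ T') h2
  have h3 := base_card hb
  have h4 := (perm_mono hp hT hT').2.2.2.2
  have h5 := hcon T' (by omega)
  have h6 : 2^(c0 d + (fr T').1.2.2.2) ≤ 2^(c0 d + K) :=
    Nat.pow_le_pow_right (by norm_num) (by omega)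
  have h7 : msr (fr T') ≤ (fr T').1.2.2.2 + 2 * (fr T').2.1.length + 1 := by
    unfold msr
    cases (fr T').2.2.isSome <;> simp
  omega

theorem events_inf (h : Ctx U E a) (hp : Perm E a d τ0 R pr fr) (hans : Ans E a d) (B : ℕ) :
    ∃ T ≥ B, τ0 ≤ T ∧ pr T = [] ∧ ∃ X, evF E a d X (run E a d T).1 (fr T) = true := by
  by_contra hcon
  push Not at hcon
  set T0 := max B τ0 with hT0
  have hk : ∀ T ≥ T0, (fr T).1.2.2.2 = (fr T0).1.2.2.2 := by
    intro T hT
    induction T, hT using Nat.le_induction with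
    | base => rfl
    | succ n hn ih =>
      obtain ⟨_, _, e3, _, _, e6⟩ := evo_basic (hp.evo n (by omega))
      rcases Nat.lt_or_ge (fr n).1.2.2.2 (fr (n+1)).1.2.2.2 with h1 | h1
      · obtain ⟨h2, X, h3⟩ := e6 h1
        exact absurd h3 (hcon n (by omega) (by omega) h2 X)
      · omega
  obtain ⟨T, hT, h1⟩ := h.k_unbounded hp hans ((fr T0).1.2.2.2 + 1)
  have h2 := (perm_mono hp hT (le_max_left T T0)).2.2.1
  have h3 := hk (max T T0) (le_max_right _ _)
  omega

theorem evB_iff (hp : Perm E a d τ0 R pr fr) {X : Bool} {T : ℕ} :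
    evB E a d X (R.length + 1) τ0 T = true ↔
      τ0 ≤ T ∧ pr T = [] ∧ evF E a d X (run E a d T).1 (fr T) = true := by
  unfold evB
  by_cases hT : τ0 ≤ T
  · have h1 := hp.st T hT
    by_cases h2 : pr T = []
    · rw [h1, h2]; simp [hT]
    · rw [h1]
      have : (pr T).length ≠ 0 := fun h => h2 (List.eq_nil_of_length_eq_zero h)
      simp [hT, h2]
  · simp [hT]

theorem evB_head (hp : Perm E a d τ0 R pr fr) {X : Bool} {T : ℕ}
    (h : evB E a d X (R.length + 1) τ0 T = true) :
    (run E a d T).2.head? = Option.some (fr T) := by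
  obtain ⟨h1, h2, _⟩ := (evB_iff hp).1 h
  rw [hp.st T h1, h2]; rfl

theorem event_side (h : Ctx U E a) (hp : Perm E a d τ0 R pr fr) (hans : Ans E a d) :
    ∃ X, ∀ B, ∃ T ≥ B, evB E a d X (R.length + 1) τ0 T = true := by
  by_contra hcon
  push Not at hcon
  obtain ⟨B1, h1⟩ := hcon true
  obtain ⟨B2, h2⟩ := hcon false
  obtain ⟨T, hT, h3, h4, X, h5⟩ := h.events_inf hp hans (max B1 B2)
  have h6 := (evB_iff hp).2 ⟨h3, h4, h5⟩
  cases X with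
  | true => exact h1 T (le_trans (le_max_left _ _) hT) h6
  | false => exact h2 T (le_trans (le_max_right _ _) hT) h6

theorem event_step (hp : Perm E a d τ0 R pr fr) {X : Bool} {T : ℕ}
    (h : evB E a d X (R.length + 1) τ0 T = true) :
    (fr (T+1)).1.2.2.2 = (fr T).1.2.2.2 + 1 := by
  obtain ⟨h1, h2, h3⟩ := (evB_iff hp).1 h
  obtain ⟨e1, e2, e3, e4⟩ := evo_event h3
  have hc : (cmpX E a d (run E a d T).1 true (fr T) || cmpX E a d (run E a d T).1 false (fr T)) =
      true := by
    cases X <;> simp [e4]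
  have h5 := hp.st (T+1) (by omega)
  have h6 : (run E a d (T+1)).2 =
      ((((fr T).1.1, (fr T).1.2.1, (fr T).1.2.2.1, (fr T).1.2.2.2 + 1), (fr T).2) : Frm) :: R := by
    rw [run_succ]
    unfold step
    rw [hp.st T h1, h2]
    simp only [List.nil_append, List.head?_cons, Option.elim_some, List.tail_cons]
    unfold stepF stepNone
    rw [e2, e3, hc]
    simp [e1]
  rw [h6, ← List.nil_append (_ :: R)] at h5
  obtain ⟨_, h7⟩ := List.append_inj' h5 rfl
  rw [List.cons.injEq] at h7
  rw [← h7.1]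

/-! ### Counting changes -/

/-- lost mass with label `X` -/
noncomputable def XL (E : ℕ → Option (Str × Str)) (a : Bool → ℕ → ℕ → Bool) (X : Bool) (t : ℕ)
    (P : List Pkt) : ℝ :=
  us (fun v => lostB E a t v = true ∧ labB E a v = X) (fl P)

theorem XL_le_loss (X : Bool) (t P) : XL E a X t P ≤ loss E a t P :=
  us_mono fun _ _ h => h.1

theorem XL_suffix {X : Bool} {t P P'} (hs : P <:+ P') : XL E a X t P ≤ XL E a X t P' := by
  obtain ⟨l, rfl⟩ := hs
  unfold XL
  rw [show fl (l ++ P) = fl l ++ fl P by simp [fl], us_append]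
  have := us_nonneg (fun v => lostB E a t v = true ∧ labB E a v = X) (fl l)
  linarith

theorem change_bound (h : Ctx U E a) {Q t t' lev q s k P P' hi} {X : Bool}
    (hb : Base E a d Q t lev q s k P hi) (ht : t ≤ t') (hs : P <:+ P')
    (hc : (1/2:ℝ)^(q + c0 d) * zC E k < ac E a t X P + (1/2)^(q + c0 d + k)) :
    (1/2:ℝ)^(q + c0 d) * (∑ j ∈ Finset.range k, if isZ E j = true ∧
      seg (a X t') (sg E j).length ≠ seg (a X t) (sg E j).length then ew E j else 0) ≤
    XL E a X t' P' - XL E a X t P + (1/2)^(q + c0 d + k) := by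
  have hv : ∀ v ∈ fl P, v.1 ≤ t := fun v hv => (base_units hb hv).1.trans hb.hit
  have h0 : XL E a X t' P ≤ XL E a X t' P' := XL_suffix hs
  have hmon : XL E a X t P ≤ XL E a X t' P :=
    us_mono fun v hv' h1 => ⟨h.lost_mono (hv v hv') ht h1.1, h1.2⟩
  have hpos : (0:ℝ) < (1/2)^(q + c0 d + k) := by positivity
  by_cases hx : ∃ x, a X t' x ≠ a X t x
  · have hx1 := Nat.find_spec hx
    have hx2 : ∀ y < Nat.find hx, a X t' y = a X t y := fun y hy => by
      have := Nat.find_min hx hy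
      push Not at this
      exact this
    generalize Nat.find hx = x at hx1 hx2
    have hsum : (∑ j ∈ Finset.range k, if isZ E j = true ∧
        seg (a X t') (sg E j).length ≠ seg (a X t) (sg E j).length then ew E j else 0) +
        zw E k (x+1) ≤ zC E k := by
      unfold zw zC
      rw [← Finset.sum_add_distrib]
      apply Finset.sum_le_sum
      intro j _
      by_cases hz : isZ E j = true
      · have hew : 0 ≤ ew E j := by rw [ew_isZ hz]; positivity
        by_cases hl : (sg E j).length < x + 1
        · have : seg (a X t') (sg E j).length = seg (a X t) (sg E j).length :=
            seg_eq_iff.2 fun y hy => hx2 y (by omega)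
          simp [hz, hl, this]
        · simp only [hz, hl, true_and, if_false, add_zero, if_true]
          split_ifs
          · exact le_rfl
          · exact hew
      · simp [hz]
    have hJ := hb.J X (x+1)
    have hsplit := us_split (fun v => actB E a t X v = true) (fun v => v.2.1 < x + 1) (fl P)
    have hsp2 := us_split (fun v => lostB E a t' v = true ∧ labB E a v = X)
      (fun v => lostB E a t v = true) (fl P)
    have h1 : XL E a X t P ≤ us (fun v => (lostB E a t' v = true ∧ labB E a v = X) ∧
        lostB E a t v = true) (fl P) :=
      us_mono fun v hv' h1 => ⟨⟨h.lost_mono (hv v hv') ht h1.1, h1.2⟩, h1.1⟩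
    have h2 : us (fun v => actB E a t X v = true ∧ ¬ v.2.1 < x + 1) (fl P) ≤
        us (fun v => (lostB E a t' v = true ∧ labB E a v = X) ∧ ¬ lostB E a t v = true) (fl P) := by
      refine us_mono fun v hv' h1 => ?_
      obtain ⟨h1, h2⟩ := h1
      unfold actB at h1
      rw [Bool.and_eq_true, decide_eq_true_eq] at h1
      obtain ⟨h3, h4⟩ := h1
      refine ⟨⟨?_, h3⟩, by simpa using h4⟩
      unfold lostB chgB
      rw [h3]
      simp only [Bool.not_eq_true', decide_eq_false_iff_not]
      intro h5
      have h6 := seg_eq_iff.1 h5 x (by omega)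
      have h7 := mono_agree (h.mono X) (hv v hv') ht h6.symm
      exact hx1 (h6.trans h7)
    have hXL : XL E a X t' P = us (fun v => lostB E a t' v = true ∧ labB E a v = X) (fl P) := rfl
    have hac : ac E a t X P = us (fun v => actB E a t X v = true) (fl P) := rfl
    have hη : (0:ℝ) < (1/2)^(q + c0 d) := by positivity
    have h8 := mul_le_mul_of_nonneg_left hsum hη.le
    rw [mul_add] at h8
    linarith
  · push Not at hx
    have : ∀ n, seg (a X t') n = seg (a X t) n := fun n => seg_eq_iff.2 fun y _ => hx y
    simp only [this, ne_eq, not_true_eq_false, and_false, if_false, Finset.sum_const_zero, mul_zero]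
    linarith

end Ctx

/-! ### The side with infinitely many events is trivial -/

/-- time and counter of the last event -/
def lst (E : ℕ → Option (Str × Str)) (a : Bool → ℕ → ℕ → Bool) (d : ℕ) (X : Bool) (l τ0 T : ℕ) :
    ℕ × ℕ :=
  Nat.rec (0, 0) (fun T x => cond (evB E a d X l τ0 T)
    ((run E a d T).1, (run E a d T).2.head?.elim 0 fun f => f.1.2.2.2) x) T

section
variable {α : Type*} [Primcodable α] {E : ℕ → Option (Str × Str)} {a : Bool → ℕ → ℕ → Bool}

theorem pr_evF (hE : Primrec E) (ha : Primrec fun p : Bool × ℕ × ℕ => a p.1 p.2.1 p.2.2)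
    (d : ℕ) (X : Bool) {t : α → ℕ} {f : α → Frm} (ht : Primrec t) (hf : Primrec f) :
    Primrec (fun x => evF E a d X (t x) (f x)) := by
  have h1 := pr_fullB hE ha ht hf
  have h2 := pr_cmpX hE ha (pr_const d) ht (pr_const X) hf
  unfold evF
  fun_prop

theorem pr_evB (hE : Primrec E) (ha : Primrec fun p : Bool × ℕ × ℕ => a p.1 p.2.1 p.2.2)
    (d : ℕ) (X : Bool) (l τ0 : ℕ) {T : α → ℕ} (hT : Primrec T) :
    Primrec (fun x => evB E a d X l τ0 (T x)) := by
  have h1 := pr_run hE ha (pr_const d) hT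
  have h3 : Primrec fun p : α × Frm => run E a d (T p.1) := h1.comp Primrec.fst
  have h2 : Primrec fun p : α × Frm => evF E a d X (run E a d (T p.1)).1 p.2 :=
    pr_evF hE ha d X (by fun_prop) (by fun_prop)
  unfold evB
  fun_prop

theorem pr_lst (hE : Primrec E) (ha : Primrec fun p : Bool × ℕ × ℕ => a p.1 p.2.1 p.2.2)
    (d : ℕ) (X : Bool) (l τ0 : ℕ) {T : α → ℕ} (hT : Primrec T) :
    Primrec (fun x => lst E a d X l τ0 (T x)) := by
  have h1 : Primrec fun p : α × ℕ × ℕ × ℕ => run E a d p.2.1 :=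
    pr_run hE ha (pr_const d) (by fun_prop)
  have h2 : Primrec fun p : α × ℕ × ℕ × ℕ => evB E a d X l τ0 p.2.1 :=
    pr_evB hE ha d X l τ0 (by fun_prop)
  unfold lst
  exact pr_rec hT (by fun_prop) (by fun_prop)

end

namespace Ctx
variable {U : Str →. Str} {E : ℕ → Option (Str × Str)} {a : Bool → ℕ → ℕ → Bool} {d : ℕ}
variable {τ0 : ℕ} {R : List Frm} {pr : ℕ → List Frm} {fr : ℕ → Frm} {X : Bool}

theorem lst_of_ev (hp : Perm E a d τ0 R pr fr) {T : ℕ}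
    (h : evB E a d X (R.length+1) τ0 T = true) :
    lst E a d X (R.length+1) τ0 (T+1) = ((run E a d T).1, (fr T).1.2.2.2) := by
  show cond (evB E a d X (R.length+1) τ0 T) _ _ = _
  rw [h, evB_head hp h]; rfl

theorem lst_of_not {l T : ℕ} (h : evB E a d X l τ0 T = false) :
    lst E a d X l τ0 (T+1) = lst E a d X l τ0 T := by
  show cond (evB E a d X l τ0 T) _ _ = _
  rw [h]; rfl

/-- facts at an event -/
theorem event_facts (h : Ctx U E a) (hp : Perm E a d τ0 R pr fr) {T : ℕ}
    (he : evB E a d X (R.length+1) τ0 T = true) :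
    Base E a d (Qd E a d) (run E a d T).1 (fr T).1.1 (fr T).1.2.1
      (fr T).1.2.2.1 (fr T).1.2.2.2 (fr T).2.1 (run E a d T).1 ∧
    (1/2:ℝ)^((fr T).1.2.1 + c0 d) * zC E (fr T).1.2.2.2 <
      ac E a (run E a d T).1 X (fr T).2.1 + (1/2)^((fr T).1.2.1 + c0 d + (fr T).1.2.2.2) ∧
    XL E a X (run E a d T).1 (fr T).2.1 ≤ (1/2:ℝ)^(fr T).1.2.1 := by
  obtain ⟨h1, h2, h3⟩ := (evB_iff hp).1 he
  obtain ⟨_, e2, e3, e4⟩ := evo_event h3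
  have hb : Base E a d (Qd E a d) (run E a d T).1 (fr T).1.1 (fr T).1.2.1
      (fr T).1.2.2.1 (fr T).1.2.2.2 (fr T).2.1 (run E a d T).1 := by
    rcases h.perm_top hp h1 h2 with ⟨_, hb⟩ | ⟨s', G, h4, _⟩
    · exact hb
    · rw [e2] at h4; simp at h4
  have hu : ∀ v ∈ fl (fr T).2.1, v.2.2 ≤ (run E a d T).1 := fun v hv =>
    (base_units hb hv).2.2.2.2.1
  refine ⟨hb, (h.cmpX_iff hu hb.tm).1 e4, (XL_le_loss _ _ _).trans ?_⟩
  by_contra hcon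
  have := (fullB_iff (E := E) (a := a) (f := fr T) hu (by have := hb.tm; omega)).2
    (not_le.1 hcon).le
  rw [e3] at this
  exact Bool.noConfusion this

/-- mass of the changes of step `s` -/
noncomputable def dl (E : ℕ → Option (Str × Str)) (a : Bool → ℕ → ℕ → Bool) (X : Bool)
    (x y : ℕ × ℕ) : ℝ :=
  ∑ j ∈ Finset.range y.2, if isZ E j = true ∧ (x.2 ≤ j ∨
    seg (a X y.1) (sg E j).length ≠ seg (a X x.1) (sg E j).length) then ew E j else 0

theorem dl_zero (E : ℕ → Option (Str × Str)) (a : Bool → ℕ → ℕ → Bool) (X : Bool)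
    (x : ℕ × ℕ) : dl E a X x x = 0 := by
  unfold dl
  apply Finset.sum_eq_zero
  intro j hj
  rw [Finset.mem_range] at hj
  rw [if_neg]
  rintro ⟨_, h | h⟩
  · omega
  · exact h rfl

theorem dl_first (y : ℕ × ℕ) : dl E a X (0, 0) y = zC E y.2 := by
  unfold dl zC
  simp

theorem dl_split {x y : ℕ × ℕ} (h : x.2 ≤ y.2) : dl E a X x y =
    (∑ j ∈ Finset.range x.2, if isZ E j = true ∧
      seg (a X y.1) (sg E j).length ≠ seg (a X x.1) (sg E j).length then ew E j else 0) +
    (zC E y.2 - zC E x.2) := by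
  unfold dl zC
  rw [Finset.range_eq_Ico, Finset.range_eq_Ico,
    ← Finset.sum_Ico_consecutive _ (Nat.zero_le _) h,
    ← Finset.sum_Ico_consecutive (fun j => if isZ E j = true then ew E j else 0) (Nat.zero_le _) h,
    add_sub_cancel_left]
  congr 1
  · apply Finset.sum_congr rfl
    intro j hj
    rw [Finset.mem_Ico] at hj
    have : ¬ x.2 ≤ j := by omega
    simp [this]
  · apply Finset.sum_congr rfl
    intro j hj
    rw [Finset.mem_Ico] at hj
    simp [hj.1]

/-- total mass of the changes -/
theorem total (h : Ctx U E a) (hp : Perm E a d τ0 R pr fr) (S : ℕ) :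
    (lst E a d X (R.length+1) τ0 S = (0, 0) ∧
      ∑ s ∈ Finset.range S, dl E a X (lst E a d X (R.length+1) τ0 s)
        (lst E a d X (R.length+1) τ0 (s+1)) = 0) ∨
    ∃ T < S, evB E a d X (R.length+1) τ0 T = true ∧
      lst E a d X (R.length+1) τ0 S = ((run E a d T).1, (fr T).1.2.2.2) ∧
      (1/2:ℝ)^((fr τ0).1.2.1 + c0 d) * ∑ s ∈ Finset.range S,
        dl E a X (lst E a d X (R.length+1) τ0 s) (lst E a d X (R.length+1) τ0 (s+1)) ≤
      (1/2:ℝ)^((fr τ0).1.2.1 + c0 d) * (zC E (fr T).1.2.2.2 + 2 - 2 * (1/2)^(fr T).1.2.2.2) +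
        XL E a X (run E a d T).1 (fr T).2.1 := by
  induction S with
  | zero => exact Or.inl ⟨rfl, rfl⟩
  | succ S ih =>
    cases he : evB E a d X (R.length+1) τ0 S with
    | false =>
      rw [Finset.sum_range_succ, lst_of_not he, dl_zero, add_zero]
      rcases ih with ih | ⟨T, hT, ih⟩
      · exact Or.inl ih
      · exact Or.inr ⟨T, by omega, ih⟩
    | true =>
      right
      refine ⟨S, Nat.lt_succ_self S, he, lst_of_ev hp he, ?_⟩
      obtain ⟨hτ, _, _⟩ := (evB_iff hp).1 he
      rw [Finset.sum_range_succ, lst_of_ev hp he]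
      have hη : (0:ℝ) < (1/2)^((fr τ0).1.2.1 + c0 d) := by positivity
      rcases ih with ⟨h1, h2⟩ | ⟨T, hT, hev, h1, h2⟩
      · rw [h1, h2, dl_first, zero_add]
        have h3 : 0 ≤ XL E a X (run E a d S).1 (fr S).2.1 := us_nonneg _ _
        have h4 : (1/2:ℝ)^(fr S).1.2.2.2 ≤ 1 := pow_le_one₀ (by norm_num) (by norm_num)
        have h5 : (1/2:ℝ)^((fr τ0).1.2.1 + c0 d) * zC E (fr S).1.2.2.2 ≤
            (1/2:ℝ)^((fr τ0).1.2.1 + c0 d) *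
              (zC E (fr S).1.2.2.2 + 2 - 2 * (1/2)^(fr S).1.2.2.2) :=
          mul_le_mul_of_nonneg_left (by linarith) hη.le
        simp only
        linarith
      · obtain ⟨hτT, _, _⟩ := (evB_iff hp).1 hev
        obtain ⟨hb, hc, _⟩ := h.event_facts hp hev
        have hk1 := event_step hp hev
        obtain ⟨_, _, hk2, _, _⟩ := perm_mono hp (by omega : τ0 ≤ T+1) (by omega : T+1 ≤ S)
        obtain ⟨_, _, _, hsuf, _⟩ := perm_mono hp hτT (by omega : T ≤ S)
        have hq := (perm_mono hp le_rfl hτT).2.1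
        have hch := h.change_bound hb ((h.run_time_mono (d := d)).monotone (by omega : T ≤ S))
          hsuf hc
        rw [h1, dl_split (by simp only; omega), mul_add]
        simp only at hch ⊢
        rw [hq] at hch
        generalize hSum : (∑ j ∈ Finset.range (fr T).1.2.2.2, if isZ E j = true ∧
          seg (a X (run E a d S).1) (sg E j).length ≠ seg (a X (run E a d T).1) (sg E j).length
          then ew E j else 0) = Sm at hch ⊢
        have hpow : 2 * (1/2:ℝ)^(fr S).1.2.2.2 ≤ (1/2)^(fr T).1.2.2.2 := by
          have : (1/2:ℝ)^(fr S).1.2.2.2 ≤ (1/2)^((fr T).1.2.2.2 + 1) :=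
            pow_le_pow_of_le_one (by norm_num) (by norm_num) (by omega)
          rw [pow_succ] at this
          linarith
        have hpow' := mul_le_mul_of_nonneg_left hpow hη.le
        rw [pow_add] at hch
        rw [pow_add (1/2:ℝ) _ (fr T).1.2.2.2] at hch
        rw [← pow_add] at hch
        nlinarith

theorem total_le (h : Ctx U E a) (hp : Perm E a d τ0 R pr fr) (S : ℕ) :
    ∑ s ∈ Finset.range S, dl E a X (lst E a d X (R.length+1) τ0 s)
        (lst E a d X (R.length+1) τ0 (s+1)) ≤ 2^(c0 d + 2) := by
  have hone : (1:ℝ) ≤ 2^(c0 d) := one_le_pow₀ (by norm_num)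
  rcases h.total hp (X := X) S with ⟨_, h1⟩ | ⟨T, hT, hev, _, h1⟩
  · rw [h1]; positivity
  · obtain ⟨hb, _, hl⟩ := h.event_facts hp hev
    have hq := (perm_mono hp le_rfl ((evB_iff hp).1 hev).1).2.1
    rw [hq] at hl
    have hz := h.zC_le_one (fr T).1.2.2.2
    have hη : (0:ℝ) < (1/2)^((fr τ0).1.2.1 + c0 d) := by positivity
    have hpk : (0:ℝ) < (1/2)^(fr T).1.2.2.2 := by positivity
    have h2 : (1/2:ℝ)^(fr τ0).1.2.1 = (1/2)^((fr τ0).1.2.1 + c0 d) * 2^(c0 d) := by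
      rw [pow_add, mul_assoc, mul_comm ((1/2:ℝ)^(c0 d)), two_mul_half, mul_one]
    rw [h2] at hl
    have h3 : (1/2:ℝ)^((fr τ0).1.2.1 + c0 d) *
        (zC E (fr T).1.2.2.2 + 2 - 2 * (1/2)^(fr T).1.2.2.2) ≤
        (1/2:ℝ)^((fr τ0).1.2.1 + c0 d) * 3 := mul_le_mul_of_nonneg_left (by linarith) hη.le
    refine le_of_mul_le_mul_left (h1.trans ((add_le_add h3 hl).trans ?_)) hη
    rw [← mul_add]
    refine mul_le_mul_of_nonneg_left ?_ hη.le
    rw [pow_add]; linarith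

theorem trivial_of_events (h : Ctx U E a) (hp : Perm E a d τ0 R pr fr) {A : Set ℕ}
    (hA : IsApprox A (a X)) (hinf : ∀ B, ∃ T ≥ B, evB E a d X (R.length+1) τ0 T = true) :
    KTrivialSet U A := by
  have hE := h.hE.prim
  obtain ⟨L, hL⟩ : ∃ L, L = lst E a d X (R.length+1) τ0 := ⟨_, rfl⟩
  have hLp : Primrec L := by
    rw [hL]; exact pr_lst (α := ℕ) hE h.ha d X _ τ0 Primrec.id
  have hz := pr_isZ hE
  have hrl : Primrec (rl E) := pr_rl hE Primrec.id
  have hsg : Primrec (sg E) := pr_sg hE Primrec.id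
  obtain ⟨c, hc⟩ := track h.hU (fun s j => decide (j < (L s).2) && isZ E j)
    (fun s j => seg (a X (L s).1) (sg E j).length) (rl E) (by fun_prop) (by
      exact pr_seg (g := fun p : ℕ × ℕ => a X (L p.1).1)
        (pr_a h.ha (by fun_prop) (by fun_prop) (by fun_prop)) (by fun_prop)) hrl
    (by intro j; rw [hL]; simp [lst]) (c0 d + 2) (by
      intro S
      refine le_trans (Finset.sum_le_sum fun s _ => ?_) (h.total_le hp (X := X) S)
      rw [← hL]
      have hnn : ∀ j, 0 ≤ (if isZ E j = true ∧ j < (L (s+1)).2 ∧ ((L s).2 ≤ j ∨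
          seg (a X (L (s+1)).1) (sg E j).length ≠ seg (a X (L s).1) (sg E j).length)
          then ew E j else 0) := by
        intro j
        split_ifs with h1
        · rw [ew_isZ h1.1]; positivity
        · exact le_rfl
      calc _ ≤ ∑ j ∈ Finset.range S, (if isZ E j = true ∧ j < (L (s+1)).2 ∧ ((L s).2 ≤ j ∨
          seg (a X (L (s+1)).1) (sg E j).length ≠ seg (a X (L s).1) (sg E j).length)
          then ew E j else 0) := by
            apply Finset.sum_le_sum
            intro j _
            by_cases h1 : isZ E j = true
            · rw [ew_isZ h1]
              apply le_of_eq
              congr 1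
              simp only [h1, Bool.and_true, decide_eq_true_eq, decide_eq_false_iff_not, not_lt,
                true_and]
            · simp [h1]
        _ ≤ ∑ j ∈ Finset.range (max S (L (s+1)).2), (if isZ E j = true ∧ j < (L (s+1)).2 ∧
          ((L s).2 ≤ j ∨
          seg (a X (L (s+1)).1) (sg E j).length ≠ seg (a X (L s).1) (sg E j).length)
          then ew E j else 0) :=
            Finset.sum_le_sum_of_subset_of_nonneg
              (Finset.range_subset_range.2 (le_max_left _ _)) fun j _ _ => hnn j
        _ = dl E a X (L s) (L (s+1)) := by
            unfold dl
            symm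
            rw [← Finset.sum_subset (Finset.range_subset_range.2 (le_max_right S (L (s+1)).2))]
            · apply Finset.sum_congr rfl
              intro j hj
              rw [Finset.mem_range] at hj
              simp [hj]
            · intro j _ hj
              rw [Finset.mem_range] at hj
              simp [hj])
  refine ⟨c, fun n => le_KC_add fun ρ hρ => ?_⟩
  obtain ⟨j, hj⟩ := h.hE.complete _ _ hρ
  have hsgj : sg E j = zeroStr n := by simp [sg, hj]
  have hrlj : rl E j = ρ.length := by simp [rl, hj]
  have hzj : isZ E j = true := by
    unfold isZ
    rw [hsgj, hj]
    simp [zeroStr]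
  obtain ⟨t0, ht0⟩ := approx_agree hA n
  -- event with large counter
  have hk : ∀ m, ∃ T, evB E a d X (R.length+1) τ0 T = true ∧ m ≤ (fr T).1.2.2.2 := by
    intro m
    induction m with
    | zero =>
      obtain ⟨T, _, hT⟩ := hinf 0
      exact ⟨T, hT, Nat.zero_le _⟩
    | succ m ih =>
      obtain ⟨T, hT, h1⟩ := ih
      obtain ⟨T', h2, h3⟩ := hinf (T+1)
      refine ⟨T', h3, ?_⟩
      have h4 := event_step hp hT
      have h5 := (perm_mono hp (by have := ((evB_iff hp).1 hT).1; omega : τ0 ≤ T + 1) h2).2.2.1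
      omega
  obtain ⟨T1, hT1, hk1⟩ := hk (j+1)
  obtain ⟨T, hT, hev⟩ := hinf (max T1 t0)
  have hk2 := (perm_mono hp ((evB_iff hp).1 hT1).1 (le_trans (le_max_left _ _) hT)).2.2.1
  have htm : T ≤ (run E a d T).1 := (h.run_time_mono (d := d)).le_apply
  have hLT : L (T+1) = ((run E a d T).1, (fr T).1.2.2.2) := by rw [hL]; exact lst_of_ev hp hev
  have := hc (T+1) j (by
    rw [hLT, hzj]
    simp only [Bool.and_true, decide_eq_true_eq]
    omega)
  rw [hLT, hsgj, hrlj] at this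
  rw [restrSet_eq_seg]
  have hl : (zeroStr n).length = n := by simp [zeroStr]
  rw [hl] at this
  have heq : seg (a X (run E a d T).1) n = seg (fun i => decide (i ∈ A)) n :=
    seg_eq_iff.2 fun x hx => ht0 _ (by have := le_max_right T1 t0; omega) x hx
  simp only [heq] at this
  exact this

end Ctx

theorem main_aux (U : Str →. Str) (hU : OptimalPF U) (A D : Set ℕ) (hA : CESet A) (hD : CESet D)
    (hAnt : ¬ KTrivialSet U A) (hDnt : ¬ KTrivialSet U D) :
    ∃ B : Set ℕ, CESet B ∧ ¬ KTrivialSet U B ∧ KLeSet U B A ∧ KLeSet U B D := by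
  obtain ⟨E, hE⟩ := exists_enum hU.1.1
  obtain ⟨aA, haA⟩ := exists_approx hA
  obtain ⟨aD, haD⟩ := exists_approx hD
  obtain ⟨b, act, hB⟩ := exists_isB hE haA.prim haD.prim
  refine ⟨_, ce_of_approx hB.approx, fun htriv => ?_,
    hB.le_of_dom hU hE haA fun s hs => ?_, hB.le_of_dom hU hE haD fun s hs => ?_⟩
  · let a : Bool → ℕ → ℕ → Bool := fun X s x => cond X (aA s x) (aD s x)
    have hctx : Ctx U E a := by
      refine ⟨hU, hE, ?_, fun X => ?_⟩
      · have h1 := haA.prim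
        have h2 := haD.prim
        have h3 : Primrec fun p : Bool × ℕ × ℕ => aA p.2.1 p.2.2 := h1.comp Primrec.snd
        have h4 : Primrec fun p : Bool × ℕ × ℕ => aD p.2.1 p.2.2 := h2.comp Primrec.snd
        exact Primrec.cond Primrec.fst h3 h4
      · cases X with
        | true => exact haA.mono
        | false => exact haD.mono
    obtain ⟨c, hrep⟩ := hB.reply hU hE haA haD htriv
    obtain ⟨e, he⟩ := hctx.issued_K
    obtain ⟨τ0, R, pr, fr, hp⟩ := hctx.exists_perm (d := c + e + 1)
    have hans : Ctx.Ans E a (c + e + 1) := fun G hnd hQ => Ctx.answered rfl hrep he hnd hQ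
    obtain ⟨X, hX⟩ := hctx.event_side hp hans
    cases X with
    | true => exact hAnt (hctx.trivial_of_events hp (X := true) haA hX)
    | false => exact hDnt (hctx.trivial_of_events hp (X := false) haD hX)
  · have h1 := ((hB.act_iff s).1 hs).2.1
    have h2 := mass_nonneg E (aD s) s.unpair.1 s
    linarith
  · have h1 := ((hB.act_iff s).1 hs).2.1
    have h2 := mass_nonneg E (aA s) s.unpair.1 s
    linarith

/-- There are no minimal pairs in the `K`-degrees of c.e. sets:
for any c.e. sets `A`, `D`, neither `K`-trivial, there is a c.e. set `B` that is
not `K`-trivial with `B ≤_K A` and `B ≤_K D`. -/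
theorem stmt6 (U : Str →. Str) (hU : OptimalPF U)
    (A D : Set ℕ) (hA : CESet A) (hD : CESet D)
    (hAnt : ¬ KTrivialSet U A) (hDnt : ¬ KTrivialSet U D) :
    ∃ B : Set ℕ, CESet B ∧ ¬ KTrivialSet U B ∧ KLeSet U B A ∧ KLeSet U B D := main_aux U hU A D hA hD hAnt hDnt

end KPaper
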